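/- arXiv:2004.12558 — 4 statements merged into one kernel-verified Lean document; each statement's English description precedes it below -/
import Mathlib

section
/- There exist ε_0 > 0 and N such that for every ε with 0 < ε ≤ ε_0 and every n ∈ 3ℤ with n ≥ N the following holds: let H be a balanced (1,3)-partite 4-graph with partition classes Q, P and 3|Q| = |P| = n; suppose H is ε-close to some H_{1,3}(n, n/3) whose larger class equals P and whose smaller class equals Q; if d_H({u, v}) ≥ C(n−1, 2) − C(2n/3, 2) + 1 for all u ∈ P and v ∈ Q, then H has a perfect matching. -/
/-- The extremal (1,3)-partite 4-graph `H_{1,3}(n, n/3)`: assuming `Q, P` partition the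
vertex set and `W ⊆ P`, its edges are exactly the sets `s` with `|s ∩ Q| = 1`,
`|s ∩ P| = 3`, `(s ∩ P) ∩ W ≠ ∅` and `¬ s ∩ P ⊆ W`. -/
def extremalH13 {V : Type*} [Fintype V] [DecidableEq V] (Q P W : Finset V) :
    Finset (Finset V) :=
  Finset.univ.filter (fun e =>
    (e ∩ Q).card = 1 ∧ (e ∩ P).card = 3 ∧ (e ∩ P ∩ W).Nonempty ∧ ¬ e ∩ P ⊆ W)


section generic
set_option linter.unusedSectionVars false
set_option linter.unusedSimpArgs false
variable {V : Type*} [Fintype V] [DecidableEq V]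

theorem avoid3 (T : Finset (V × V × V)) (Y : Finset V)
    (h : 3 * Y.card * (Fintype.card V) ^ 2 < T.card) :
    ∃ a b c, (a, b, c) ∈ T ∧ a ∉ Y ∧ b ∉ Y ∧ c ∉ Y := by
  by_contra hc
  push Not at hc
  have hsub : T ⊆ (Y ×ˢ (Finset.univ : Finset V) ×ˢ (Finset.univ : Finset V)) ∪
      ((Finset.univ : Finset V) ×ˢ Y ×ˢ (Finset.univ : Finset V)) ∪
      ((Finset.univ : Finset V) ×ˢ (Finset.univ : Finset V) ×ˢ Y) := by
    rintro ⟨a, b, c⟩ ht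
    have := hc a b c ht
    simp only [Finset.mem_union, Finset.mem_product, Finset.mem_univ, true_and, and_true]
    tauto
  have h1 := Finset.card_le_card hsub
  have h2 := Finset.card_union_le ((Y ×ˢ (Finset.univ : Finset V) ×ˢ (Finset.univ : Finset V)) ∪
      ((Finset.univ : Finset V) ×ˢ Y ×ˢ (Finset.univ : Finset V)))
      ((Finset.univ : Finset V) ×ˢ (Finset.univ : Finset V) ×ˢ Y)
  have h3 := Finset.card_union_le (Y ×ˢ (Finset.univ : Finset V) ×ˢ (Finset.univ : Finset V))
      ((Finset.univ : Finset V) ×ˢ Y ×ˢ (Finset.univ : Finset V))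
  simp only [Finset.card_product, Finset.card_univ] at h2 h3
  nlinarith

theorem avoid4 (T : Finset (V × V × V × V)) (Y : Finset V)
    (h : 4 * Y.card * (Fintype.card V) ^ 3 < T.card) :
    ∃ a b c d, (a, b, c, d) ∈ T ∧ a ∉ Y ∧ b ∉ Y ∧ c ∉ Y ∧ d ∉ Y := by
  by_contra hc
  push Not at hc
  set u := (Finset.univ : Finset V) with hu
  have hsub : T ⊆ ((Y ×ˢ u ×ˢ u ×ˢ u) ∪ (u ×ˢ Y ×ˢ u ×ˢ u)) ∪
      ((u ×ˢ u ×ˢ Y ×ˢ u) ∪ (u ×ˢ u ×ˢ u ×ˢ Y)) := by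
    rintro ⟨a, b, c, d⟩ ht
    have := hc a b c d ht
    simp only [hu, Finset.mem_union, Finset.mem_product, Finset.mem_univ, true_and, and_true]
    tauto
  have h1 := Finset.card_le_card hsub
  have h2 := Finset.card_union_le ((Y ×ˢ u ×ˢ u ×ˢ u) ∪ (u ×ˢ Y ×ˢ u ×ˢ u))
      ((u ×ˢ u ×ˢ Y ×ˢ u) ∪ (u ×ˢ u ×ˢ u ×ˢ Y))
  have h3 := Finset.card_union_le (Y ×ˢ u ×ˢ u ×ˢ u) (u ×ˢ Y ×ˢ u ×ˢ u)
  have h4 := Finset.card_union_le (u ×ˢ u ×ˢ Y ×ˢ u) (u ×ˢ u ×ˢ u ×ˢ Y)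
  have hcu : u.card = Fintype.card V := Finset.card_univ
  simp only [Finset.card_product, hcu] at h2 h3 h4
  nlinarith

theorem card_filter_prod {α β : Type*} (A : Finset α) (B : Finset β) (R : α × β → Prop)
    [DecidablePred R] :
    ((A ×ˢ B).filter R).card = ∑ a ∈ A, (B.filter (fun b => R (a, b))).card := by
  rw [Finset.card_filter, Finset.sum_product]
  refine Finset.sum_congr rfl fun a _ => ?_
  rw [Finset.card_filter]

/-- Sets that are exactly covered by a matching contained in `H`. -/
def Cov (H : Finset (Finset V)) (X : Finset V) : Prop :=
  ∃ M ⊆ H, (∀ e ∈ M, ∀ f ∈ M, e ≠ f → Disjoint e f) ∧ M.biUnion id = X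

theorem Cov.empty (H : Finset (Finset V)) : Cov H (∅ : Finset V) :=
  ⟨∅, by simp, by simp, by simp⟩

theorem Cov.insert {H : Finset (Finset V)} {X e : Finset V} (h : Cov H X) (he : e ∈ H)
    (hd : Disjoint e X) : Cov H (X ∪ e) := by
  obtain ⟨M, hM, hdis, hX⟩ := h
  have key : ∀ f ∈ M, Disjoint e f := by
    intro f hf
    refine Finset.disjoint_of_subset_right ?_ hd
    rw [← hX]
    exact Finset.subset_biUnion_of_mem id hf
  refine ⟨Insert.insert e M, ?_, ?_, ?_⟩
  · intro f hf
    rcases Finset.mem_insert.1 hf with rfl | hf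
    · exact he
    · exact hM hf
  · intro f hf g hg hne
    rcases Finset.mem_insert.1 hf with hf' | hf' <;> rcases Finset.mem_insert.1 hg with hg' | hg'
    · exact absurd (hf'.trans hg'.symm) hne
    · rw [hf']; exact key _ hg'
    · rw [hg']; exact (key _ hf').symm
    · exact hdis f hf' g hg' hne
  · rw [Finset.biUnion_insert, hX, id, Finset.union_comm]

theorem Cov.family {ι : Type*} [DecidableEq ι] {H : Finset (Finset V)} {X : Finset V}
    (h : Cov H X) (e : ι → Finset V) (he : ∀ i, e i ∈ H) (hd : ∀ i, Disjoint (e i) X)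
    (hp : ∀ i j, i ≠ j → Disjoint (e i) (e j)) (s : Finset ι) : Cov H (X ∪ s.biUnion e) := by
  induction s using Finset.induction_on with
  | empty => simpa using h
  | insert i s hi ih =>
    have : X ∪ (Insert.insert i s).biUnion e = (X ∪ s.biUnion e) ∪ e i := by
      rw [Finset.biUnion_insert, Finset.union_assoc, Finset.union_comm (e i)]
    rw [this]
    refine ih.insert (he i) ?_
    rw [Finset.disjoint_union_right, Finset.disjoint_biUnion_right]
    refine ⟨hd i, fun j hj => hp i j ?_⟩
    rintro rfl
    exact hi hj

end generic

section latin
variable {ι : Type*} [Fintype ι] [DecidableEq ι]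

theorem card_reindex (p q : ι × ι × ι → Prop) {_ : DecidablePred p} {_ : DecidablePred q}
    (f : ι × ι × ι → ι × ι × ι) (hf : Function.Injective f) (h : ∀ t, p t → q (f t)) :
    (Finset.univ.filter p).card ≤ (Finset.univ.filter q).card := by
  refine Finset.card_le_card_of_injOn f ?_ hf.injOn
  intro t ht
  simp at ht ⊢
  exact h t ht

theorem latin (R : ι → ι → ι → ι → Prop) [∀ a b c d, Decidable (R a b c d)] (β : ℕ)
    (h1 : ∀ i, (Finset.univ.filter (fun t : ι × ι × ι => ¬ R i t.1 t.2.1 t.2.2)).card ≤ β)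
    (h2 : ∀ i, (Finset.univ.filter (fun t : ι × ι × ι => ¬ R t.1 i t.2.1 t.2.2)).card ≤ β)
    (h3 : ∀ i, (Finset.univ.filter (fun t : ι × ι × ι => ¬ R t.1 t.2.1 i t.2.2)).card ≤ β)
    (h4 : ∀ i, (Finset.univ.filter (fun t : ι × ι × ι => ¬ R t.1 t.2.1 t.2.2 i)).card ≤ β)
    (hβ : 4 * β + 6 * (Fintype.card ι) ^ 2 < (Fintype.card ι) ^ 3) :
    ∃ s2 s3 s4 : Equiv.Perm ι, ∀ i, R i (s2 i) (s3 i) (s4 i) := by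
  classical
  obtain ⟨⟨s2, s3, s4⟩, -, hmax⟩ := Finset.exists_max_image
    (Finset.univ : Finset (Equiv.Perm ι × Equiv.Perm ι × Equiv.Perm ι))
    (fun s => (Finset.univ.filter (fun i => R i (s.1 i) (s.2.1 i) (s.2.2 i))).card)
    ⟨(1, 1, 1), Finset.mem_univ _⟩
  refine ⟨s2, s3, s4, ?_⟩
  by_contra hbad
  push Not at hbad
  obtain ⟨x, hx⟩ := hbad
  have hex : ∃ t : ι × ι × ι, R x (s2 t.1) (s3 t.2.1) (s4 t.2.2) ∧
      R t.1 (s2 x) (s3 t.2.2) (s4 t.2.1) ∧ R t.2.1 (s2 t.2.2) (s3 x) (s4 t.1) ∧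
      R t.2.2 (s2 t.2.1) (s3 t.1) (s4 x) ∧ t.1 ≠ x ∧ t.2.1 ≠ x ∧ t.2.2 ≠ x ∧
      t.1 ≠ t.2.1 ∧ t.1 ≠ t.2.2 ∧ t.2.1 ≠ t.2.2 := by
    by_contra hno
    push Not at hno
    set F : (ι × ι × ι → Prop) → Finset (ι × ι × ι) := fun p => Finset.univ.filter p with hF
    have hsub : (Finset.univ : Finset (ι × ι × ι)) ⊆
        (F (fun t => ¬ R x (s2 t.1) (s3 t.2.1) (s4 t.2.2)) ∪
        (F (fun t => ¬ R t.1 (s2 x) (s3 t.2.2) (s4 t.2.1)) ∪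
        (F (fun t => ¬ R t.2.1 (s2 t.2.2) (s3 x) (s4 t.1)) ∪
        (F (fun t => ¬ R t.2.2 (s2 t.2.1) (s3 t.1) (s4 x)) ∪
        (F (fun t => t.1 = x) ∪ (F (fun t => t.2.1 = x) ∪ (F (fun t => t.2.2 = x) ∪
        (F (fun t => t.1 = t.2.1) ∪ (F (fun t => t.1 = t.2.2) ∪
          F (fun t => t.2.1 = t.2.2)))))))))) := by
      intro t _
      have := hno t
      simp only [hF, Finset.mem_union, Finset.mem_filter, Finset.mem_univ, true_and]
      tauto
    have hc : ∀ p : ι × ι × ι → Prop, ∀ f : ι × ι × ι → ι × ι,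
        (∀ s t, p s → p t → f s = f t → s = t) → (F p).card ≤ (Fintype.card ι) ^ 2 := by
      intro p f hf
      have : (F p).card ≤ (Finset.univ : Finset (ι × ι)).card := by
        refine Finset.card_le_card_of_injOn f (fun _ _ => by simp) ?_
        intro s hs t ht hst
        simp [hF] at hs ht
        exact hf s t hs ht hst
      simpa [Fintype.card_prod, sq] using this
    have e1 : (F (fun t => ¬ R x (s2 t.1) (s3 t.2.1) (s4 t.2.2))).card ≤ β := by
      refine le_trans ?_ (h1 x)
      refine card_reindex _ _ (fun t => (s2 t.1, s3 t.2.1, s4 t.2.2)) ?_ (fun t ht => ht)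
      rintro ⟨a, b, c⟩ ⟨a', b', c'⟩ h
      simp at h ⊢; tauto
    have e2 : (F (fun t => ¬ R t.1 (s2 x) (s3 t.2.2) (s4 t.2.1))).card ≤ β := by
      refine le_trans ?_ (h2 (s2 x))
      refine card_reindex _ _ (fun t => (t.1, s3 t.2.2, s4 t.2.1)) ?_ (fun t ht => ht)
      rintro ⟨a, b, c⟩ ⟨a', b', c'⟩ h
      simp at h ⊢; tauto
    have e3 : (F (fun t => ¬ R t.2.1 (s2 t.2.2) (s3 x) (s4 t.1))).card ≤ β := by
      refine le_trans ?_ (h3 (s3 x))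
      refine card_reindex _ _ (fun t => (t.2.1, s2 t.2.2, s4 t.1)) ?_ (fun t ht => ht)
      rintro ⟨a, b, c⟩ ⟨a', b', c'⟩ h
      simp at h ⊢; tauto
    have e4 : (F (fun t => ¬ R t.2.2 (s2 t.2.1) (s3 t.1) (s4 x))).card ≤ β := by
      refine le_trans ?_ (h4 (s4 x))
      refine card_reindex _ _ (fun t => (t.2.2, s2 t.2.1, s3 t.1)) ?_ (fun t ht => ht)
      rintro ⟨a, b, c⟩ ⟨a', b', c'⟩ h
      simp at h ⊢; tauto
    have f1 := hc (fun t => t.1 = x) (fun t => t.2) (by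
      rintro ⟨a, b, c⟩ ⟨a', b', c'⟩; simp; grind)
    have f2 := hc (fun t => t.2.1 = x) (fun t => (t.1, t.2.2)) (by
      rintro ⟨a, b, c⟩ ⟨a', b', c'⟩; simp; grind)
    have f3 := hc (fun t => t.2.2 = x) (fun t => (t.1, t.2.1)) (by
      rintro ⟨a, b, c⟩ ⟨a', b', c'⟩; simp; grind)
    have f4 := hc (fun t => t.1 = t.2.1) (fun t => t.2) (by
      rintro ⟨a, b, c⟩ ⟨a', b', c'⟩; simp; grind)
    have f5 := hc (fun t => t.1 = t.2.2) (fun t => t.2) (by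
      rintro ⟨a, b, c⟩ ⟨a', b', c'⟩; simp; grind)
    have f6 := hc (fun t => t.2.1 = t.2.2) (fun t => (t.1, t.2.1)) (by
      rintro ⟨a, b, c⟩ ⟨a', b', c'⟩; simp; grind)
    have hle := Finset.card_le_card hsub
    have hu : (Finset.univ : Finset (ι × ι × ι)).card = (Fintype.card ι) ^ 3 := by
      rw [Finset.card_univ, Fintype.card_prod, Fintype.card_prod]; ring
    rw [hu] at hle
    have hle2 := hle.trans ((Finset.card_union_le _ _).trans (Nat.add_le_add e1
      ((Finset.card_union_le _ _).trans (Nat.add_le_add e2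
      ((Finset.card_union_le _ _).trans (Nat.add_le_add e3
      ((Finset.card_union_le _ _).trans (Nat.add_le_add e4
      ((Finset.card_union_le _ _).trans (Nat.add_le_add f1
      ((Finset.card_union_le _ _).trans (Nat.add_le_add f2
      ((Finset.card_union_le _ _).trans (Nat.add_le_add f3
      ((Finset.card_union_le _ _).trans (Nat.add_le_add f4
      ((Finset.card_union_le _ _).trans (Nat.add_le_add f5 f6))))))))))))))))))
    omega
  obtain ⟨⟨e, f, g⟩, r1, r2, r3, r4, n1, n2, n3, n4, n5, n6⟩ := hex
  simp only at r1 r2 r3 r4 n1 n2 n3 n4 n5 n6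
  have hm := hmax (s2 * (Equiv.swap x e * Equiv.swap f g), s3 * (Equiv.swap x f * Equiv.swap e g),
    s4 * (Equiv.swap x g * Equiv.swap e f)) (Finset.mem_univ _)
  simp only at hm
  refine absurd hm (not_le.2 (Finset.card_lt_card ?_))
  rw [Finset.ssubset_iff_of_subset]
  · refine ⟨x, ?_, ?_⟩
    · refine Finset.mem_filter.2 ⟨Finset.mem_univ _, ?_⟩
      simp only [Equiv.Perm.mul_apply]
      simpa [Equiv.swap_apply_of_ne_of_ne, n1.symm, n2.symm, n3.symm, Ne.symm] using r1
    · simpa using hx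
  · intro i hi
    simp only [Finset.mem_filter, Finset.mem_univ, true_and] at hi
    refine Finset.mem_filter.2 ⟨Finset.mem_univ _, ?_⟩
    simp only [Equiv.Perm.mul_apply]
    by_cases hix : i = x
    · subst hix; exact absurd hi hx
    by_cases hie : i = e
    · subst hie
      simpa [Equiv.swap_apply_of_ne_of_ne, n1, n2, n3, n4, n5, n6, n1.symm, n2.symm, n3.symm, n4.symm,
        n5.symm, n6.symm] using r2
    by_cases hif : i = f
    · subst hif
      simpa [Equiv.swap_apply_of_ne_of_ne, n1, n2, n3, n4, n5, n6, n1.symm, n2.symm, n3.symm, n4.symm,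
        n5.symm, n6.symm] using r3
    by_cases hig : i = g
    · subst hig
      simpa [Equiv.swap_apply_of_ne_of_ne, n1, n2, n3, n4, n5, n6, n1.symm, n2.symm, n3.symm, n4.symm,
        n5.symm, n6.symm] using r4
    simpa [Equiv.swap_apply_of_ne_of_ne, hix, hie, hif, hig] using hi

end latin


section ctx
set_option linter.unusedSectionVars false
variable {V : Type*} [Fintype V] [DecidableEq V]

/-- triples in `A × B × C` completing `x` to an edge -/
def d3 (H : Finset (Finset V)) (A B C : Finset V) (x : V) : Finset (V × V × V) :=
  (A ×ˢ B ×ˢ C).filter (fun t => ({x, t.1, t.2.1, t.2.2} : Finset V) ∈ H)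

/-- triples in `A × B × C` not completing `x` to an edge -/
def n3 (H : Finset (Finset V)) (A B C : Finset V) (x : V) : Finset (V × V × V) :=
  (A ×ˢ B ×ˢ C).filter (fun t => ({x, t.1, t.2.1, t.2.2} : Finset V) ∉ H)

theorem d3_add_n3 (H : Finset (Finset V)) (A B C : Finset V) (x : V) :
    (d3 H A B C x).card + (n3 H A B C x).card = A.card * (B.card * C.card) := by
  unfold d3 n3
  rw [Finset.card_filter_add_card_filter_not, Finset.card_product, Finset.card_product]

/-- the working context -/
structure Ctx (m : ℕ) (Q U W : Finset V) (H : Finset (Finset V)) : Prop where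
  hm : 10 ^ 9 ≤ m
  cV : Fintype.card V = 4 * m
  cQ : Q.card = m
  cU : U.card = 2 * m
  cW : W.card = m
  dQU : Disjoint Q U
  dQW : Disjoint Q W
  dUW : Disjoint U W
  cov : ∀ x, x ∈ Q ∨ x ∈ U ∨ x ∈ W
  hH : ∀ e ∈ H, (e ∩ Q).card = 1 ∧ (e ∩ (U ∪ W)).card = 3
  deg : ∀ u, u ∉ Q → ∀ v ∈ Q, 5 * m ^ 2 + 4 ≤
    (Finset.univ.filter (fun t : V × V => ({v, u, t.1, t.2} : Finset V) ∈ H)).card + 7 * m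
  miss1 : 10 ^ 7 * ((Q ×ˢ W ×ˢ U ×ˢ U).filter
    (fun t => ({t.1, t.2.1, t.2.2.1, t.2.2.2} : Finset V) ∉ H)).card ≤ m ^ 4
  miss2 : 10 ^ 7 * ((Q ×ˢ W ×ˢ W ×ˢ U).filter
    (fun t => ({t.1, t.2.1, t.2.2.1, t.2.2.2} : Finset V) ∉ H)).card ≤ m ^ 4

variable {m : ℕ} {Q U W : Finset V} {H : Finset (Finset V)}

namespace Ctx

theorem card4 (h : Ctx m Q U W H) {e : Finset V} (he : e ∈ H) : e.card = 4 := by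
  obtain ⟨h1, h2⟩ := h.hH e he
  have : e = (e ∩ Q) ∪ (e ∩ (U ∪ W)) := by
    ext x
    have := h.cov x
    simp only [Finset.mem_union, Finset.mem_inter]
    tauto
  rw [this, Finset.card_union_of_disjoint, h1, h2]
  have hd : Disjoint Q (U ∪ W) := Finset.disjoint_union_right.2 ⟨h.dQU, h.dQW⟩
  exact Finset.disjoint_of_subset_left Finset.inter_subset_right
    (Finset.disjoint_of_subset_right Finset.inter_subset_right hd)

theorem ne (h : Ctx m Q U W H) {a b c d : V} (he : ({a, b, c, d} : Finset V) ∈ H) :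
    a ≠ b ∧ a ≠ c ∧ a ≠ d ∧ b ≠ c ∧ b ≠ d ∧ c ≠ d := by
  have h4 := h.card4 he
  by_contra hcon
  have : (({a, b, c, d} : Finset V)).card ≤ 3 := by
    by_cases h1 : a = b
    · subst h1; simpa using Finset.card_le_three
    by_cases h2 : a = c
    · subst h2
      rw [Finset.insert_eq_of_mem (by simp)]; exact Finset.card_le_three
    by_cases h3 : a = d
    · subst h3
      rw [Finset.insert_eq_of_mem (by simp)]; exact Finset.card_le_three
    by_cases h4 : b = c
    · subst h4
      rw [Finset.insert_eq_of_mem (s := {b, d}) (by simp)]; exact Finset.card_le_three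
    by_cases h5 : b = d
    · subst h5
      rw [Finset.insert_eq_of_mem (s := {c, b}) (by simp)]; exact Finset.card_le_three
    by_cases h6 : c = d
    · subst h6; simpa using Finset.card_le_three
    exact absurd ⟨h1, h2, h3, h4, h5, h6⟩ hcon
  omega

theorem notQ (h : Ctx m Q U W H) {q a b c : V} (hq : q ∈ Q)
    (he : ({q, a, b, c} : Finset V) ∈ H) : a ∉ Q ∧ b ∉ Q ∧ c ∉ Q := by
  have h1 := (h.hH _ he).1
  obtain ⟨n1, n2, n3, -⟩ := h.ne he
  have key : ∀ x ∈ ({q, a, b, c} : Finset V), q ≠ x → x ∉ Q := by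
    intro x hx hne hxQ
    have : ({q, x} : Finset V) ⊆ {q, a, b, c} ∩ Q := by
      intro y hy
      simp only [Finset.mem_insert, Finset.mem_singleton] at hy
      rcases hy with rfl | rfl
      · simp [hq]
      · exact Finset.mem_inter.2 ⟨hx, hxQ⟩
    have h2 := Finset.card_le_card this
    rw [Finset.card_pair hne] at h2
    omega
  exact ⟨key a (by simp) n1, key b (by simp) n2, key c (by simp) n3⟩

theorem pair_deg (h : Ctx m Q U W H) {p q : V} (hp : p ∉ Q) (hq : q ∈ Q) :
    4 * m ^ 2 ≤ ((U ×ˢ U).filter (fun t => ({q, p, t.1, t.2} : Finset V) ∈ H)).card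
      + 2 * ((U ×ˢ W).filter (fun t => ({q, p, t.1, t.2} : Finset V) ∈ H)).card + 7 * m := by
  have hd := h.deg p hp q hq
  have hsub : (Finset.univ.filter (fun t : V × V => ({q, p, t.1, t.2} : Finset V) ∈ H)) ⊆
      (((U ×ˢ U).filter (fun t => ({q, p, t.1, t.2} : Finset V) ∈ H)) ∪
      ((U ×ˢ W).filter (fun t => ({q, p, t.1, t.2} : Finset V) ∈ H))) ∪
      (((W ×ˢ U).filter (fun t => ({q, p, t.1, t.2} : Finset V) ∈ H)) ∪ (W ×ˢ W)) := by
    rintro ⟨a, b⟩ hab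
    simp only [Finset.mem_filter, Finset.mem_univ, true_and] at hab
    obtain ⟨-, ha, hb⟩ := h.notQ hq hab
    have := h.cov a
    have := h.cov b
    simp only [Finset.mem_union, Finset.mem_filter, Finset.mem_product]
    tauto
  have hsw : ((W ×ˢ U).filter (fun t => ({q, p, t.1, t.2} : Finset V) ∈ H)).card ≤
      ((U ×ˢ W).filter (fun t => ({q, p, t.1, t.2} : Finset V) ∈ H)).card := by
    refine Finset.card_le_card_of_injOn Prod.swap ?_ Prod.swap_injective.injOn
    rintro ⟨a, b⟩ hab
    simp only [Finset.coe_filter, Set.mem_ofPred_eq, Finset.mem_product, Prod.swap] at hab ⊢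
    refine ⟨⟨hab.1.2, hab.1.1⟩, ?_⟩
    rw [Finset.pair_comm]
    exact hab.2
  have h1 := Finset.card_le_card hsub
  have h2 := h1.trans ((Finset.card_union_le _ _).trans (Nat.add_le_add
    (Finset.card_union_le _ _) (Finset.card_union_le _ _)))
  rw [Finset.card_product W W, h.cW] at h2
  nlinarith

theorem sum_p (h : Ctx m Q U W H) {p : V} (hp : p ∉ Q) :
    4 * m ^ 3 ≤ (d3 H Q U U p).card + 2 * (d3 H Q U W p).card + 7 * m ^ 2 := by
  have e1 : ∀ A B : Finset V, (d3 H Q A B p).card =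
      ∑ q ∈ Q, ((A ×ˢ B).filter (fun t => ({q, p, t.1, t.2} : Finset V) ∈ H)).card := by
    intro A B
    unfold d3
    rw [card_filter_prod]
    refine Finset.sum_congr rfl fun q _ => ?_
    simp only [Finset.insert_comm p q]
  have := Finset.sum_le_sum (fun q (hq : q ∈ Q) => h.pair_deg hp hq)
  simp only [Finset.sum_add_distrib, ← Finset.mul_sum] at this
  rw [← e1, ← e1] at this
  simp only [Finset.sum_const, h.cQ, smul_eq_mul] at this
  nlinarith

theorem sum_q (h : Ctx m Q U W H) {q : V} (hq : q ∈ Q) :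
    8 * m ^ 3 ≤ (d3 H U U U q).card + 2 * (d3 H W U U q).card + 14 * m ^ 2 := by
  have e1 : ∀ B : Finset V, (d3 H U U B q).card =
      ∑ p ∈ U, ((U ×ˢ B).filter (fun t => ({q, p, t.1, t.2} : Finset V) ∈ H)).card := by
    intro B
    unfold d3
    rw [card_filter_prod]
  have e2 : (d3 H U U W q).card ≤ (d3 H W U U q).card := by
    refine Finset.card_le_card_of_injOn (fun t => (t.2.2, t.1, t.2.1)) ?_ ?_
    · rintro ⟨a, b, c⟩ hab
      simp only [d3, Finset.coe_filter, Set.mem_ofPred_eq, Finset.mem_product] at hab ⊢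
      refine ⟨⟨hab.1.2.2, hab.1.1, hab.1.2.1⟩, ?_⟩
      convert hab.2 using 1
      ext x; simp; tauto
    · rintro ⟨a, b, c⟩ - ⟨a', b', c'⟩ - hh
      simp at hh ⊢; tauto
  have := Finset.sum_le_sum (fun p (hp : p ∈ U) =>
    h.pair_deg (Finset.disjoint_right.1 h.dQU hp) hq)
  simp only [Finset.sum_add_distrib, ← Finset.mul_sum] at this
  rw [← e1, ← e1] at this
  simp only [Finset.sum_const, h.cU, smul_eq_mul] at this
  nlinarith

theorem q_alt (h : Ctx m Q U W H) {q : V} (hq : q ∈ Q) :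
    m ^ 3 ≤ 10 * (d3 H U U U q).card ∨ m ^ 3 ≤ 10 * (d3 H W U U q).card := by
  have h1 := h.sum_q hq
  have : 10 ^ 9 * m ^ 2 ≤ m ^ 3 := by rw [pow_succ m 2, mul_comm]; gcongr; exact h.hm
  omega

theorem p_alt (h : Ctx m Q U W H) {p : V} (hp : p ∉ Q) :
    m ^ 3 ≤ 10 * (d3 H Q U U p).card ∨ m ^ 3 ≤ 10 * (d3 H Q U W p).card := by
  have h1 := h.sum_p hp
  have : 10 ^ 9 * m ^ 2 ≤ m ^ 3 := by rw [pow_succ m 2, mul_comm]; gcongr; exact h.hm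
  omega

/-- number of vertices of `A` with many missing edges is small -/
theorem few (h : Ctx m Q U W H) (A X Y Z : Finset V) (f : V × V × V × V → V × V × V × V)
    (hf : Function.Injective f) (hfm : ∀ a x y z, a ∈ A → x ∈ X → y ∈ Y → z ∈ Z →
      ({a, x, y, z} : Finset V) ∉ H → f (a, x, y, z) ∈ (Q ×ˢ W ×ˢ U ×ˢ U).filter
    (fun t => ({t.1, t.2.1, t.2.2.1, t.2.2.2} : Finset V) ∉ H)) (c : ℕ)
    (S : Finset V) (hS : S ⊆ A) (hbad : ∀ a ∈ S, m ^ 3 ≤ c * (n3 H X Y Z a).card) :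
    10 ^ 7 * S.card ≤ c * m := by
  have e1 : ((S ×ˢ X ×ˢ Y ×ˢ Z).filter
      (fun t => ({t.1, t.2.1, t.2.2.1, t.2.2.2} : Finset V) ∉ H)).card =
      ∑ a ∈ S, (n3 H X Y Z a).card := by
    rw [card_filter_prod]; rfl
  have e2 : ((S ×ˢ X ×ˢ Y ×ˢ Z).filter
      (fun t => ({t.1, t.2.1, t.2.2.1, t.2.2.2} : Finset V) ∉ H)).card ≤
      ((Q ×ˢ W ×ˢ U ×ˢ U).filter
    (fun t => ({t.1, t.2.1, t.2.2.1, t.2.2.2} : Finset V) ∉ H)).card := by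
    refine Finset.card_le_card_of_injOn f ?_ hf.injOn
    rintro ⟨a, x, y, z⟩ ht
    simp only [Finset.coe_filter, Set.mem_ofPred_eq, Finset.mem_product] at ht
    exact hfm a x y z (hS ht.1.1) ht.1.2.1 ht.1.2.2.1 ht.1.2.2.2 ht.2
  have e3 : S.card * m ^ 3 ≤ c * ∑ a ∈ S, (n3 H X Y Z a).card := by
    rw [Finset.mul_sum, ← smul_eq_mul, ← Finset.sum_const]
    exact Finset.sum_le_sum hbad
  have e4 := h.miss1
  have hm : 0 < m ^ 3 := by have := h.hm; positivity
  rw [← e1] at e3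
  have : (10 ^ 7 * S.card) * m ^ 3 ≤ (c * m) * m ^ 3 := by
    calc (10 ^ 7 * S.card) * m ^ 3 = 10 ^ 7 * (S.card * m ^ 3) := by ring
      _ ≤ 10 ^ 7 * (c * _) := Nat.mul_le_mul_left _ (e3.trans (Nat.mul_le_mul_left _ e2))
      _ = c * (10 ^ 7 * _) := by ring
      _ ≤ c * m ^ 4 := Nat.mul_le_mul_left _ e4
      _ = _ := by ring
  exact Nat.le_of_mul_le_mul_right this hm

theorem few_q (h : Ctx m Q U W H) (c : ℕ) (S : Finset V) (hS : S ⊆ Q)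
    (hbad : ∀ a ∈ S, m ^ 3 ≤ c * (n3 H W U U a).card) : 10 ^ 7 * S.card ≤ c * m := by
  refine h.few Q W U U id Function.injective_id ?_ c S hS hbad
  intro a x y z ha hx hy hz he
  simp [ha, hx, hy, hz, he]

theorem few_w (h : Ctx m Q U W H) (c : ℕ) (S : Finset V) (hS : S ⊆ W)
    (hbad : ∀ a ∈ S, m ^ 3 ≤ c * (n3 H Q U U a).card) : 10 ^ 7 * S.card ≤ c * m := by
  refine h.few W Q U U (fun t => (t.2.1, t.1, t.2.2)) ?_ ?_ c S hS hbad
  · rintro ⟨a, b, c, d⟩ ⟨a', b', c', d'⟩ hh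
    simp at hh ⊢; tauto
  intro a x y z ha hx hy hz he
  rw [Finset.insert_comm] at he
  simp [ha, hx, hy, hz, he]

theorem few_u (h : Ctx m Q U W H) (c : ℕ) (S : Finset V) (hS : S ⊆ U)
    (hbad : ∀ a ∈ S, m ^ 3 ≤ c * (n3 H Q U W a).card) : 10 ^ 7 * S.card ≤ c * m := by
  refine h.few U Q U W (fun t => (t.2.1, t.2.2.2, t.1, t.2.2.1)) ?_ ?_ c S hS hbad
  · rintro ⟨a, b, c, d⟩ ⟨a', b', c', d'⟩ hh
    simp at hh ⊢; tauto
  intro a x y z ha hx hy hz he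
  have : ({x, z, a, y} : Finset V) = {a, x, y, z} := by
    ext x; simp; tauto
  simp [ha, hx, hy, hz, he, this]

/-- choice of the corrected partition -/
theorem exists_W' (h : Ctx m Q U W H) : ∃ W' : Finset V, Disjoint Q W' ∧
    10 ^ 7 * (W \ W').card ≤ m ∧ 10 ^ 7 * (W' \ W).card ≤ 2 * m ∧
    (∀ w ∈ W', m ^ 3 ≤ 10 * (d3 H Q U U w).card) ∧
    (∀ u, u ∉ Q → u ∉ W' → m ^ 3 ≤ 10 * (d3 H Q U W u).card) ∧
    (m ≤ W'.card ∨ ∀ u, u ∉ Q → u ∉ W' → 10 * (d3 H Q U U u).card < m ^ 3) := by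
  set S := (Finset.univ \ Q).filter (fun p => m ^ 3 ≤ 10 * (d3 H Q U U p).card) with hS
  set BU := U.filter (fun p => 10 * (d3 H Q U W p).card < m ^ 3) with hBU
  have memS : ∀ p, p ∈ S ↔ p ∉ Q ∧ m ^ 3 ≤ 10 * (d3 H Q U U p).card := by
    intro p; simp [hS]
  have hBUS : BU ⊆ S := by
    intro u hu
    simp only [hBU, Finset.mem_filter] at hu
    have hq := Finset.disjoint_right.1 h.dQU hu.1
    have := h.p_alt hq
    rw [memS]
    refine ⟨hq, ?_⟩
    omega
  have cBU : 10 ^ 7 * BU.card ≤ m := by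
    have := h.few_u 1 BU (Finset.filter_subset _ _) (by
      intro a ha
      simp only [hBU, Finset.mem_filter] at ha
      have := d3_add_n3 H Q U W a
      rw [h.cQ, h.cU, h.cW] at this
      nlinarith)
    simpa using this
  have cWS : 10 ^ 7 * (W \ S).card ≤ m := by
    have := h.few_w 1 (W \ S) Finset.sdiff_subset (by
      intro a ha
      rw [Finset.mem_sdiff, memS] at ha
      have hq := Finset.disjoint_right.1 h.dQW ha.1
      have h2 := ha.2
      simp only [hq, not_false_eq_true, true_and, not_le] at h2
      have := d3_add_n3 H Q U U a
      rw [h.cQ, h.cU] at this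
      nlinarith)
    simpa using this
  set Wm := (W ∩ S) ∪ BU with hWm
  have hWmS : Wm ⊆ S := Finset.union_subset Finset.inter_subset_right hBUS
  have cWm : Wm.card ≤ m + BU.card := by
    refine (Finset.card_union_le _ _).trans ?_
    have : (W ∩ S).card ≤ W.card := Finset.card_le_card Finset.inter_subset_left
    rw [h.cW] at this
    omega
  obtain ⟨W', hW1, hW2, hW3, hW4⟩ : ∃ W', Wm ⊆ W' ∧ W' ⊆ S ∧ W'.card ≤ m + BU.card ∧
      (m ≤ W'.card ∨ W' = S) := by
    by_cases c1 : m ≤ Wm.card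
    · exact ⟨Wm, subset_rfl, hWmS, cWm, Or.inl c1⟩
    by_cases c2 : m ≤ S.card
    · obtain ⟨W', h1, h2, h3⟩ := Finset.exists_subsuperset_card_eq hWmS (by omega) c2
      exact ⟨W', h1, h2, by omega, Or.inl (by omega)⟩
    · exact ⟨S, hWmS, subset_rfl, by omega, Or.inr rfl⟩
  have hWsub : W \ W' ⊆ W \ S := by
    intro x hx
    rw [Finset.mem_sdiff] at hx ⊢
    refine ⟨hx.1, fun hxs => hx.2 (hW1 ?_)⟩
    exact Finset.mem_union_left _ (Finset.mem_inter.2 ⟨hx.1, hxs⟩)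
  have hc1 := Finset.card_le_card hWsub
  refine ⟨W', ?_, by omega, ?_, ?_, ?_, ?_⟩
  · rw [Finset.disjoint_right]
    intro x hx
    exact ((memS x).1 (hW2 hx)).1
  · have a1 := Finset.card_sdiff_add_card_inter W' W
    have a2 := Finset.card_sdiff_add_card_inter W W'
    rw [Finset.inter_comm] at a2
    rw [h.cW] at a2
    omega
  · intro w hw
    exact ((memS w).1 (hW2 hw)).2
  · intro u hu huW
    by_contra hcon
    rcases h.cov u with hu' | hu' | hu'
    · exact hu hu'
    · apply huW
      apply hW1
      apply Finset.mem_union_right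
      simp only [hBU, Finset.mem_filter]
      exact ⟨hu', by omega⟩
    · rcases h.p_alt hu with h1 | h1
      · apply huW
        apply hW1
        apply Finset.mem_union_left
        exact Finset.mem_inter.2 ⟨hu', (memS u).2 ⟨hu, h1⟩⟩
      · exact hcon h1
  · rcases hW4 with h4 | h4
    · exact Or.inl h4
    · right
      intro u hu huW
      by_contra hcon
      apply huW
      rw [h4, memS]
      exact ⟨hu, by omega⟩

end Ctx
end ctx


section ctx2
set_option linter.unusedSectionVars false
variable {V : Type*} [Fintype V] [DecidableEq V]

/-- the context with corrected partition `U', W'`; `D` contains the differences -/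
structure Ctx2 (m : ℕ) (Q U W U' W' D : Finset V) (H : Finset (Finset V)) : Prop where
  c : Ctx m Q U W H
  dQW' : ∀ x ∈ W', x ∉ Q
  hU' : ∀ x, x ∈ U' ↔ x ∉ Q ∧ x ∉ W'
  cD : 10 ^ 7 * D.card ≤ 3 * m
  hD : ∀ x, x ∉ D → (x ∈ W ↔ x ∈ W')
  F1 : ∀ w ∈ W', m ^ 3 ≤ 10 * (d3 H Q U U w).card
  F2 : ∀ u ∈ U', m ^ 3 ≤ 10 * (d3 H Q U W u).card
  F3 : m ≤ W'.card ∨ ∀ u ∈ U', 10 * (d3 H Q U U u).card < m ^ 3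

theorem Ctx.exists_ctx2 {m : ℕ} {Q U W : Finset V} {H : Finset (Finset V)} (h : Ctx m Q U W H) :
    ∃ U' W' D, Ctx2 m Q U W U' W' D H := by
  obtain ⟨W', h1, h2, h3, h4, h5, h6⟩ := h.exists_W'
  refine ⟨Finset.univ \ (Q ∪ W'), W', (W \ W') ∪ (W' \ W), ⟨h, ?_, ?_, ?_, ?_, h4, ?_, ?_⟩⟩
  · intro x hx; exact Finset.disjoint_right.1 h1 hx
  · intro x; simp
  · have := Finset.card_union_le (W \ W') (W' \ W)
    omega
  · intro x hx
    simp only [Finset.mem_union, Finset.mem_sdiff] at hx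
    tauto
  · intro u hu; simp at hu; exact h5 u hu.1 hu.2
  · rcases h6 with h6 | h6
    · exact Or.inl h6
    · right; intro u hu; simp at hu; exact h6 u hu.1 hu.2

variable {m : ℕ} {Q U W U' W' D : Finset V} {H : Finset (Finset V)}

theorem count_four {a b c d : V} (A : Finset V)
    (h : a ≠ b ∧ a ≠ c ∧ a ≠ d ∧ b ≠ c ∧ b ≠ d ∧ c ≠ d) :
    (({a, b, c, d} : Finset V) ∩ A).card = (if a ∈ A then 1 else 0) + (if b ∈ A then 1 else 0)
      + (if c ∈ A then 1 else 0) + (if d ∈ A then 1 else 0) := by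
  obtain ⟨h1, h2, h3, h4, h5, h6⟩ := h
  rw [← Finset.filter_mem_eq_inter, Finset.card_filter, Finset.sum_insert (by simp [h1, h2, h3]),
    Finset.sum_insert (by simp [h4, h5]), Finset.sum_pair h6]
  omega

namespace Ctx2

theorem memU (h : Ctx2 m Q U W U' W' D H) {x : V} (hx : x ∈ U) (hd : x ∉ D) : x ∈ U' := by
  rw [h.hU', ← h.hD x hd]
  exact ⟨Finset.disjoint_right.1 h.c.dQU hx, Finset.disjoint_left.1 h.c.dUW hx⟩

theorem memU' (h : Ctx2 m Q U W U' W' D H) {x : V} (hx : x ∈ U') (hd : x ∉ D) : x ∈ U := by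
  rw [h.hU', ← h.hD x hd] at hx
  have := h.c.cov x
  tauto

theorem memW (h : Ctx2 m Q U W U' W' D H) {x : V} (hx : x ∈ W) (hd : x ∉ D) : x ∈ W' :=
  (h.hD x hd).1 hx

theorem cW'U' (h : Ctx2 m Q U W U' W' D H) : W'.card + U'.card = 3 * m := by
  have e : (Finset.univ : Finset V) = Q ∪ (W' ∪ U') := by
    ext x
    have := h.hU' x
    simp only [Finset.mem_univ, Finset.mem_union, true_iff]
    tauto
  have := congrArg Finset.card e
  rw [Finset.card_univ, h.c.cV, Finset.card_union_of_disjoint, Finset.card_union_of_disjoint,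
    h.c.cQ] at this
  · omega
  · rw [Finset.disjoint_left]; intro x hx hx'; exact ((h.hU' x).1 hx').2 hx
  · rw [Finset.disjoint_left]; intro x hx hx'
    rcases Finset.mem_union.1 hx' with h1 | h1
    · exact h.dQW' x h1 hx
    · exact ((h.hU' x).1 h1).1 hx

theorem cW'1 (h : Ctx2 m Q U W U' W' D H) : W'.card ≤ m + D.card := by
  rw [← h.c.cW]
  refine le_trans (Finset.card_le_card ?_) (Finset.card_union_le _ _)
  intro x hx
  by_cases hd : x ∈ D
  · simp [hd]
  · simp [(h.hD x hd).2 hx]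

theorem cW'2 (h : Ctx2 m Q U W U' W' D H) : m ≤ W'.card + D.card := by
  rw [← h.c.cW]
  refine le_trans (Finset.card_le_card ?_) (Finset.card_union_le _ _)
  intro x hx
  by_cases hd : x ∈ D
  · simp [hd]
  · simp [(h.hD x hd).1 hx]

theorem add_edge (h : Ctx2 m Q U W U' W' D H) {X : Finset V} (hX : Cov H X) {a b c d : V}
    (he : ({a, b, c, d} : Finset V) ∈ H) (ha : a ∉ X) (hb : b ∉ X) (hc : c ∉ X) (hd : d ∉ X) :
    Cov H (X ∪ {a, b, c, d}) ∧ (X ∪ {a, b, c, d}).card = X.card + 4 ∧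
    ∀ A : Finset V, ((X ∪ {a, b, c, d}) ∩ A).card = (X ∩ A).card + ((if a ∈ A then 1 else 0)
      + (if b ∈ A then 1 else 0) + (if c ∈ A then 1 else 0) + (if d ∈ A then 1 else 0)) := by
  have hdis : Disjoint ({a, b, c, d} : Finset V) X := by
    simp [ha, hb, hc, hd]
  refine ⟨hX.insert he hdis, ?_, ?_⟩
  · rw [Finset.card_union_of_disjoint hdis.symm, h.c.card4 he]
  · intro A
    rw [← count_four A (h.c.ne he), Finset.union_inter_distrib_right,
      Finset.card_union_of_disjoint]
    exact Finset.disjoint_of_subset_left Finset.inter_subset_left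
      (Finset.disjoint_of_subset_right Finset.inter_subset_left hdis.symm)

theorem avoid (h : Ctx2 m Q U W U' W' D H) {X : Finset V} (hX : 1000 * X.card ≤ m)
    (T : Finset (V × V × V)) (hT : m ^ 3 ≤ 10 * T.card) :
    ∃ a b c, (a, b, c) ∈ T ∧ (a ∉ X ∧ b ∉ X ∧ c ∉ X) ∧ (a ∉ D ∧ b ∉ D ∧ c ∉ D) := by
  have h1 := Finset.card_union_le X D
  have h2 := h.cD
  have h3 := h.c.hm
  obtain ⟨a, b, c, ht, ha, hb, hc⟩ := avoid3 T (X ∪ D) (by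
    rw [h.c.cV]
    have : 480 * (X ∪ D).card < m := by omega
    have h4 : 480 * (X ∪ D).card * m ^ 2 < m * m ^ 2 :=
      Nat.mul_lt_mul_of_pos_right this (by positivity)
    nlinarith)
  simp only [Finset.mem_union, not_or] at ha hb hc
  exact ⟨a, b, c, ht, ⟨ha.1, hb.1, hc.1⟩, ha.2, hb.2, hc.2⟩

theorem edge_w (h : Ctx2 m Q U W U' W' D H) {X : Finset V} (hX : 1000 * X.card ≤ m) {w : V}
    (hw : w ∈ W') : ∃ q ∈ Q, ∃ a ∈ U', ∃ b ∈ U', ({w, q, a, b} : Finset V) ∈ H ∧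
      q ∉ X ∧ a ∉ X ∧ b ∉ X := by
  obtain ⟨q, a, b, ht, hx, hd⟩ := h.avoid hX _ (h.F1 w hw)
  simp only [d3, Finset.mem_filter, Finset.mem_product] at ht
  exact ⟨q, ht.1.1, a, h.memU ht.1.2.1 hd.2.1, b, h.memU ht.1.2.2 hd.2.2, ht.2, hx⟩

theorem edge_u (h : Ctx2 m Q U W U' W' D H) {X : Finset V} (hX : 1000 * X.card ≤ m) {u : V}
    (hu : u ∈ U') : ∃ q ∈ Q, ∃ a ∈ U', ∃ b ∈ W', ({u, q, a, b} : Finset V) ∈ H ∧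
      q ∉ X ∧ a ∉ X ∧ b ∉ X := by
  obtain ⟨q, a, b, ht, hx, hd⟩ := h.avoid hX _ (h.F2 u hu)
  simp only [d3, Finset.mem_filter, Finset.mem_product] at ht
  exact ⟨q, ht.1.1, a, h.memU ht.1.2.1 hd.2.1, b, h.memW ht.1.2.2 hd.2.2, ht.2, hx⟩

theorem edge_q (h : Ctx2 m Q U W U' W' D H) {X : Finset V} (hX : 1000 * X.card ≤ m) {q : V}
    (hq : q ∈ Q) : (∃ a ∈ U', ∃ b ∈ U', ∃ c ∈ U', ({q, a, b, c} : Finset V) ∈ H ∧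
      a ∉ X ∧ b ∉ X ∧ c ∉ X) ∨ (∃ w ∈ W', ∃ a ∈ U', ∃ b ∈ U', ({q, w, a, b} : Finset V) ∈ H ∧
      w ∉ X ∧ a ∉ X ∧ b ∉ X) := by
  rcases h.c.q_alt hq with h1 | h1
  · obtain ⟨a, b, c, ht, hx, hd⟩ := h.avoid hX _ h1
    simp only [d3, Finset.mem_filter, Finset.mem_product] at ht
    exact Or.inl ⟨a, h.memU ht.1.1 hd.1, b, h.memU ht.1.2.1 hd.2.1, c, h.memU ht.1.2.2 hd.2.2,
      ht.2, hx⟩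
  · obtain ⟨a, b, c, ht, hx, hd⟩ := h.avoid hX _ h1
    simp only [d3, Finset.mem_filter, Finset.mem_product] at ht
    exact Or.inr ⟨a, h.memW ht.1.1 hd.1, b, h.memU ht.1.2.1 hd.2.1, c, h.memU ht.1.2.2 hd.2.2,
      ht.2, hx⟩

theorem edge_wwu (h : Ctx2 m Q U W U' W' D H) {X : Finset V} (hX : 1000 * X.card ≤ m) :
    ∃ q ∈ Q, ∃ w ∈ W', ∃ w' ∈ W', ∃ u ∈ U', ({q, w, w', u} : Finset V) ∈ H ∧
      q ∉ X ∧ w ∉ X ∧ w' ∉ X ∧ u ∉ X := by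
  have h1 := Finset.card_union_le X D
  have h2 := h.cD
  have h3 := h.c.hm
  have h4 := h.c.miss2
  have h5 := Finset.card_filter_add_card_filter_not (s := Q ×ˢ W ×ˢ W ×ˢ U)
    (fun t => ({t.1, t.2.1, t.2.2.1, t.2.2.2} : Finset V) ∈ H)
  simp only [Finset.card_product, h.c.cQ, h.c.cU, h.c.cW] at h5
  obtain ⟨q, w, w', u, ht, hq, hw, hw', hu⟩ := avoid4 ((Q ×ˢ W ×ˢ W ×ˢ U).filter
    (fun t => ({t.1, t.2.1, t.2.2.1, t.2.2.2} : Finset V) ∈ H)) (X ∪ D) (by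
    rw [h.c.cV]
    have : 256 * (X ∪ D).card < m := by omega
    have h6 : 256 * (X ∪ D).card * m ^ 3 < m * m ^ 3 :=
      Nat.mul_lt_mul_of_pos_right this (by positivity)
    nlinarith)
  simp only [Finset.mem_union, not_or] at hq hw hw' hu
  simp only [Finset.mem_filter, Finset.mem_product] at ht
  exact ⟨q, ht.1.1, w, h.memW ht.1.2.1 hw.2, w', h.memW ht.1.2.2.1 hw'.2, u,
    h.memU ht.1.2.2.2 hu.2, ht.2, hq.1, hw.1, hw'.1, hu.1⟩

theorem codeg (h : Ctx2 m Q U W U' W' D H) {r : ℕ} (hr : W'.card + (r + 1) = m) {q a : V}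
    (hq : q ∈ Q) (ha : a ∈ U') : 4 * m * r + 2 ≤
      ((U' ×ˢ U').filter (fun t => ({q, a, t.1, t.2} : Finset V) ∈ H)).card := by
  have haQ := ((h.hU' a).1 ha).1
  have hd := h.c.deg a haQ q hq
  have hUc : U'.card = 2 * m + (r + 1) := by have := h.cW'U'; omega
  set P1 := (Finset.univ \ Q).erase a with hP1
  set U1 := U'.erase a with hU1
  have hsubU : U1 ⊆ P1 := by
    intro x hx
    simp only [hU1, hP1, Finset.mem_erase, Finset.mem_sdiff, Finset.mem_univ, true_and] at hx ⊢
    exact ⟨hx.1, ((h.hU' x).1 hx.2).1⟩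
  have cP1 : P1.card = 3 * m - 1 := by
    rw [hP1, Finset.card_erase_of_mem (by simp [haQ]), Finset.card_sdiff_of_subset (by simp),
      Finset.card_univ, h.c.cV, h.c.cQ]
    omega
  have cU1 : U1.card = 2 * m + r := by
    rw [hU1, Finset.card_erase_of_mem ha, hUc]; omega
  have hoff : U1.offDiag ⊆ P1.offDiag := Finset.offDiag_mono hsubU
  have hsub : (Finset.univ.filter (fun t : V × V => ({q, a, t.1, t.2} : Finset V) ∈ H)) ⊆
      ((U' ×ˢ U').filter (fun t => ({q, a, t.1, t.2} : Finset V) ∈ H)) ∪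
      (P1.offDiag \ U1.offDiag) := by
    rintro ⟨b, c⟩ hab
    simp only [Finset.mem_filter, Finset.mem_univ, true_and] at hab
    obtain ⟨-, hb, hc⟩ := h.c.notQ hq hab
    obtain ⟨-, -, -, n1, n2, n3⟩ := h.c.ne hab
    simp only [hP1, hU1, Finset.mem_union, Finset.mem_filter, Finset.mem_product, Finset.mem_sdiff,
      Finset.mem_offDiag, Finset.mem_erase, Finset.mem_univ, true_and]
    by_cases hbc : b ∈ U' ∧ c ∈ U'
    · exact Or.inl ⟨hbc, hab⟩
    · right
      exact ⟨⟨⟨n1.symm, hb⟩, ⟨n2.symm, hc⟩, n3⟩, fun hh => hbc ⟨hh.1.2, hh.2.1.2⟩⟩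
  have h1 := (Finset.card_le_card hsub).trans (Finset.card_union_le _ _)
  have h2 := Finset.card_sdiff_add_card_eq_card hoff
  rw [Finset.offDiag_card, Finset.offDiag_card, cP1, cU1] at h2
  have hm := h.c.hm
  obtain ⟨k, rfl⟩ : ∃ k, m = k + 1 := ⟨m - 1, by omega⟩
  have e1 : (3 * (k + 1) - 1) * (3 * (k + 1) - 1) - (3 * (k + 1) - 1) = (3 * k + 2) * (3 * k + 1) := by
    have : 3 * (k + 1) - 1 = 3 * k + 2 := by omega
    rw [this]
    have : (3 * k + 2) * (3 * k + 2) = (3 * k + 2) * (3 * k + 1) + (3 * k + 2) := by ring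
    omega
  have e2 : (2 * (k + 1) + r) * (2 * (k + 1) + r) - (2 * (k + 1) + r) =
      (2 * (k + 1) + r) * (2 * k + 1 + r) := by
    have : (2 * (k + 1) + r) * (2 * (k + 1) + r) =
      (2 * (k + 1) + r) * (2 * k + 1 + r) + (2 * (k + 1) + r) := by ring
    omega
  rw [e1, e2] at h2
  have hrr : r ≤ r * r := Nat.le_mul_self r
  nlinarith

theorem d3U' (h : Ctx2 m Q U W U' W' D H) {u : V} (hu : 10 * (d3 H Q U U u).card < m ^ 3) :
    9 * (d3 H Q U' U' u).card ≤ m ^ 3 := by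
  have hsub : d3 H Q U' U' u ⊆ d3 H Q U U u ∪
      (((Finset.univ : Finset V) ×ˢ D ×ˢ (Finset.univ : Finset V)) ∪
      ((Finset.univ : Finset V) ×ˢ (Finset.univ : Finset V) ×ˢ D)) := by
    rintro ⟨q, a, b⟩ ht
    simp only [d3, Finset.mem_filter, Finset.mem_product, Finset.mem_union, Finset.mem_univ,
      true_and, and_true] at ht ⊢
    by_cases h1 : a ∈ D
    · tauto
    by_cases h2 : b ∈ D
    · tauto
    exact Or.inl ⟨⟨ht.1.1, h.memU' ht.1.2.1 h1, h.memU' ht.1.2.2 h2⟩, ht.2⟩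
  have h1 := (Finset.card_le_card hsub).trans ((Finset.card_union_le _ _).trans
    (Nat.add_le_add_left (Finset.card_union_le _ _) _))
  simp only [Finset.card_product, Finset.card_univ, h.c.cV] at h1
  have h2 : 10 ^ 7 * D.card * m ^ 2 ≤ 3 * m * m ^ 2 := Nat.mul_le_mul_right _ h.cD
  have e : 3 * m * m ^ 2 = 3 * m ^ 3 := by ring
  have e2 : 4 * m * (D.card * (4 * m)) + 4 * m * (4 * m * D.card) = 32 * (D.card * m ^ 2) := by ring
  rw [e, mul_assoc] at h2
  rw [e2] at h1
  omega

theorem edge_uuu (h : Ctx2 m Q U W U' W' D H) {r : ℕ} (hr : W'.card + (r + 1) = m)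
    {X : Finset V} (hX : X.card ≤ 4 * r) :
    ∃ q ∈ Q, ∃ a ∈ U', ∃ b ∈ U', ∃ c ∈ U', ({q, a, b, c} : Finset V) ∈ H ∧
      q ∉ X ∧ a ∉ X ∧ b ∉ X ∧ c ∉ X := by
  have F3 : ∀ u ∈ U', 10 * (d3 H Q U U u).card < m ^ 3 := by
    rcases h.F3 with h3 | h3
    · omega
    · exact h3
  have hm := h.c.hm
  have hD := h.cD
  have hW2 := h.cW'2
  have hUc : U'.card = 2 * m + (r + 1) := by have := h.cW'U'; omega
  set T := ((Q \ X) ×ˢ (U' \ X) ×ˢ U' ×ˢ U').filter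
    (fun t => ({t.1, t.2.1, t.2.2.1, t.2.2.2} : Finset V) ∈ H) with hT
  set Z := ((X ∩ U') ×ˢ Q ×ˢ U' ×ˢ U').filter
    (fun t => ({t.1, t.2.1, t.2.2.1, t.2.2.2} : Finset V) ∈ H) with hZ
  have cQX : m ≤ 2 * (Q \ X).card := by
    have := Finset.le_card_sdiff X Q
    rw [h.c.cQ] at this
    omega
  have cUX : m ≤ (U' \ X).card := by
    have := Finset.le_card_sdiff X U'
    omega
  have cT : (Q \ X).card * ((U' \ X).card * (4 * m * r + 2)) ≤ T.card := by
    rw [hT, card_filter_prod]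
    rw [← smul_eq_mul, ← Finset.sum_const]
    refine Finset.sum_le_sum fun q hq => ?_
    rw [card_filter_prod, ← smul_eq_mul, ← Finset.sum_const]
    refine Finset.sum_le_sum fun a ha => ?_
    exact h.codeg hr (Finset.mem_sdiff.1 hq).1 (Finset.mem_sdiff.1 ha).1
  have cZ : 9 * Z.card ≤ 4 * r * m ^ 3 := by
    rw [hZ, card_filter_prod, Finset.mul_sum]
    have : ∑ u ∈ X ∩ U', 9 * (d3 H Q U' U' u).card ≤ ∑ u ∈ X ∩ U', m ^ 3 :=
      Finset.sum_le_sum fun u hu => h.d3U' (F3 u (Finset.mem_inter.1 hu).2)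
    refine this.trans ?_
    rw [Finset.sum_const, smul_eq_mul]
    exact Nat.mul_le_mul_right _ ((Finset.card_le_card Finset.inter_subset_left).trans hX)
  by_contra hno
  push Not at hno
  have hsub : T ⊆ T.filter (fun t => t.2.2.1 ∈ X) ∪ T.filter (fun t => t.2.2.2 ∈ X) := by
    rintro ⟨q, a, b, c⟩ ht
    have ht' := ht
    simp only [hT, Finset.mem_filter, Finset.mem_product, Finset.mem_sdiff] at ht'
    obtain ⟨⟨⟨q1, q2⟩, ⟨a1, a2⟩, b1, c1⟩, he⟩ := ht'
    have := hno q q1 a a1 b b1 c c1 he q2 a2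
    simp only [Finset.mem_union, Finset.mem_filter]
    tauto
  have s1 : (T.filter (fun t => t.2.2.1 ∈ X)).card ≤ Z.card := by
    refine Finset.card_le_card_of_injOn (fun t => (t.2.2.1, t.1, t.2.1, t.2.2.2)) ?_ ?_
    · rintro ⟨q, a, b, c⟩ ht
      simp only [hT, hZ, Finset.mem_coe, Finset.mem_filter, Finset.mem_product, Finset.mem_sdiff,
        Finset.mem_inter] at ht ⊢
      obtain ⟨⟨⟨⟨q1, q2⟩, ⟨a1, a2⟩, b1, c1⟩, he⟩, hb⟩ := ht
      refine ⟨⟨⟨hb, b1⟩, q1, a1, c1⟩, ?_⟩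
      convert he using 1
      ext x; simp; tauto
    · rintro ⟨q, a, b, c⟩ - ⟨q', a', b', c'⟩ - hh
      simp at hh ⊢; tauto
  have s2 : (T.filter (fun t => t.2.2.2 ∈ X)).card ≤ Z.card := by
    refine Finset.card_le_card_of_injOn (fun t => (t.2.2.2, t.1, t.2.1, t.2.2.1)) ?_ ?_
    · rintro ⟨q, a, b, c⟩ ht
      simp only [hT, hZ, Finset.mem_coe, Finset.mem_filter, Finset.mem_product, Finset.mem_sdiff,
        Finset.mem_inter] at ht ⊢
      obtain ⟨⟨⟨⟨q1, q2⟩, ⟨a1, a2⟩, b1, c1⟩, he⟩, hb⟩ := ht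
      refine ⟨⟨⟨hb, c1⟩, q1, a1, b1⟩, ?_⟩
      convert he using 1
      ext x; simp; tauto
    · rintro ⟨q, a, b, c⟩ - ⟨q', a', b', c'⟩ - hh
      simp at hh ⊢; tauto
  have s3 := (Finset.card_le_card hsub).trans ((Finset.card_union_le _ _).trans
    (Nat.add_le_add s1 s2))
  have s4 : m * (m * (4 * m * r + 2)) ≤ 2 * T.card := by
    calc m * (m * (4 * m * r + 2)) ≤ (2 * (Q \ X).card) * ((U' \ X).card * (4 * m * r + 2)) := by
          gcongr
      _ = 2 * ((Q \ X).card * ((U' \ X).card * (4 * m * r + 2))) := by ring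
      _ ≤ _ := Nat.mul_le_mul_left _ cT
  have e : m * (m * (4 * m * r + 2)) = 4 * (r * m ^ 3) + 2 * m ^ 2 := by ring
  have hm2 : 0 < m ^ 2 := by positivity
  rw [e] at s4
  rw [mul_assoc] at cZ
  omega

/-- the state of the greedy procedure -/
def St (m : ℕ) (Q U' W' : Finset V) (H : Finset (Finset V)) (X : Finset V) : Prop :=
  Cov H X ∧ m + (X ∩ W').card = W'.card + (X ∩ Q).card ∧
    U'.card + 2 * (X ∩ Q).card = 2 * m + (X ∩ U').card

theorem phase1 (h : Ctx2 m Q U W U' W' D H) : ∃ X, St m Q U' W' H X ∧ X.card ≤ 4 * D.card := by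
  have hWU := h.cW'U'
  have hW1 := h.cW'1
  have hW2 := h.cW'2
  have hD := h.cD
  have hm := h.c.hm
  have nQU : ∀ x ∈ Q, x ∉ U' := fun x hx hx' => ((h.hU' x).1 hx').1 hx
  have nQW : ∀ x ∈ Q, x ∉ W' := fun x hx hx' => h.dQW' x hx' hx
  have nWU : ∀ x ∈ W', x ∉ U' := fun x hx hx' => ((h.hU' x).1 hx').2 hx
  have nUQ : ∀ x ∈ U', x ∉ Q := fun x hx => ((h.hU' x).1 hx).1
  have nUW : ∀ x ∈ U', x ∉ W' := fun x hx => ((h.hU' x).1 hx).2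
  have nWQ := h.dQW'
  by_cases hc : m ≤ W'.card
  · have key : ∀ k, k ≤ D.card → ∃ X, Cov H X ∧ X.card = 4 * k ∧ (X ∩ Q).card = k ∧
        (X ∩ W').card = 2 * k ∧ (X ∩ U').card = k := by
      intro k
      induction k with
      | zero => intro _; exact ⟨∅, Cov.empty H, by simp⟩
      | succ k ih =>
        intro hk
        obtain ⟨X, x0, x1, x2, x3, x4⟩ := ih (by omega)
        obtain ⟨q, hq, w, hw, w', hw', u, hu, he, n1, n2, n3, n4⟩ := h.edge_wwu (X := X) (by omega)
        obtain ⟨y0, y1, y2⟩ := h.add_edge x0 he n1 n2 n3 n4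
        refine ⟨_, y0, by omega, ?_, ?_, ?_⟩
        · rw [y2]; simp [hq, nWQ w hw, nWQ w' hw', nUQ u hu]; omega
        · rw [y2]; simp [nQW q hq, hw, hw', nUW u hu]; omega
        · rw [y2]; simp [nQU q hq, nWU w hw, nWU w' hw', hu]; omega
    obtain ⟨X, x0, x1, x2, x3, x4⟩ := key (W'.card - m) (by omega)
    exact ⟨X, ⟨x0, by omega, by omega⟩, by omega⟩
  · obtain ⟨r, hr⟩ : ∃ r, W'.card + (r + 1) = m := ⟨m - W'.card - 1, by omega⟩
    have key : ∀ k, k ≤ r + 1 → ∃ X, Cov H X ∧ X.card = 4 * k ∧ (X ∩ Q).card = k ∧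
        (X ∩ W').card = 0 ∧ (X ∩ U').card = 3 * k := by
      intro k
      induction k with
      | zero => intro _; exact ⟨∅, Cov.empty H, by simp⟩
      | succ k ih =>
        intro hk
        obtain ⟨X, x0, x1, x2, x3, x4⟩ := ih (by omega)
        obtain ⟨q, hq, a, ha, b, hb, c, hc, he, n1, n2, n3, n4⟩ :=
          h.edge_uuu hr (X := X) (by omega)
        obtain ⟨y0, y1, y2⟩ := h.add_edge x0 he n1 n2 n3 n4
        refine ⟨_, y0, by omega, ?_, ?_, ?_⟩
        · rw [y2]; simp [hq, nUQ a ha, nUQ b hb, nUQ c hc]; omega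
        · rw [y2, x3]; simp [nQW q hq, nUW a ha, nUW b hb, nUW c hc]
        · rw [y2]; simp [nQU q hq, ha, hb, hc]; omega
    obtain ⟨X, x0, x1, x2, x3, x4⟩ := key (r + 1) le_rfl
    exact ⟨X, ⟨x0, by omega, by omega⟩, by omega⟩

theorem step (h : Ctx2 m Q U W U' W' D H) {X : Finset V} (hS : St m Q U' W' H X)
    (hX : 1000 * (X.card + 4) ≤ m) (x : V) :
    ∃ X', St m Q U' W' H X' ∧ X ⊆ X' ∧ x ∈ X' ∧ X'.card ≤ X.card + 8 := by
  have nQU : ∀ x ∈ Q, x ∉ U' := fun x hx hx' => ((h.hU' x).1 hx').1 hx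
  have nQW : ∀ x ∈ Q, x ∉ W' := fun x hx hx' => h.dQW' x hx' hx
  have nWU : ∀ x ∈ W', x ∉ U' := fun x hx hx' => ((h.hU' x).1 hx').2 hx
  have nUQ : ∀ x ∈ U', x ∉ Q := fun x hx => ((h.hU' x).1 hx).1
  have nUW : ∀ x ∈ U', x ∉ W' := fun x hx => ((h.hU' x).1 hx).2
  have nWQ := h.dQW'
  obtain ⟨x0, b1, b2⟩ := hS
  by_cases hx : x ∈ X
  · exact ⟨X, ⟨x0, b1, b2⟩, subset_rfl, hx, by omega⟩
  by_cases hxQ : x ∈ Q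
  · rcases h.edge_q (X := X) (by omega) hxQ with
      ⟨a, ha, b, hb, c, hc, he, n2, n3, n4⟩ | ⟨w, hw, a, ha, b, hb, he, n2, n3, n4⟩
    · obtain ⟨y0, y1, y2⟩ := h.add_edge x0 he hx n2 n3 n4
      set Y := X ∪ {x, a, b, c} with hY
      obtain ⟨q', hq', w, hw, w', hw', u, hu, he', k1, k2, k3, k4⟩ :=
        h.edge_wwu (X := Y) (by omega)
      obtain ⟨z0, z1, z2⟩ := h.add_edge y0 he' k1 k2 k3 k4
      refine ⟨_, ⟨z0, ?_, ?_⟩, ?_, ?_, by omega⟩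
      · rw [z2, z2, y2, y2]
        simp [hxQ, hq', nQW x hxQ, nQW q' hq', nUW a ha, nUW b hb, nUW c hc, hw, hw', nUW u hu,
          nUQ a ha, nUQ b hb, nUQ c hc, nWQ w hw, nWQ w' hw', nUQ u hu]
        omega
      · rw [z2, z2, y2, y2]
        simp [hxQ, hq', nQU x hxQ, nQU q' hq', ha, hb, hc, hu, nWU w hw, nWU w' hw',
          nUQ a ha, nUQ b hb, nUQ c hc, nWQ w hw, nWQ w' hw', nUQ u hu]
        omega
      · exact Finset.subset_union_left.trans Finset.subset_union_left
      · simp [hY]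
    · obtain ⟨y0, y1, y2⟩ := h.add_edge x0 he hx n2 n3 n4
      refine ⟨_, ⟨y0, ?_, ?_⟩, Finset.subset_union_left, by simp, by omega⟩
      · rw [y2, y2]
        simp [hxQ, nQW x hxQ, nUW a ha, nUW b hb, hw, nUQ a ha, nUQ b hb, nWQ w hw]
        omega
      · rw [y2, y2]
        simp [hxQ, nQU x hxQ, ha, hb, nWU w hw, nUQ a ha, nUQ b hb, nWQ w hw]
        omega
  by_cases hxW : x ∈ W'
  · obtain ⟨q, hq, a, ha, b, hb, he, n2, n3, n4⟩ := h.edge_w (X := X) (by omega) hxW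
    obtain ⟨y0, y1, y2⟩ := h.add_edge x0 he hx n2 n3 n4
    refine ⟨_, ⟨y0, ?_, ?_⟩, Finset.subset_union_left, by simp, by omega⟩
    · rw [y2, y2]
      simp [hq, nQW q hq, nUW a ha, nUW b hb, hxW, nUQ a ha, nUQ b hb, hxQ]
      omega
    · rw [y2, y2]
      simp [hq, nQU q hq, ha, hb, nWU x hxW, nUQ a ha, nUQ b hb, hxQ]
      omega
  have hxU : x ∈ U' := (h.hU' x).2 ⟨hxQ, hxW⟩
  obtain ⟨q, hq, a, ha, w, hw, he, n2, n3, n4⟩ := h.edge_u (X := X) (by omega) hxU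
  obtain ⟨y0, y1, y2⟩ := h.add_edge x0 he hx n2 n3 n4
  refine ⟨_, ⟨y0, ?_, ?_⟩, Finset.subset_union_left, by simp, by omega⟩
  · rw [y2, y2]
    simp [hq, nQW q hq, nUW a ha, hw, hxW, nUQ a ha, nWQ w hw, hxQ]
    omega
  · rw [y2, y2]
    simp [hq, nQU q hq, ha, hxU, nWU w hw, nUQ a ha, nWQ w hw, hxQ]
    omega

theorem steps (h : Ctx2 m Q U W U' W' D H) {X : Finset V} (hS : St m Q U' W' H X) (B : Finset V)
    (hX : 1000 * (X.card + 8 * B.card) ≤ m) :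
    ∃ X', St m Q U' W' H X' ∧ X ⊆ X' ∧ B ⊆ X' ∧ X'.card ≤ X.card + 8 * B.card := by
  induction B using Finset.induction_on with
  | empty => exact ⟨X, hS, subset_rfl, by simp, by simp⟩
  | insert x B hx ih =>
    rw [Finset.card_insert_of_notMem hx] at hX ⊢
    obtain ⟨Y, hY, h1, h2, h3⟩ := ih (by omega)
    obtain ⟨Z, hZ, k1, k2, k3⟩ := h.step hY (by omega) x
    exact ⟨Z, hZ, h1.trans k1, Finset.insert_subset k2 (h2.trans k1), by omega⟩

end Ctx2
end ctx2


section fin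
set_option linter.unusedSectionVars false
variable {V : Type*} [Fintype V] [DecidableEq V]
variable {m : ℕ} {Q U W U' W' D : Finset V} {H : Finset (Finset V)}

theorem disjoint_four {a b c d a' b' c' d' : V}
    (h : ∀ x, (x = a ∨ x = b ∨ x = c ∨ x = d) → (x = a' ∨ x = b' ∨ x = c' ∨ x = d') → False) :
    Disjoint ({a, b, c, d} : Finset V) {a', b', c', d'} := by
  rw [Finset.disjoint_left]
  intro x hx hx'
  simp only [Finset.mem_insert, Finset.mem_singleton] at hx hx'
  exact h x hx hx'

theorem Ctx2.finish (h : Ctx2 m Q U W U' W' D H) : Cov H (Finset.univ : Finset V) := by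
  have hWU := h.cW'U'
  have hD := h.cD
  have hm := h.c.hm
  set bq := Q.filter (fun a => m ^ 3 < 100 * (n3 H W U U a).card) with hbq
  set bw := W.filter (fun a => m ^ 3 < 100 * (n3 H Q U U a).card) with hbw
  set bu := U.filter (fun a => m ^ 3 < 100 * (n3 H Q U W a).card) with hbu
  have c1 := h.c.few_q 100 bq (Finset.filter_subset _ _) (fun a ha => (Finset.mem_filter.1 ha).2.le)
  have c2 := h.c.few_w 100 bw (Finset.filter_subset _ _) (fun a ha => (Finset.mem_filter.1 ha).2.le)
  have c3 := h.c.few_u 100 bu (Finset.filter_subset _ _) (fun a ha => (Finset.mem_filter.1 ha).2.le)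
  set B := (D ∪ bq) ∪ (bw ∪ bu) with hB
  have cB : B.card ≤ D.card + bq.card + (bw.card + bu.card) :=
    (Finset.card_union_le _ _).trans
      (Nat.add_le_add (Finset.card_union_le _ _) (Finset.card_union_le _ _))
  obtain ⟨X0, hS0, hX0⟩ := h.phase1
  obtain ⟨X, ⟨hcov, b1, b2⟩, -, hBX, hXc⟩ := h.steps hS0 B (by omega)
  have hXm : 1000 * X.card ≤ m := by omega
  -- goodness
  have gq : ∀ q ∈ Q, q ∉ X → (n3 H W U U q).card ≤ m ^ 3 / 100 := by
    intro q hq hx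
    by_contra hcon
    apply hx; apply hBX
    simp only [hB, hbq, Finset.mem_union, Finset.mem_filter]
    left; right; exact ⟨hq, by omega⟩
  have nD : ∀ x, x ∉ X → x ∉ D := by
    intro x hx hd
    apply hx; apply hBX
    simp [hB, hd]
  have gw : ∀ w ∈ W, w ∉ X → (n3 H Q U U w).card ≤ m ^ 3 / 100 := by
    intro q hq hx
    by_contra hcon
    apply hx; apply hBX
    simp only [hB, hbw, Finset.mem_union, Finset.mem_filter]
    right; left; exact ⟨hq, by omega⟩
  have gu : ∀ w ∈ U, w ∉ X → (n3 H Q U W w).card ≤ m ^ 3 / 100 := by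
    intro q hq hx
    by_contra hcon
    apply hx; apply hBX
    simp only [hB, hbu, Finset.mem_union, Finset.mem_filter]
    right; right; exact ⟨hq, by omega⟩
  have sQ := Finset.card_sdiff_add_card_inter Q X
  have sW := Finset.card_sdiff_add_card_inter W' X
  have sU := Finset.card_sdiff_add_card_inter U' X
  rw [Finset.inter_comm] at sQ sW sU
  have cQ := h.c.cQ
  obtain ⟨k, hk⟩ : ∃ k, (Q \ X).card = k := ⟨_, rfl⟩
  have hkW : (W' \ X).card = k := by omega
  have hkU : (U' \ X).card = 2 * k := by omega
  have hk1 : m ≤ 2 * k := by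
    have : (X ∩ Q).card ≤ X.card := Finset.card_le_card Finset.inter_subset_left
    omega
  obtain ⟨A, hA, hAc⟩ := Finset.exists_subset_card_eq (s := U' \ X) (n := k) (by omega)
  have hCc : ((U' \ X) \ A).card = k := by
    rw [Finset.card_sdiff_of_subset hA]; omega
  let eq := (Finset.equivFinOfCardEq hk).symm
  let ew := (Finset.equivFinOfCardEq hkW).symm
  let ea := (Finset.equivFinOfCardEq hAc).symm
  let ec := (Finset.equivFinOfCardEq hCc).symm
  have mq : ∀ i, (eq i : V) ∈ Q ∧ (eq i : V) ∉ X := fun i => Finset.mem_sdiff.1 (eq i).2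
  have mw' : ∀ i, (ew i : V) ∈ W' ∧ (ew i : V) ∉ X := fun i => Finset.mem_sdiff.1 (ew i).2
  have ma' : ∀ i, (ea i : V) ∈ U' ∧ (ea i : V) ∉ X := fun i => Finset.mem_sdiff.1 (hA (ea i).2)
  have mc0 : ∀ i, (ec i : V) ∈ U' \ X ∧ (ec i : V) ∉ A := fun i => Finset.mem_sdiff.1 (ec i).2
  have mc' : ∀ i, (ec i : V) ∈ U' ∧ (ec i : V) ∉ X := fun i => Finset.mem_sdiff.1 (mc0 i).1
  have mw : ∀ i, (ew i : V) ∈ W := fun i => (h.hD _ (nD _ (mw' i).2)).2 (mw' i).1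
  have ma : ∀ i, (ea i : V) ∈ U := fun i => h.memU' (ma' i).1 (nD _ (ma' i).2)
  have mc : ∀ i, (ec i : V) ∈ U := fun i => h.memU' (mc' i).1 (nD _ (mc' i).2)
  have iq : ∀ i j, (eq i : V) = eq j → i = j := fun i j hh => eq.injective (Subtype.ext hh)
  have iw : ∀ i j, (ew i : V) = ew j → i = j := fun i j hh => ew.injective (Subtype.ext hh)
  have ia : ∀ i j, (ea i : V) = ea j → i = j := fun i j hh => ea.injective (Subtype.ext hh)
  have ic : ∀ i j, (ec i : V) = ec j → i = j := fun i j hh => ec.injective (Subtype.ext hh)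
  obtain ⟨s2, s3, s4, hs⟩ := latin
    (fun i j l p : Fin k => ({(eq i : V), (ew j : V), (ea l : V), (ec p : V)} : Finset V) ∈ H)
    (m ^ 3 / 100)
    (by
      intro i
      refine le_trans ?_ (gq _ (mq i).1 (mq i).2)
      refine Finset.card_le_card_of_injOn (fun t => (ew t.1, ea t.2.1, ec t.2.2)) ?_ ?_
      · rintro ⟨x, y, z⟩ ht
        simp only [n3, Finset.mem_coe, Finset.mem_filter, Finset.mem_product, Finset.mem_univ,
          true_and] at ht ⊢
        exact ⟨⟨mw _, ma _, mc _⟩, ht⟩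
      · rintro ⟨x, y, z⟩ - ⟨x', y', z'⟩ - hh
        simp only [Prod.mk.injEq] at hh ⊢
        exact ⟨iw _ _ hh.1, ia _ _ hh.2.1, ic _ _ hh.2.2⟩)
    (by
      intro i
      refine le_trans ?_ (gw _ (mw i) (mw' i).2)
      refine Finset.card_le_card_of_injOn (fun t => (eq t.1, ea t.2.1, ec t.2.2)) ?_ ?_
      · rintro ⟨x, y, z⟩ ht
        simp only [n3, Finset.mem_coe, Finset.mem_filter, Finset.mem_product, Finset.mem_univ,
          true_and] at ht ⊢
        refine ⟨⟨(mq _).1, ma _, mc _⟩, ?_⟩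
        rwa [Finset.insert_comm] at ht
      · rintro ⟨x, y, z⟩ - ⟨x', y', z'⟩ - hh
        simp only [Prod.mk.injEq] at hh ⊢
        exact ⟨iq _ _ hh.1, ia _ _ hh.2.1, ic _ _ hh.2.2⟩)
    (by
      intro i
      refine le_trans ?_ (gu _ (ma i) (ma' i).2)
      refine Finset.card_le_card_of_injOn (fun t => (eq t.1, ec t.2.2, ew t.2.1)) ?_ ?_
      · rintro ⟨x, y, z⟩ ht
        simp only [n3, Finset.mem_coe, Finset.mem_filter, Finset.mem_product, Finset.mem_univ,
          true_and] at ht ⊢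
        refine ⟨⟨(mq _).1, mc _, mw _⟩, ?_⟩
        convert ht using 2
        ext x; simp only [Finset.mem_insert, Finset.mem_singleton]; tauto
      · rintro ⟨x, y, z⟩ - ⟨x', y', z'⟩ - hh
        simp only [Prod.mk.injEq] at hh ⊢
        exact ⟨iq _ _ hh.1, iw _ _ hh.2.2, ic _ _ hh.2.1⟩)
    (by
      intro i
      refine le_trans ?_ (gu _ (mc i) (mc' i).2)
      refine Finset.card_le_card_of_injOn (fun t => (eq t.1, ea t.2.2, ew t.2.1)) ?_ ?_
      · rintro ⟨x, y, z⟩ ht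
        simp only [n3, Finset.mem_coe, Finset.mem_filter, Finset.mem_product, Finset.mem_univ,
          true_and] at ht ⊢
        refine ⟨⟨(mq _).1, ma _, mw _⟩, ?_⟩
        convert ht using 2
        ext x; simp only [Finset.mem_insert, Finset.mem_singleton]; tauto
      · rintro ⟨x, y, z⟩ - ⟨x', y', z'⟩ - hh
        simp only [Prod.mk.injEq] at hh ⊢
        exact ⟨iq _ _ hh.1, iw _ _ hh.2.2, ia _ _ hh.2.1⟩)
    (by
      rw [Fintype.card_fin]
      have e1 : m ^ 3 ≤ 8 * k ^ 3 := by
        calc m ^ 3 ≤ (2 * k) ^ 3 := Nat.pow_le_pow_left hk1 3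
          _ = 8 * k ^ 3 := by ring
      have e2 : 100 * k ^ 2 ≤ k ^ 3 := by
        rw [pow_succ k 2, mul_comm]; gcongr; omega
      have e3 : 0 < k ^ 2 := by have : 0 < k := by omega
                                positivity
      omega)
  have nQU : ∀ x ∈ Q, x ∉ U' := fun x hx hx' => ((h.hU' x).1 hx').1 hx
  have nQW : ∀ x ∈ Q, x ∉ W' := fun x hx hx' => h.dQW' x hx' hx
  have nWU : ∀ x ∈ W', x ∉ U' := fun x hx hx' => ((h.hU' x).1 hx').2 hx
  have fam := hcov.family (fun i => ({(eq i : V), (ew (s2 i) : V), (ea (s3 i) : V),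
    (ec (s4 i) : V)} : Finset V)) hs (by
      intro i
      simp [(mq i).2, (mw' (s2 i)).2, (ma' (s3 i)).2, (mc' (s4 i)).2]) (by
      intro i j hij
      have d1 : ∀ i j, (eq i : V) ≠ ew j := fun i j hh => nQW _ (mq i).1 (hh ▸ (mw' j).1)
      have d2 : ∀ i j, (eq i : V) ≠ ea j := fun i j hh => nQU _ (mq i).1 (hh ▸ (ma' j).1)
      have d3 : ∀ i j, (eq i : V) ≠ ec j := fun i j hh => nQU _ (mq i).1 (hh ▸ (mc' j).1)
      have d4 : ∀ i j, (ew i : V) ≠ ea j := fun i j hh => nWU _ (mw' i).1 (hh ▸ (ma' j).1)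
      have d5 : ∀ i j, (ew i : V) ≠ ec j := fun i j hh => nWU _ (mw' i).1 (hh ▸ (mc' j).1)
      have d6 : ∀ i j, (ea i : V) ≠ ec j := fun i j hh => (mc0 j).2 (hh ▸ (ea i).2)
      apply disjoint_four
      rintro x (hx | hx | hx | hx) (hy | hy | hy | hy) <;> rw [hx] at hy
      · exact hij (iq _ _ hy)
      · exact d1 _ _ hy
      · exact d2 _ _ hy
      · exact d3 _ _ hy
      · exact d1 _ _ hy.symm
      · exact hij (s2.injective (iw _ _ hy))
      · exact d4 _ _ hy
      · exact d5 _ _ hy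
      · exact d2 _ _ hy.symm
      · exact d4 _ _ hy.symm
      · exact hij (s3.injective (ia _ _ hy))
      · exact d6 _ _ hy
      · exact d3 _ _ hy.symm
      · exact d5 _ _ hy.symm
      · exact d6 _ _ hy.symm
      · exact hij (s4.injective (ic _ _ hy))) Finset.univ
  convert fam using 1
  symm
  rw [Finset.eq_univ_iff_forall]
  intro x
  rw [Finset.mem_union]
  by_cases hx : x ∈ X
  · exact Or.inl hx
  right
  rw [Finset.mem_biUnion]
  by_cases hxQ : x ∈ Q
  · refine ⟨eq.symm ⟨x, Finset.mem_sdiff.2 ⟨hxQ, hx⟩⟩, Finset.mem_univ _, ?_⟩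
    simp
  by_cases hxW : x ∈ W'
  · refine ⟨s2.symm (ew.symm ⟨x, Finset.mem_sdiff.2 ⟨hxW, hx⟩⟩), Finset.mem_univ _, ?_⟩
    simp
  have hxU : x ∈ U' \ X := Finset.mem_sdiff.2 ⟨(h.hU' x).2 ⟨hxQ, hxW⟩, hx⟩
  by_cases hxA : x ∈ A
  · refine ⟨s3.symm (ea.symm ⟨x, hxA⟩), Finset.mem_univ _, ?_⟩
    simp
  · refine ⟨s4.symm (ec.symm ⟨x, Finset.mem_sdiff.2 ⟨hxU, hxA⟩⟩), Finset.mem_univ _, ?_⟩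
    simp

theorem deg_pairs (hH : ∀ e ∈ H, e.card = 4) {u v : V} (huv : u ≠ v) :
    2 * (H.filter (fun e => u ∈ e ∧ v ∈ e)).card ≤
      (Finset.univ.filter (fun t : V × V => ({v, u, t.1, t.2} : Finset V) ∈ H)).card := by
  set T := Finset.univ.filter (fun t : V × V => ({v, u, t.1, t.2} : Finset V) ∈ H) with hT
  set K := H.filter (fun e => u ∈ e ∧ v ∈ e) with hK
  have hmap : Set.MapsTo (fun t : V × V => ({v, u, t.1, t.2} : Finset V)) (T : Set (V × V))
      (K : Set (Finset V)) := by
    rintro ⟨a, b⟩ ht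
    simp only [hT, hK, Finset.mem_coe, Finset.mem_filter, Finset.mem_univ, true_and] at ht ⊢
    exact ⟨ht, by simp, by simp⟩
  rw [Finset.card_eq_sum_card_fiberwise hmap, mul_comm, ← smul_eq_mul, ← Finset.sum_const]
  refine Finset.sum_le_sum fun e he => ?_
  simp only [hK, Finset.mem_filter] at he
  obtain ⟨he, hu, hv⟩ := he
  have hc : ((e.erase v).erase u).card = 2 := by
    rw [Finset.card_erase_of_mem (Finset.mem_erase.2 ⟨huv, hu⟩), Finset.card_erase_of_mem hv, hH e he]
  obtain ⟨a, b, hab, heq⟩ := Finset.card_eq_two.1 hc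
  have e1 : ({v, u, a, b} : Finset V) = e := by
    rw [← heq, Finset.insert_erase (Finset.mem_erase.2 ⟨huv, hu⟩), Finset.insert_erase hv]
  have e2 : ({v, u, b, a} : Finset V) = e := by rw [← e1, Finset.pair_comm]
  have hsub : ({(a, b), (b, a)} : Finset (V × V)) ⊆
      T.filter (fun t => ({v, u, t.1, t.2} : Finset V) = e) := by
    intro t ht
    simp only [Finset.mem_insert, Finset.mem_singleton] at ht
    rcases ht with rfl | rfl
    · simp [hT, e1, he]
    · simp [hT, e2, he]
  have := Finset.card_le_card hsub
  rwa [Finset.card_pair (by simp only [ne_eq, Prod.mk.injEq, not_and]; intro h1 _; exact hab h1)] at this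

theorem miss_tuples (K : Finset (Finset V)) (hK : ∀ e ∈ K, e.card = 4)
    (T : Finset (V × V × V × V))
    (hT : ∀ a b c d, (a, b, c, d) ∈ T → ({a, b, c, d} : Finset V) ∈ K) :
    T.card ≤ 256 * K.card := by
  have hmap : ∀ t ∈ T, (fun t : V × V × V × V => ({t.1, t.2.1, t.2.2.1, t.2.2.2} : Finset V)) t ∈ K := by
    rintro ⟨a, b, c, d⟩ ht
    exact hT a b c d ht
  refine Finset.card_le_mul_card_image_of_maps_to hmap 256 ?_
  intro e he
  have : T.filter (fun t => ({t.1, t.2.1, t.2.2.1, t.2.2.2} : Finset V) = e) ⊆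
      e ×ˢ e ×ˢ e ×ˢ e := by
    rintro ⟨a, b, c, d⟩ ht
    rw [Finset.mem_filter] at ht
    have h2 := ht.2
    simp only at h2
    rw [← h2]
    simp
  refine (Finset.card_le_card this).trans ?_
  simp [Finset.card_product, hK e he]

end fin

theorem two_choose (j : ℕ) : 2 * Nat.choose (j + 1) 2 = (j + 1) * j := by
  have : (j + 1) * Nat.choose j 1 = Nat.choose (j + 1) 2 * 2 := Nat.add_one_mul_choose_eq j 1
  rw [Nat.choose_one_right] at this
  omega

theorem build_ctx {V : Type*} [Fintype V] [DecidableEq V] {m : ℕ} {Q P U W : Finset V}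
    {H : Finset (Finset V)} (hm : 10 ^ 9 ≤ m) (cV : Fintype.card V = 4 * m)
    (hQP : Disjoint Q P) (hun : Q ∪ P = Finset.univ) (cQ : Q.card = m)
    (hH : ∀ e ∈ H, (e ∩ Q).card = 1 ∧ (e ∩ P).card = 3)
    (hUW : Disjoint U W) (hUWP : U ∪ W = P) (cU : U.card = 2 * m) (cW : W.card = m)
    (hclose : 10 ^ 13 * (extremalH13 Q P W \ H).card ≤ 256 * m ^ 4)
    (hdeg : ∀ u ∈ P, ∀ v ∈ Q, Nat.choose (3 * m - 1) 2 - Nat.choose (2 * m) 2 + 1 ≤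
            (H.filter (fun e => u ∈ e ∧ v ∈ e)).card) : Ctx m Q U W H := by
  subst hUWP
  have c4 : ∀ e : Finset V, (e ∩ Q).card = 1 → (e ∩ (U ∪ W)).card = 3 → e.card = 4 := by
    intro e h1 h2
    have : e = (e ∩ Q) ∪ (e ∩ (U ∪ W)) := by
      rw [← Finset.inter_union_distrib_left, hun, Finset.inter_univ]
    rw [this, Finset.card_union_of_disjoint, h1, h2]
    exact Finset.disjoint_of_subset_left Finset.inter_subset_right
      (Finset.disjoint_of_subset_right Finset.inter_subset_right hQP)
  obtain ⟨dQU, dQW⟩ := Finset.disjoint_union_right.1 hQP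
  have hcov : ∀ x, x ∈ Q ∨ x ∈ U ∨ x ∈ W := by
    intro x
    have := Finset.mem_univ x
    rw [← hun] at this
    simpa using this
  have cK : ∀ e ∈ extremalH13 Q (U ∪ W) W \ H, e.card = 4 := by
    intro e he
    have := (Finset.mem_filter.1 (Finset.mem_sdiff.1 he).1).2
    exact c4 e this.1 this.2.1
  have nUQ : ∀ x ∈ U, x ∉ Q := fun x hx hq => Finset.disjoint_left.1 dQU hq hx
  have nWQ : ∀ x ∈ W, x ∉ Q := fun x hx hq => Finset.disjoint_left.1 dQW hq hx
  have nUW : ∀ x ∈ U, x ∉ W := fun x hx hq => Finset.disjoint_left.1 hUW hx hq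
  have hm3 : 10 ^ 9 * m ^ 3 ≤ m ^ 4 := by rw [pow_succ m 3, mul_comm]; gcongr
  have ext_mem : ∀ q w a b : V, q ∈ Q → w ∈ W → a ∈ U → (b ∈ U ∨ b ∈ W) → w ≠ b → a ≠ b →
      ({q, w, a, b} : Finset V) ∉ H →
      ({q, w, a, b} : Finset V) ∈ extremalH13 Q (U ∪ W) W \ H := by
    intro q w a b hq hw ha hb hwb hab he
    have hbQ : b ∉ Q := by
      rcases hb with hb | hb
      · exact nUQ b hb
      · exact nWQ b hb
    have hne : q ≠ w ∧ q ≠ a ∧ q ≠ b ∧ w ≠ a ∧ w ≠ b ∧ a ≠ b := by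
      refine ⟨?_, ?_, ?_, ?_, hwb, hab⟩
      · rintro rfl; exact nWQ _ hw hq
      · rintro rfl; exact nUQ _ ha hq
      · rintro rfl; exact hbQ hq
      · rintro rfl; exact nUW _ ha hw
    have hqP : q ∉ U ∪ W := fun hh => Finset.disjoint_left.1 hQP hq hh
    rw [Finset.mem_sdiff]
    refine ⟨?_, he⟩
    refine Finset.mem_filter.2 ⟨Finset.mem_univ _, ?_, ?_, ?_, ?_⟩
    · rw [count_four Q hne]; simp [hq, nWQ w hw, nUQ a ha, hbQ]
    · have hwP : w ∈ U ∪ W := Finset.mem_union_right _ hw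
      have haP : a ∈ U ∪ W := Finset.mem_union_left _ ha
      have hbP : b ∈ U ∪ W := Finset.mem_union.2 hb
      rw [count_four (U ∪ W) hne, if_neg hqP, if_pos hwP, if_pos haP, if_pos hbP]
    · exact ⟨w, by simp [hw]⟩
    · intro hs
      exact nUW a ha (hs (by simp [ha]))
  refine ⟨hm, cV, cQ, cU, cW, dQU, dQW, hUW, hcov, hH, ?_, ?_, ?_⟩
  · intro u hu v hv
    have huP : u ∈ U ∪ W := by
      have := hcov u
      rw [Finset.mem_union]; tauto
    have h1 := hdeg u huP v hv
    have h2 := deg_pairs (H := H) (fun e he => c4 e (hH e he).1 (hH e he).2) (u := u) (v := v)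
      (by rintro rfl; exact hu hv)
    obtain ⟨k, rfl⟩ : ∃ k, m = k + 1 := ⟨m - 1, by omega⟩
    have t1 := two_choose (3 * k + 1)
    have t2 := two_choose (2 * k + 1)
    have s1 : 3 * (k + 1) - 1 = 3 * k + 1 + 1 := by omega
    have s2 : 2 * (k + 1) = 2 * k + 1 + 1 := by omega
    rw [s1, s2] at h1
    have e1 : (3 * k + 1 + 1) * (3 * k + 1) = 9 * k ^ 2 + 9 * k + 2 := by ring
    have e2 : (2 * k + 1 + 1) * (2 * k + 1) = 4 * k ^ 2 + 6 * k + 2 := by ring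
    have e3 : 5 * (k + 1) ^ 2 = 5 * k ^ 2 + 10 * k + 5 := by ring
    rw [e1] at t1
    rw [e2] at t2
    rw [e3]
    omega
  · set T := (Q ×ˢ W ×ˢ U ×ˢ U).filter
      (fun t => ({t.1, t.2.1, t.2.2.1, t.2.2.2} : Finset V) ∉ H) with hT
    have s1 : (T.filter (fun t => t.2.2.1 ≠ t.2.2.2)).card ≤
        256 * (extremalH13 Q (U ∪ W) W \ H).card := by
      refine miss_tuples _ cK _ ?_
      intro a b c d ht
      simp only [hT, Finset.mem_filter, Finset.mem_product] at ht
      obtain ⟨⟨⟨hq, hw, ha, hb⟩, he⟩, hne⟩ := ht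
      exact ext_mem a b c d hq hw ha (Or.inl hb) (by rintro rfl; exact nUW _ hb hw) hne he
    have s2 : (T.filter (fun t => ¬ t.2.2.1 ≠ t.2.2.2)).card ≤ (Q ×ˢ W ×ˢ U).card := by
      refine Finset.card_le_card_of_injOn (fun t => (t.1, t.2.1, t.2.2.1)) ?_ ?_
      · rintro ⟨a, b, c, d⟩ ht
        simp only [hT, Finset.mem_coe, Finset.mem_filter, Finset.mem_product] at ht ⊢
        exact ⟨ht.1.1.1, ht.1.1.2.1, ht.1.1.2.2.1⟩
      · rintro ⟨a, b, c, d⟩ h1 ⟨a', b', c', d'⟩ h2 hh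
        simp only [Finset.mem_coe, Finset.mem_filter, not_not, Prod.mk.injEq] at h1 h2 hh ⊢
        exact ⟨hh.1, hh.2.1, hh.2.2, h1.2.symm.trans (hh.2.2.trans h2.2)⟩
    have s3 := Finset.card_filter_add_card_filter_not (s := T) (fun t => t.2.2.1 ≠ t.2.2.2)
    have e : (Q ×ˢ W ×ˢ U).card = 2 * m ^ 3 := by
      simp only [Finset.card_product, cQ, cW, cU]; ring
    omega
  · set T := (Q ×ˢ W ×ˢ W ×ˢ U).filter
      (fun t => ({t.1, t.2.1, t.2.2.1, t.2.2.2} : Finset V) ∉ H) with hT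
    have s1 : (T.filter (fun t => t.2.1 ≠ t.2.2.1)).card ≤
        256 * (extremalH13 Q (U ∪ W) W \ H).card := by
      refine miss_tuples _ cK _ ?_
      intro a b c d ht
      simp only [hT, Finset.mem_filter, Finset.mem_product] at ht
      obtain ⟨⟨⟨hq, hw, hc, hd⟩, he⟩, hne⟩ := ht
      rw [Finset.pair_comm] at he ⊢
      exact ext_mem a b d c hq hw hd (Or.inr hc) hne (by rintro rfl; exact nUW _ hd hc) he
    have s2 : (T.filter (fun t => ¬ t.2.1 ≠ t.2.2.1)).card ≤ (Q ×ˢ W ×ˢ U).card := by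
      refine Finset.card_le_card_of_injOn (fun t => (t.1, t.2.1, t.2.2.2)) ?_ ?_
      · rintro ⟨a, b, c, d⟩ ht
        simp only [hT, Finset.mem_coe, Finset.mem_filter, Finset.mem_product] at ht ⊢
        exact ⟨ht.1.1.1, ht.1.1.2.1, ht.1.1.2.2.2⟩
      · rintro ⟨a, b, c, d⟩ h1 ⟨a', b', c', d'⟩ h2 hh
        simp only [Finset.mem_coe, Finset.mem_filter, not_not, Prod.mk.injEq] at h1 h2 hh ⊢
        exact ⟨hh.1, hh.2.1, h1.2.symm.trans (hh.2.1.trans h2.2), hh.2.2⟩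
    have s3 := Finset.card_filter_add_card_filter_not (s := T) (fun t => t.2.1 ≠ t.2.2.1)
    have e : (Q ×ˢ W ×ˢ U).card = 2 * m ^ 3 := by
      simp only [Finset.card_product, cQ, cW, cU]; ring
    omega

/-- There exist `ε₀ > 0` and `N` such that for every `0 < ε ≤ ε₀` and every
`n ∈ 3ℤ` with `n ≥ N`: if `H` is a balanced (1,3)-partite 4-graph with partition classes
`Q, P`, `3|Q| = |P| = n`, `H` is `ε`-close to some `H_{1,3}(n, n/3)` (with larger class
`P` and smaller class `Q`), and `d_H({u,v}) ≥ C(n-1,2) - C(2n/3,2) + 1` for all `u ∈ P`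
and `v ∈ Q`, then `H` has a perfect matching. -/
theorem pm_extremal_case :
    ∃ (ε₀ : ℝ) (N : ℕ), 0 < ε₀ ∧
      ∀ ε : ℝ, 0 < ε → ε ≤ ε₀ →
      ∀ n : ℕ, 3 ∣ n → N ≤ n →
      ∀ (Q P : Finset (Fin (n + n / 3))) (H : Finset (Finset (Fin (n + n / 3)))),
        Disjoint Q P → Q ∪ P = Finset.univ →
        Q.card = n / 3 → P.card = n →
        (∀ e ∈ H, (e ∩ Q).card = 1 ∧ (e ∩ P).card = 3) →
        (∃ U W : Finset (Fin (n + n / 3)), Disjoint U W ∧ U ∪ W = P ∧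
          U.card = 2 * n / 3 ∧ W.card = n / 3 ∧
          (((extremalH13 Q P W) \ H).card : ℝ) < ε * ((n + n / 3 : ℕ) : ℝ) ^ 4) →
        (∀ u ∈ P, ∀ v ∈ Q,
          Nat.choose (n - 1) 2 - Nat.choose (2 * n / 3) 2 + 1 ≤
            (H.filter (fun e => u ∈ e ∧ v ∈ e)).card) →
        ∃ M ⊆ H, (∀ e ∈ M, ∀ f ∈ M, e ≠ f → Disjoint e f) ∧
          ∀ x : Fin (n + n / 3), ∃ e ∈ M, x ∈ e := by
  refine ⟨1 / 10 ^ 13, 3 * 10 ^ 9, by positivity, ?_⟩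
  intro ε _ hε n hn3 hn Q P H hQP hun cQ _ hH hex hdeg
  obtain ⟨U, W, hUW, hUWP, cU, cW, hclose⟩ := hex
  obtain ⟨m, rfl⟩ := hn3
  have d1 : 3 * m / 3 = m := by omega
  have d2 : 2 * (3 * m) / 3 = 2 * m := by omega
  have hclose' : 10 ^ 13 * (extremalH13 Q P W \ H).card ≤ 256 * m ^ 4 := by
    have e : ((3 * m + 3 * m / 3 : ℕ) : ℝ) = 4 * (m : ℝ) := by
      rw [d1]; push_cast; ring
    rw [e] at hclose
    have h1 : ε * (4 * (m : ℝ)) ^ 4 ≤ 1 / 10 ^ 13 * (4 * (m : ℝ)) ^ 4 := by gcongr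
    have h2 : (10 : ℝ) ^ 13 * ((extremalH13 Q P W \ H).card : ℝ) ≤ 256 * (m : ℝ) ^ 4 := by
      have h3 := (hclose.trans_le h1).le
      calc (10 : ℝ) ^ 13 * ((extremalH13 Q P W \ H).card : ℝ)
          ≤ 10 ^ 13 * (1 / 10 ^ 13 * (4 * (m : ℝ)) ^ 4) := by gcongr
        _ = 256 * (m : ℝ) ^ 4 := by ring
    exact_mod_cast h2
  have hctx : Ctx m Q U W H := by
    refine build_ctx (P := P) (by omega) ?_ hQP hun (cQ.trans d1) hH hUW hUWP (cU.trans d2)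
      (cW.trans d1) hclose' ?_
    · rw [Fintype.card_fin]; omega
    · intro u hu v hv
      have := hdeg u hu v hv
      rw [d2] at this
      exact this
  obtain ⟨U', W', D, h2⟩ := hctx.exists_ctx2
  obtain ⟨M, hM, hdis, hcov⟩ := h2.finish
  refine ⟨M, hM, hdis, fun x => ?_⟩
  have hx := Finset.mem_univ x
  rw [← hcov, Finset.mem_biUnion] at hx
  exact hx
end

section
/- There exists ρ_0 > 0 such that for every ρ with 0 < ρ ≤ ρ_0 there exists ρ'_0 > 0 such that for every ρ' with 0 < ρ' ≤ ρ'_0 there exists N such that for every n ∈ 3ℤ with n ≥ N the following holds: if H is a (1,3)-partite 4-graph with partition classes Q, P, 3|Q| = |P| = n, and δ_1(H) ≥ (n/3)(C(n−1, 2) − C(2n/3, 2) + 1), then H has a matching M' such that |M'| ≤ ρn and, for every subset S ⊆ V(H) \ V(M') with |S| ≤ ρ'n and 3|S ∩ Q| = |S ∩ P|, the subgraph of H induced on S ∪ V(M') has a perfect matching. -/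
namespace Absorb

open Finset

section gen
variable {V : Type*} [DecidableEq V]

/-- `M` is a matching in `H` covering exactly `X`. -/
def PM (H : Finset (Finset V)) (X : Finset V) (M : Finset (Finset V)) : Prop :=
  M ⊆ H ∧ (∀ e ∈ M, ∀ f ∈ M, e ≠ f → Disjoint e f) ∧ M.biUnion id = X

lemma PM.union {H : Finset (Finset V)} {X Y : Finset V} {M N : Finset (Finset V)}
    (h1 : PM H X M) (h2 : PM H Y N) (hd : Disjoint X Y) : PM H (X ∪ Y) (M ∪ N) := by
  obtain ⟨a1, b1, rfl⟩ := h1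
  obtain ⟨a2, b2, rfl⟩ := h2
  refine ⟨union_subset a1 a2, ?_, by rw [union_biUnion]⟩
  have key : ∀ e ∈ M, ∀ f ∈ N, Disjoint e f := fun e he f hf =>
    Disjoint.mono (subset_biUnion_of_mem id he) (subset_biUnion_of_mem id hf) hd
  intro e he f hf hne
  rcases mem_union.1 he with he | he <;> rcases mem_union.1 hf with hf | hf
  · exact b1 e he f hf hne
  · exact key e he f hf
  · exact (key f hf e he).symm
  · exact b2 e he f hf hne

lemma PM.single {H : Finset (Finset V)} {e : Finset V} (h : e ∈ H) : PM H e {e} := by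
  refine ⟨by simpa using h, ?_, by simp⟩
  intro a ha b hb hne
  simp at ha hb
  exact absurd (ha.trans hb.symm) hne

lemma PM.empty (H : Finset (Finset V)) : PM H ∅ ∅ := by
  refine ⟨by simp, by simp, by simp⟩

/-- Greedy selection through a potential function. -/
lemma select {α τ : Type*} [DecidableEq α] (supp : α → Finset V) (A : Finset α) (T : Finset τ)
    (R : τ → α → Prop) [∀ s a, Decidable (R s a)] (c : ℝ) (hc : 0 < c) (hc1 : c ≤ 1) (t : ℕ)
    (hT : T.Nonempty)
    (hs : ∀ a ∈ A, (supp a).card ≤ 12)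
    (hne : ∀ a ∈ A, (supp a).Nonempty)
    (h : ∀ U : Finset V, U.card ≤ 12 * t → ∀ s ∈ T,
      0 < (A.filter (fun a => R s a ∧ Disjoint (supp a) U)).card ∧
      c * A.card ≤ (A.filter (fun a => R s a ∧ Disjoint (supp a) U)).card) :
    ∀ j ≤ t, ∃ F ⊆ A, F.card ≤ j ∧ (∀ a ∈ F, ∀ b ∈ F, a ≠ b → Disjoint (supp a) (supp b)) ∧
      ∑ s ∈ T, (1 / 2 : ℝ) ^ (F.filter (R s)).card ≤ T.card * (1 - c / 2) ^ j := by
  intro j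
  induction j with
  | zero => intro _; exact ⟨∅, by simp, by simp, by simp, by simp⟩
  | succ j ih =>
    intro hj
    obtain ⟨F, hFA, hFc, hFd, hFs⟩ := ih (by omega)
    set U := F.biUnion supp with hU
    have hUc : U.card ≤ 12 * t := by
      have : U.card ≤ F.card * 12 := card_biUnion_le_card_mul _ _ _ (fun a ha => hs a (hFA ha))
      have : F.card * 12 ≤ t * 12 := Nat.mul_le_mul_right _ (by omega)
      omega
    set B := A.filter (fun a => Disjoint (supp a) U) with hB
    have hBne : B.Nonempty := by
      obtain ⟨s, hsT⟩ := hT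
      obtain ⟨a, ha⟩ := card_pos.1 (h U hUc s hsT).1
      simp only [mem_filter] at ha
      exact ⟨a, by simp [hB, ha]⟩
    have hBA : (B.card : ℝ) ≤ A.card := by exact_mod_cast card_le_card (filter_subset _ _)
    have hcnt : ∀ s ∈ T, c * B.card ≤ (B.filter (R s)).card := by
      intro s hsT
      have h1 := (h U hUc s hsT).2
      have h2 : A.filter (fun a => R s a ∧ Disjoint (supp a) U) = B.filter (R s) := by
        ext a; simp [hB]; tauto
      rw [h2] at h1
      nlinarith
    set Φ : τ → ℝ := fun s => (1 / 2 : ℝ) ^ (F.filter (R s)).card with hΦ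
    have havg : ∑ a ∈ B, ∑ s ∈ T, Φ s * (if R s a then 1 / 2 else 1) ≤
        ∑ a ∈ B, (T.card * (1 - c / 2) ^ (j + 1) : ℝ) := by
      rw [sum_comm, sum_const, nsmul_eq_mul]
      have : ∀ s ∈ T, ∑ a ∈ B, Φ s * (if R s a then (1 / 2 : ℝ) else 1) ≤
          Φ s * (B.card * (1 - c / 2)) := by
        intro s hsT
        rw [← mul_sum]
        apply mul_le_mul_of_nonneg_left _ (by positivity)
        have e1 : ∀ a, (if R s a then (1 / 2 : ℝ) else 1) = 1 - (1/2) * (if R s a then 1 else 0) := by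
          intro a; split_ifs <;> norm_num
        simp_rw [e1]
        rw [sum_sub_distrib, ← mul_sum, sum_boole]
        have := hcnt s hsT
        simp
        linarith
      calc _ ≤ ∑ s ∈ T, Φ s * (B.card * (1 - c / 2)) := sum_le_sum this
        _ = (∑ s ∈ T, Φ s) * (B.card * (1 - c / 2)) := by rw [sum_mul]
        _ ≤ (T.card * (1 - c / 2) ^ j) * (B.card * (1 - c / 2)) := by
            apply mul_le_mul_of_nonneg_right hFs
            apply mul_nonneg (by positivity); linarith
        _ = _ := by ring
    obtain ⟨a, haB, ha⟩ := exists_le_of_sum_le hBne havg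
    have haA : a ∈ A := (mem_filter.1 haB).1
    have hadis : Disjoint (supp a) U := (mem_filter.1 haB).2
    have hdb : ∀ b ∈ F, Disjoint (supp a) (supp b) := fun b hb =>
      hadis.mono_right (subset_biUnion_of_mem supp hb)
    have haF : a ∉ F := by
      intro haF
      have := hdb a haF
      rw [disjoint_self] at this
      exact (hne a haA).ne_empty this
    refine ⟨insert a F, insert_subset haA hFA, ?_, ?_, ?_⟩
    · rw [card_insert_of_notMem haF]; omega
    · intro x hx y hy hxy
      rcases mem_insert.1 hx with hx1 | hx1 <;> rcases mem_insert.1 hy with hy1 | hy1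
      · exact absurd (hx1.trans hy1.symm) hxy
      · rw [hx1]; exact hdb y hy1
      · rw [hy1]; exact (hdb x hx1).symm
      · exact hFd x hx1 y hy1 hxy
    · refine le_trans (le_of_eq ?_) ha
      apply sum_congr rfl
      intro s _
      rw [filter_insert]
      split_ifs with hR
      · rw [card_insert_of_notMem (by simp [haF]), pow_succ]
      · simp [hΦ]

lemma card_prod_filter {X Y : Type*} [Fintype X] [Fintype Y] (p : X → Prop) [DecidablePred p]
    (r : X → Y → Prop) [∀ x, DecidablePred (r x)] (a b : ℕ)
    (ha : a ≤ (univ.filter p).card) (hb : ∀ x, p x → b ≤ (univ.filter (r x)).card) :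
    a * b ≤ (univ.filter (fun z : X × Y => p z.1 ∧ r z.1 z.2)).card := by
  classical
  have : (univ.filter (fun z : X × Y => p z.1 ∧ r z.1 z.2)).card =
      ∑ x ∈ univ.filter p, (univ.filter (r x)).card := by
    rw [← card_sigma]
    apply card_bij' (fun z _ => (⟨z.1, z.2⟩ : Σ _ : X, Y)) (fun z _ => (z.1, z.2))
    all_goals simp
  rw [this]
  calc a * b ≤ (univ.filter p).card * b := Nat.mul_le_mul_right _ ha
    _ = ∑ x ∈ univ.filter p, b := by simp
    _ ≤ _ := sum_le_sum (fun x hx => hb x (by simpa using hx))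

/-- Underlying set of a triple. -/
def ts (w : V × V × V) : Finset V := {w.1, w.2.1, w.2.2}

lemma ts_card (w : V × V × V) : (ts w).card ≤ 3 := card_le_three

lemma count_triples [Fintype V] (G : Finset (Finset V)) (hG : ∀ f ∈ G, f.card = 3) (U : Finset V) :
    G.card ≤ (univ.filter (fun w : V × V × V => ts w ∈ G ∧ Disjoint (ts w) U)).card
      + 3 * U.card * (Fintype.card V) ^ 2 := by
  classical
  have h1 : G.card ≤ (univ.filter (fun w : V × V × V => ts w ∈ G)).card := by
    have : G ⊆ (univ.filter (fun w : V × V × V => ts w ∈ G)).image ts := by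
      intro f hf
      obtain ⟨x, y, z, _, _, _, rfl⟩ := card_eq_three.1 (hG f hf)
      refine mem_image.2 ⟨(x, y, z), ?_, rfl⟩
      exact mem_filter.2 ⟨mem_univ _, hf⟩
    exact (card_le_card this).trans card_image_le
  have h2 : (univ.filter (fun w : V × V × V => ts w ∈ G)) ⊆
      (univ.filter (fun w : V × V × V => ts w ∈ G ∧ Disjoint (ts w) U)) ∪
      (U ×ˢ (univ ×ˢ univ) ∪ (univ ×ˢ (U ×ˢ univ) ∪ univ ×ˢ (univ ×ˢ U))) := by
    rintro ⟨x, y, z⟩ hw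
    simp only [mem_filter, mem_univ, true_and] at hw
    by_cases hx : x ∈ U
    · simp [hx]
    by_cases hy : y ∈ U
    · simp [hy]
    by_cases hz : z ∈ U
    · simp [hz]
    simp only [mem_union, mem_filter, mem_univ, true_and]
    left
    exact ⟨hw, by simp [ts, hx, hy, hz]⟩
  have h3 := card_le_card h2
  have h4 := card_union_le (univ.filter (fun w : V × V × V => ts w ∈ G ∧ Disjoint (ts w) U))
    (U ×ˢ ((univ : Finset V) ×ˢ (univ : Finset V)) ∪ (univ ×ˢ (U ×ˢ univ) ∪ univ ×ˢ (univ ×ˢ U)))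
  have h5 := card_union_le (U ×ˢ ((univ : Finset V) ×ˢ (univ : Finset V)))
    (univ ×ˢ (U ×ˢ univ) ∪ univ ×ˢ (univ ×ˢ U))
  have h6 := card_union_le ((univ : Finset V) ×ˢ (U ×ˢ (univ : Finset V))) (univ ×ˢ (univ ×ˢ U))
  simp only [card_product, card_univ] at h5 h6
  have : 3 * U.card * (Fintype.card V) ^ 2 = U.card * (Fintype.card V * Fintype.card V) +
    (Fintype.card V * (U.card * Fintype.card V) + Fintype.card V * (Fintype.card V * U.card)) := by ring
  omega

/-- `w` spans the link of `v`. -/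
def Lk (H : Finset (Finset V)) (v : V) (w : V × V × V) : Prop := v ∉ ts w ∧ insert v (ts w) ∈ H

/-- Link of `v`, as a set of triples. -/
def lnk (H : Finset (Finset V)) (v : V) : Finset (Finset V) :=
  (H.filter (fun e => v ∈ e)).image (fun e => e.erase v)

lemma mem_lnk {H : Finset (Finset V)} {v : V} {f : Finset V} :
    f ∈ lnk H v ↔ v ∉ f ∧ insert v f ∈ H := by
  simp only [lnk, mem_image, mem_filter]
  constructor
  · rintro ⟨e, ⟨he, hv⟩, rfl⟩
    exact ⟨by simp, by rwa [insert_erase hv]⟩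
  · rintro ⟨h1, h2⟩
    exact ⟨_, ⟨h2, by simp⟩, erase_insert h1⟩

lemma card_lnk (H : Finset (Finset V)) (v : V) :
    (lnk H v).card = (H.filter (fun e => v ∈ e)).card := by
  apply card_image_of_injOn
  intro e he f hf hef
  simp only [coe_filter, Set.mem_ofPred_eq] at he hf
  have : e.erase v = f.erase v := hef
  rw [← insert_erase he.2, ← insert_erase hf.2, this]

/-- The type of absorbers. -/
abbrev Abs (V : Type*) := (V × V × V) × (V × V × V) × (V × V × V) × (V × V × V)

/-- Vertices of an absorber. -/
def supp (a : Abs V) : Finset V := ts a.1 ∪ ts a.2.1 ∪ ts a.2.2.1 ∪ ts a.2.2.2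

lemma supp_card (a : Abs V) : (supp a).card ≤ 12 := by
  have h1 := ts_card a.1
  have h2 := ts_card a.2.1
  have h3 := ts_card a.2.2.1
  have h4 := ts_card a.2.2.2
  have h5 := card_union_le (ts a.1 ∪ ts a.2.1 ∪ ts a.2.2.1) (ts a.2.2.2)
  have h6 := card_union_le (ts a.1 ∪ ts a.2.1) (ts a.2.2.1)
  have h7 := card_union_le (ts a.1) (ts a.2.1)
  unfold supp
  omega

lemma supp_nonempty (a : Abs V) : (supp a).Nonempty := ⟨a.1.1, by simp [supp, ts]⟩

/-- Valid absorber. -/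
def Valid (H : Finset (Finset V)) (a : Abs V) : Prop :=
  (Lk H a.1.1 a.2.1 ∧ Lk H a.1.2.1 a.2.2.1 ∧ Lk H a.1.2.2 a.2.2.2) ∧
  (a.1.1 ≠ a.1.2.1 ∧ a.1.1 ≠ a.1.2.2 ∧ a.1.2.1 ≠ a.1.2.2) ∧
  Disjoint (ts a.2.1) (ts a.1) ∧ Disjoint (ts a.2.2.1) (ts a.1 ∪ ts a.2.1) ∧
  Disjoint (ts a.2.2.2) (ts a.1 ∪ ts a.2.1 ∪ ts a.2.2.1)

/-- `a` absorbs the quadruple `s`. -/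
def Rel (H : Finset (Finset V)) (s : V × V × V × V) (a : Abs V) : Prop :=
  Lk H s.1 a.1 ∧ Lk H s.2.1 a.2.1 ∧ Lk H s.2.2.1 a.2.2.1 ∧ Lk H s.2.2.2 a.2.2.2

lemma valid_pm {H : Finset (Finset V)} {a : Abs V} (h : Valid H a) :
    ∃ M, PM H (supp a) M ∧ M.card ≤ 3 := by
  obtain ⟨⟨u1, u2, u3⟩, w1, w2, w3⟩ := a
  obtain ⟨⟨l1, l2, l3⟩, ⟨n1, n2, n3⟩, d1, d2, d3⟩ := h
  simp only [Lk] at *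
  simp only [disjoint_union_right] at d1 d2 d3
  obtain ⟨d2, d21⟩ := d2
  obtain ⟨⟨d3, d31⟩, d32⟩ := d3
  have tu : ts (u1, u2, u3) = {u1, u2, u3} := rfl
  simp only [tu, disjoint_insert_right, disjoint_singleton_right] at d1 d2 d3
  have p := ((PM.single l1.2).union (PM.single l2.2) (by
    simp only [disjoint_insert_left, disjoint_insert_right, mem_insert]
    exact ⟨by tauto, by tauto, d21.symm⟩)).union (PM.single l3.2) (by
    simp only [disjoint_insert_left, disjoint_insert_right, mem_insert, mem_union,
      disjoint_union_left]
    exact ⟨by tauto, ⟨by tauto, d31.symm⟩, by tauto, d32.symm⟩)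
  have hX : supp ((u1, u2, u3), w1, w2, w3) =
      insert u1 (ts w1) ∪ insert u2 (ts w2) ∪ insert u3 (ts w3) := by
    ext x
    simp only [supp, tu, mem_union, mem_insert, mem_singleton]
    tauto
  rw [hX]
  refine ⟨_, p, ?_⟩
  rw [union_assoc, singleton_union, singleton_union]
  exact card_le_three

lemma absorb_pm {H : Finset (Finset V)} {a : Abs V} (h : Valid H a) {q p1 p2 p3 : V}
    (hr : Rel H (q, p1, p2, p3) a) (hd : Disjoint {q, p1, p2, p3} (supp a))
    (hq : q ≠ p1 ∧ q ≠ p2 ∧ q ≠ p3) (hp : p1 ≠ p2 ∧ p1 ≠ p3 ∧ p2 ≠ p3) :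
    ∃ M, PM H ({q, p1, p2, p3} ∪ supp a) M := by
  obtain ⟨u, w1, w2, w3⟩ := a
  obtain ⟨⟨l1, l2, l3⟩, ⟨n1, n2, n3⟩, d1, d2, d3⟩ := h
  obtain ⟨r0, r1, r2, r3⟩ := hr
  simp only [Lk] at *
  simp only [disjoint_union_right] at d1 d2 d3
  obtain ⟨d2, d21⟩ := d2
  obtain ⟨⟨d3, d31⟩, d32⟩ := d3
  simp only [supp, disjoint_insert_left, disjoint_singleton_left, mem_union, not_or] at hd
  have p := (((PM.single r0.2).union (PM.single r1.2) (by
    simp only [disjoint_insert_left, disjoint_insert_right, mem_insert]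
    exact ⟨by tauto, by tauto, d1.symm⟩)).union (PM.single r2.2) (by
    simp only [disjoint_insert_left, disjoint_insert_right, mem_insert, mem_union,
      disjoint_union_left]
    exact ⟨by tauto, ⟨by tauto, d2.symm⟩, by tauto, d21.symm⟩)).union (PM.single r3.2) (by
    simp only [disjoint_insert_left, disjoint_insert_right, mem_insert, mem_union,
      disjoint_union_left]
    exact ⟨by tauto, ⟨⟨by tauto, d3.symm⟩, by tauto, d31.symm⟩, by tauto, d32.symm⟩)
  have hX : {q, p1, p2, p3} ∪ supp (u, w1, w2, w3) =
      insert q (ts u) ∪ insert p1 (ts w1) ∪ insert p2 (ts w2) ∪ insert p3 (ts w3) := by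
    clear * -
    simp only [supp, insert_eq]
    ac_rfl
  rw [hX]
  exact ⟨_, p⟩

lemma family_pm {H : Finset (Finset V)} (F : Finset (Abs V)) (hv : ∀ a ∈ F, Valid H a)
    (hd : ∀ a ∈ F, ∀ b ∈ F, a ≠ b → Disjoint (supp a) (supp b)) :
    ∃ M, PM H (F.biUnion supp) M ∧ M.card ≤ 3 * F.card := by
  classical
  induction F using Finset.induction_on with
  | empty => exact ⟨∅, by simpa using PM.empty H, by simp⟩
  | insert a F ha ih =>
    obtain ⟨M, hM, hMc⟩ := ih (fun b hb => hv b (mem_insert_of_mem hb))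
      (fun b hb c hc => hd b (mem_insert_of_mem hb) c (mem_insert_of_mem hc))
    obtain ⟨M2, hM2, hMc2⟩ := valid_pm (hv a (mem_insert_self _ _))
    refine ⟨M2 ∪ M, ?_, ?_⟩
    · rw [biUnion_insert]
      apply hM2.union hM
      rw [disjoint_biUnion_right]
      intro b hb
      exact hd a (mem_insert_self _ _) b (mem_insert_of_mem hb) (fun h => ha (h ▸ hb))
    · have := card_union_le M2 M
      rw [card_insert_of_notMem ha]
      omega

open scoped Classical in
lemma absorb_all {H : Finset (Finset V)} (Q P : Finset V) (hQP : Disjoint Q P) (s : ℕ) :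
    ∀ (F : Finset (Abs V)) (S : Finset V), (∀ a ∈ F, Valid H a) →
    (∀ a ∈ F, ∀ b ∈ F, a ≠ b → Disjoint (supp a) (supp b)) →
    (∀ q ∈ Q, ∀ p1 ∈ P, ∀ p2 ∈ P, ∀ p3 ∈ P, s ≤ (F.filter (Rel H (q, p1, p2, p3))).card) →
    S ⊆ Q ∪ P → Disjoint S (F.biUnion supp) → (S ∩ Q).card = s → (S ∩ P).card = 3 * s →
    ∃ M, PM H (S ∪ F.biUnion supp) M := by
  induction s with
  | zero =>
    intro F S hv hd _ hS _ hSQ hSP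
    obtain ⟨M, hM, _⟩ := family_pm F hv hd
    have : S = ∅ := by
      have h0 : S ∩ P = ∅ := card_eq_zero.1 (by omega)
      rw [← inter_eq_left.2 hS, inter_union_distrib_left, card_eq_zero.1 hSQ, h0]
      simp
    exact ⟨M, by simpa [this] using hM⟩
  | succ s ih =>
    intro F S hv hd hR hS hSF hSQ hSP
    obtain ⟨q, hq⟩ : (S ∩ Q).Nonempty := card_pos.1 (by omega)
    obtain ⟨X, hX, hX3⟩ := exists_subset_card_eq (s := S ∩ P) (n := 3) (by omega)
    obtain ⟨p1, p2, p3, h12, h13, h23, rfl⟩ := card_eq_three.1 hX3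
    simp only [insert_subset_iff, singleton_subset_iff, mem_inter] at hX hq
    obtain ⟨⟨s1, t1⟩, ⟨s2, t2⟩, s3, t3⟩ := hX
    have hcard := hR q hq.2 p1 t1 p2 t2 p3 t3
    obtain ⟨a, ha⟩ : (F.filter (Rel H (q, p1, p2, p3))).Nonempty := card_pos.1 (by omega)
    obtain ⟨haF, har⟩ := mem_filter.1 ha
    have hqP : ∀ p ∈ P, q ≠ p := fun p hp h => disjoint_left.1 hQP hq.2 (h ▸ hp)
    set D : Finset V := {q, p1, p2, p3} with hD
    have hDS : D ⊆ S := by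
      simp only [hD, insert_subset_iff, singleton_subset_iff]; tauto
    have hFsplit : F.biUnion supp = supp a ∪ (F.erase a).biUnion supp := by
      rw [← biUnion_insert, insert_erase haF]
    have hsub : (F.erase a).biUnion supp ⊆ F.biUnion supp :=
      biUnion_subset_biUnion_of_subset_left _ (erase_subset _ _)
    have hsa : supp a ⊆ F.biUnion supp := subset_biUnion_of_mem supp haF
    obtain ⟨M2, hM2⟩ := absorb_pm (hv a haF) har (hSF.mono hDS hsa)
      ⟨hqP _ t1, hqP _ t2, hqP _ t3⟩ ⟨h12, h13, h23⟩
    have e1 : (S \ D) ∩ Q = (S ∩ Q).erase q := by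
      ext x
      simp only [hD, mem_inter, mem_sdiff, mem_insert, mem_singleton, mem_erase]
      constructor
      · tauto
      · rintro ⟨h1, h2, h3⟩
        refine ⟨⟨h2, ?_⟩, h3⟩
        rintro (rfl | rfl | rfl | rfl)
        · exact h1 rfl
        · exact disjoint_left.1 hQP h3 t1
        · exact disjoint_left.1 hQP h3 t2
        · exact disjoint_left.1 hQP h3 t3
    have e2 : (S \ D) ∩ P = (S ∩ P) \ {p1, p2, p3} := by
      ext x
      simp only [hD, mem_inter, mem_sdiff, mem_insert, mem_singleton]
      constructor
      · tauto
      · rintro ⟨⟨h2, h3⟩, h1⟩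
        refine ⟨⟨h2, ?_⟩, h3⟩
        rintro (rfl | h)
        · exact disjoint_left.1 hQP hq.2 h3
        · exact h1 h
    obtain ⟨M, hM⟩ := ih (F.erase a) (S \ D) (fun b hb => hv b (mem_of_mem_erase hb))
      (fun b hb c hc => hd b (mem_of_mem_erase hb) c (mem_of_mem_erase hc))
      (fun q hq p1 h1 p2 h2 p3 h3 => by
        have := hR q hq p1 h1 p2 h2 p3 h3
        rw [filter_erase]
        have := pred_card_le_card_erase (s := F.filter (Rel H (q, p1, p2, p3))) (a := a)
        omega)
      (sdiff_subset.trans hS) (hSF.mono sdiff_subset hsub)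
      (by rw [e1, card_erase_of_mem (by simp [hq]), hSQ]; simp)
      (by
        rw [e2, card_sdiff_of_subset, hSP, hX3]
        · omega
        · simp only [insert_subset_iff, singleton_subset_iff, mem_inter]; tauto)
    refine ⟨M2 ∪ M, ?_⟩
    have hh := hM2.union hM (by
      rw [disjoint_union_left, disjoint_union_right, disjoint_union_right]
      refine ⟨⟨disjoint_sdiff, hSF.mono hDS hsub⟩, (hSF.mono sdiff_subset hsa).symm, ?_⟩
      rw [disjoint_biUnion_right]
      intro b hb
      exact hd a haF b (mem_of_mem_erase hb) (ne_of_mem_erase hb).symm)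
    convert hh using 1
    rw [hFsplit]
    conv_lhs => rw [← union_sdiff_of_subset hDS]
    ext x
    simp only [mem_union]
    tauto

lemma card_edge {Q P : Finset V} [Fintype V] (hQP : Disjoint Q P)
    (hun : Q ∪ P = univ) {e : Finset V} (h : (e ∩ Q).card = 1 ∧ (e ∩ P).card = 3) :
    e.card = 4 := by
  have : e = (e ∩ Q) ∪ (e ∩ P) := by rw [← inter_union_distrib_left, hun, inter_univ]
  rw [this, card_union_of_disjoint (hQP.mono inter_subset_right inter_subset_right), h.1, h.2]

lemma lnk_card3 {H : Finset (Finset V)} {Q P : Finset V} [Fintype V] (hQP : Disjoint Q P)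
    (hun : Q ∪ P = univ) (hH : ∀ e ∈ H, (e ∩ Q).card = 1 ∧ (e ∩ P).card = 3) (v : V) :
    ∀ f ∈ lnk H v, f.card = 3 := by
  intro f hf
  obtain ⟨h1, h2⟩ := mem_lnk.1 hf
  have := card_edge hQP hun (hH _ h2)
  rw [card_insert_of_notMem h1] at this
  omega

lemma lnk_union_card {H : Finset (Finset V)} {Q P : Finset V} [Fintype V] (hQP : Disjoint Q P)
    (hun : Q ∪ P = univ) (hH : ∀ e ∈ H, (e ∩ Q).card = 1 ∧ (e ∩ P).card = 3) (u p : V)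
    (hu : u ∈ P) (hp : p ∈ P) :
    (lnk H u ∪ lnk H p).card ≤ Q.card * P.card.choose 2 := by
  have key : ∀ v ∈ P, ∀ f ∈ lnk H v, (f ∩ Q).card = 1 ∧ (f ∩ P).card = 2 := by
    intro v hv f hf
    obtain ⟨h1, h2⟩ := mem_lnk.1 hf
    have h3 := hH _ h2
    rw [insert_inter_of_notMem (disjoint_right.1 hQP hv), insert_inter_of_mem hv,
      card_insert_of_notMem (by simp [h1])] at h3
    omega
  have : Q.card * P.card.choose 2 = (powersetCard 1 Q ×ˢ powersetCard 2 P).card := by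
    simp [card_product]
  rw [this]
  apply card_le_card_of_injOn (fun f => (f ∩ Q, f ∩ P))
  · intro f hf
    have : (f ∩ Q).card = 1 ∧ (f ∩ P).card = 2 := by
      rcases mem_union.1 hf with hf | hf
      · exact key u hu f hf
      · exact key p hp f hf
    simp [mem_powersetCard, this]
  · intro f _ g _ hfg
    simp only [Prod.mk.injEq] at hfg
    rw [← inter_univ f, ← inter_univ g, ← hun, inter_union_distrib_left, inter_union_distrib_left,
      hfg.1, hfg.2]

lemma numeric (m : ℕ) (hm : 22 ≤ m) (d : ℕ)
    (hd : m * (Nat.choose (3 * m - 1) 2 - Nat.choose (2 * m) 2 + 1) ≤ d) :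
    m ^ 3 ≤ d ∧ m ^ 3 + 4 * (m * (3 * m).choose 2) ≤ 8 * d := by
  have hle : Nat.choose (2 * m) 2 ≤ Nat.choose (3 * m - 1) 2 :=
    Nat.choose_le_choose 2 (by omega)
  have hd' : (m : ℝ) * (((3 * m - 1 : ℝ)) * ((3 * m - 1 : ℝ) - 1) / 2 - (2 * m : ℝ) * (2 * m - 1) / 2 + 1) ≤ d := by
    have h : ((m * (Nat.choose (3 * m - 1) 2 - Nat.choose (2 * m) 2 + 1) : ℕ) : ℝ) ≤ d := by
      exact_mod_cast hd
    push_cast [Nat.cast_sub hle, Nat.cast_choose_two, Nat.cast_sub (show 1 ≤ 3 * m by omega)] at h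
    exact h
  have hm' : (22 : ℝ) ≤ m := by exact_mod_cast hm
  have h0 : (0 : ℝ) ≤ m * m * (m - 22) := by
    apply mul_nonneg (by positivity); linarith
  have h1 : (0 : ℝ) ≤ m * (m - 22) := by
    apply mul_nonneg (by positivity); linarith
  constructor
  · have : (m : ℝ) ^ 3 ≤ d := by nlinarith
    exact_mod_cast this
  · have : (m : ℝ) ^ 3 + 4 * (m * (((3 * m : ℕ) : ℝ) * ((3 * m : ℕ) - 1) / 2)) ≤ 8 * d := by
      push_cast
      nlinarith
    rw [← Nat.cast_choose_two] at this
    exact_mod_cast this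

open scoped Classical in
lemma count_links [Fintype V] {H : Finset (Finset V)} {Q P : Finset V} (hQP : Disjoint Q P)
    (hun : Q ∪ P = univ) (hH : ∀ e ∈ H, (e ∩ Q).card = 1 ∧ (e ∩ P).card = 3)
    (m : ℕ) (hm : 22 ≤ m) (hQ : Q.card = m) (hP : P.card = 3 * m)
    (hdeg : ∀ v : V, m * (Nat.choose (3 * m - 1) 2 - Nat.choose (2 * m) 2 + 1) ≤
      (H.filter (fun e => v ∈ e)).card) (U : Finset V) (hU : 384 * U.card ≤ m) :
    (∀ v, m ^ 3 / 8 ≤ (univ.filter (fun w => Lk H v w ∧ Disjoint (ts w) U)).card) ∧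
    (∀ u ∈ P, ∀ p ∈ P, m ^ 3 / 8 ≤
      (univ.filter (fun w => Lk H u w ∧ Lk H p w ∧ Disjoint (ts w) U)).card) := by
  have hN : Fintype.card V = 4 * m := by
    rw [← card_univ, ← hun, card_union_of_disjoint hQP, hQ, hP]; ring
  have hUm : 8 * (3 * U.card * (4 * m) ^ 2) ≤ m ^ 3 := by
    calc 8 * (3 * U.card * (4 * m) ^ 2) = 384 * U.card * m ^ 2 := by ring
      _ ≤ m * m ^ 2 := Nat.mul_le_mul_right _ hU
      _ = m ^ 3 := by ring
  constructor
  · intro v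
    have h1 := count_triples (lnk H v) (lnk_card3 hQP hun hH v) U
    have h2 : (univ.filter (fun w => ts w ∈ lnk H v ∧ Disjoint (ts w) U)) =
      (univ.filter (fun w => Lk H v w ∧ Disjoint (ts w) U)) := by
      ext w; simp only [mem_filter, mem_univ, true_and, mem_lnk]; rfl
    have h3 := (numeric m hm _ (hdeg v)).1
    rw [← card_lnk] at h3
    rw [hN] at h1
    have h2 := congrArg card h2
    omega
  · intro u hu p hp
    have h1 := count_triples (lnk H u ∩ lnk H p)
      (fun f hf => lnk_card3 hQP hun hH u f (mem_inter.1 hf).1) U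
    have h2 : (univ.filter (fun w => ts w ∈ lnk H u ∩ lnk H p ∧ Disjoint (ts w) U)) =
      (univ.filter (fun w => Lk H u w ∧ Lk H p w ∧ Disjoint (ts w) U)) := by
      ext w; simp only [mem_filter, mem_univ, true_and, mem_lnk, mem_inter]; unfold Lk; tauto
    have h3 := (numeric m hm _ (hdeg u)).2
    have h4 := (numeric m hm _ (hdeg p)).2
    rw [← card_lnk] at h3 h4
    have h5 := card_union_add_card_inter (lnk H u) (lnk H p)
    have h6 := lnk_union_card hQP hun hH u p hu hp
    rw [hQ, hP] at h6
    rw [hN] at h1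
    have h2 := congrArg card h2
    omega

open scoped Classical in
lemma count_abs [Fintype V] {H : Finset (Finset V)} {Q P : Finset V} (hQP : Disjoint Q P)
    (hun : Q ∪ P = univ) (hH : ∀ e ∈ H, (e ∩ Q).card = 1 ∧ (e ∩ P).card = 3)
    (m : ℕ) (hm : 22 ≤ m) (hQ : Q.card = m) (hP : P.card = 3 * m)
    (hdeg : ∀ v : V, m * (Nat.choose (3 * m - 1) 2 - Nat.choose (2 * m) 2 + 1) ≤
      (H.filter (fun e => v ∈ e)).card) (U : Finset V) (hU : 384 * (U.card + 9) ≤ m)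
    (q p1 p2 p3 : V) (hq : q ∈ Q) (h1 : p1 ∈ P) (h2 : p2 ∈ P) (h3 : p3 ∈ P) :
    (m ^ 3 / 8) ^ 4 ≤ ((univ.filter (Valid H)).filter
      (fun a => Rel H (q, p1, p2, p3) a ∧ Disjoint (supp a) U)).card := by
  have cl := fun U hU => count_links hQP hun hH m hm hQ hP hdeg U hU
  have huP : ∀ u : V × V × V, Lk H q u → (u.1 ∈ P ∧ u.2.1 ∈ P ∧ u.2.2 ∈ P) ∧
      (u.1 ≠ u.2.1 ∧ u.1 ≠ u.2.2 ∧ u.2.1 ≠ u.2.2) := by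
    rintro ⟨x, y, z⟩ ⟨hu1, hu2⟩
    have hc := (hH _ hu2)
    constructor
    · rw [insert_inter_of_mem hq, card_insert_of_notMem (by simp [hu1])] at hc
      have h0 : ts (x, y, z) ∩ Q = ∅ := card_eq_zero.1 (by omega)
      have hh : ∀ v ∈ ts (x, y, z), v ∈ P := by
        intro v hv
        have : v ∈ Q ∪ P := hun ▸ mem_univ v
        rcases mem_union.1 this with h | h
        · have : v ∈ ts (x, y, z) ∩ Q := mem_inter.2 ⟨hv, h⟩
          rw [h0] at this; simp at this
        · exact h
      exact ⟨hh _ (by simp [ts]), hh _ (by simp [ts]), hh _ (by simp [ts])⟩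
    · have := card_edge hQP hun hc
      rw [card_insert_of_notMem hu1] at this
      have h3 : ({x, y, z} : Finset V).card = 3 := by simpa [ts] using this
      refine ⟨?_, ?_, ?_⟩
      · intro h
        change x = y at h
        subst h
        have : ({x, x, z} : Finset V) = {x, z} := by simp
        have h4 := card_le_two (a := x) (b := z)
        rw [this] at h3; omega
      · intro h
        change x = z at h
        subst h
        have : ({x, y, x} : Finset V) = {x, y} := by ext; simp; tauto
        have h4 := card_le_two (a := x) (b := y)
        rw [this] at h3; omega
      · intro h
        change y = z at h
        subst h
        have : ({x, y, y} : Finset V) = {x, y} := by simp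
        have h4 := card_le_two (a := x) (b := y)
        rw [this] at h3; omega
  have c3 : ∀ u : V × V × V, Lk H q u → ∀ w1 w2 : V × V × V, m ^ 3 / 8 ≤ (univ.filter
      (fun w => Lk H u.2.2 w ∧ Lk H p3 w ∧ Disjoint (ts w) (U ∪ ts u ∪ ts w1 ∪ ts w2))).card := by
    intro u hu w1 w2
    refine (cl _ ?_).2 _ (huP u hu).1.2.2 _ h3
    have := ts_card u
    have := ts_card w1
    have := ts_card w2
    have := card_union_le (U ∪ ts u ∪ ts w1) (ts w2)
    have := card_union_le (U ∪ ts u) (ts w1)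
    have := card_union_le (U) (ts u)
    omega
  have c2 : ∀ u : V × V × V, Lk H q u → ∀ w1 : V × V × V, m ^ 3 / 8 ≤ (univ.filter
      (fun w => Lk H u.2.1 w ∧ Lk H p2 w ∧ Disjoint (ts w) (U ∪ ts u ∪ ts w1))).card := by
    intro u hu w1
    refine (cl _ ?_).2 _ (huP u hu).1.2.1 _ h2
    have := ts_card u
    have := ts_card w1
    have := card_union_le (U ∪ ts u) (ts w1)
    have := card_union_le (U) (ts u)
    omega
  have c1 : ∀ u : V × V × V, Lk H q u → m ^ 3 / 8 ≤ (univ.filter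
      (fun w => Lk H u.1 w ∧ Lk H p1 w ∧ Disjoint (ts w) (U ∪ ts u))).card := by
    intro u hu
    refine (cl _ ?_).2 _ (huP u hu).1.1 _ h1
    have := ts_card u
    have := card_union_le (U) (ts u)
    omega
  have c0 : m ^ 3 / 8 ≤ (univ.filter (fun w => Lk H q w ∧ Disjoint (ts w) U)).card :=
    (cl U (by omega)).1 q
  have e2 : ∀ u : V × V × V, Lk H q u → ∀ w1 : V × V × V, (m ^ 3 / 8) * (m ^ 3 / 8) ≤ _ :=
    fun u hu w1 => card_prod_filter _ (fun w2 w => Lk H u.2.2 w ∧ Lk H p3 w ∧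
      Disjoint (ts w) (U ∪ ts u ∪ ts w1 ∪ ts w2)) _ _ (c2 u hu w1) (fun w2 _ => c3 u hu w1 w2)
  have e1 : ∀ u : V × V × V, Lk H q u → (m ^ 3 / 8) * ((m ^ 3 / 8) * (m ^ 3 / 8)) ≤ _ :=
    fun u hu => card_prod_filter _ (fun w1 (w : (V × V × V) × (V × V × V)) =>
      (Lk H u.2.1 w.1 ∧ Lk H p2 w.1 ∧ Disjoint (ts w.1) (U ∪ ts u ∪ ts w1)) ∧
      (Lk H u.2.2 w.2 ∧ Lk H p3 w.2 ∧ Disjoint (ts w.2) (U ∪ ts u ∪ ts w1 ∪ ts w.1))) _ _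
      (c1 u hu) (fun w1 _ => e2 u hu w1)
  have e0 := card_prod_filter _ (fun u (w : (V × V × V) × (V × V × V) × (V × V × V)) =>
      (Lk H u.1 w.1 ∧ Lk H p1 w.1 ∧ Disjoint (ts w.1) (U ∪ ts u)) ∧
      (Lk H u.2.1 w.2.1 ∧ Lk H p2 w.2.1 ∧ Disjoint (ts w.2.1) (U ∪ ts u ∪ ts w.1)) ∧
      (Lk H u.2.2 w.2.2 ∧ Lk H p3 w.2.2 ∧ Disjoint (ts w.2.2) (U ∪ ts u ∪ ts w.1 ∪ ts w.2.1))) _ _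
      c0 (fun u hu => e1 u hu.1)
  have epow : (m ^ 3 / 8) ^ 4 = (m ^ 3 / 8) * ((m ^ 3 / 8) * ((m ^ 3 / 8) * (m ^ 3 / 8))) := by ring
  rw [epow]
  refine e0.trans (card_le_card ?_)
  rintro ⟨u, w1, w2, w3⟩ ha
  simp only [mem_filter, mem_univ, true_and, disjoint_union_right] at ha
  simp only [mem_filter, mem_univ, true_and, Valid, Rel, supp, disjoint_union_right,
    disjoint_union_left]
  have := (huP u ha.1.1).2
  tauto

open scoped Classical in
lemma core [Fintype V] {H : Finset (Finset V)} {Q P : Finset V} (hQP : Disjoint Q P)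
    (hun : Q ∪ P = univ) (hH : ∀ e ∈ H, (e ∩ Q).card = 1 ∧ (e ∩ P).card = 3)
    (m : ℕ) (hm : 22 ≤ m) (hQ : Q.card = m) (hP : P.card = 3 * m)
    (hdeg : ∀ v : V, m * (Nat.choose (3 * m - 1) 2 - Nat.choose (2 * m) 2 + 1) ≤
      (H.filter (fun e => v ∈ e)).card)
    (c : ℝ) (hc : c = 1 / 2 ^ 40) (M k : ℕ) (hM : (1 - c / 2) ^ M ≤ 1 / 4)
    (hk : 384 * (12 * (M * k) + 9) ≤ m) (hkm : 27 * (m : ℝ) ^ 4 * (1 / 2) ^ k < 1) :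
    ∃ F : Finset (Abs V), (∀ a ∈ F, Valid H a) ∧ F.card ≤ M * k ∧
      (∀ a ∈ F, ∀ b ∈ F, a ≠ b → Disjoint (supp a) (supp b)) ∧
      (∀ q ∈ Q, ∀ p1 ∈ P, ∀ p2 ∈ P, ∀ p3 ∈ P, k ≤ (F.filter (Rel H (q, p1, p2, p3))).card) := by
  have hN : Fintype.card V = 4 * m := by
    rw [← card_univ, ← hun, card_union_of_disjoint hQP, hQ, hP]; ring
  have hAcard : ((univ.filter (Valid H)).card : ℝ) ≤ (4 * m : ℝ) ^ 12 := by
    have h1 : (univ.filter (Valid H)).card ≤ Fintype.card (Abs V) := card_le_univ _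
    have h2 : Fintype.card (Abs V) = (4 * m) ^ 12 := by
      simp only [Abs, Fintype.card_prod, hN]; ring
    rw [h2] at h1
    exact_mod_cast h1
  have hdiv : (m : ℝ) ^ 3 / 16 ≤ ((m ^ 3 / 8 : ℕ) : ℝ) := by
    have h1 : m ^ 3 ≤ 16 * (m ^ 3 / 8) := by
      have : 22 ^ 3 ≤ m ^ 3 := Nat.pow_le_pow_left hm 3
      omega
    have h2 : (m : ℝ) ^ 3 ≤ 16 * ((m ^ 3 / 8 : ℕ) : ℝ) := by exact_mod_cast h1
    linarith
  have hm0 : (0 : ℝ) < m := by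
    have : 0 < m := by omega
    exact_mod_cast this
  set T : Finset (V × V × V × V) := Q ×ˢ P ×ˢ P ×ˢ P with hT
  have hTc : (T.card : ℝ) = 27 * (m : ℝ) ^ 4 := by
    simp only [hT, card_product, hQ, hP]; push_cast; ring
  have hTn : T.Nonempty := by
    apply card_pos.1
    have : (0 : ℝ) < T.card := by rw [hTc]; positivity
    exact_mod_cast this
  obtain ⟨F, hF1, hF2, hF3, hF4⟩ := select supp (univ.filter (Valid H)) T (Rel H) c
    (by rw [hc]; positivity) (by rw [hc]; norm_num) (M * k) hTn (fun a _ => supp_card a)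
    (fun a _ => supp_nonempty a) (by
      rintro U hU ⟨q, p1, p2, p3⟩ hs
      simp only [hT, mem_product] at hs
      have h1 := count_abs hQP hun hH m hm hQ hP hdeg U (by omega) q p1 p2 p3 hs.1 hs.2.1
        hs.2.2.1 hs.2.2.2
      have h2 : ((m : ℝ) ^ 3 / 16) ^ 4 ≤ (((univ.filter (Valid H)).filter
        (fun a => Rel H (q, p1, p2, p3) a ∧ Disjoint (supp a) U)).card : ℝ) := by
        calc ((m : ℝ) ^ 3 / 16) ^ 4 ≤ ((m ^ 3 / 8 : ℕ) : ℝ) ^ 4 :=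
              pow_le_pow_left₀ (by positivity) hdiv 4
          _ ≤ _ := by exact_mod_cast h1
      constructor
      · have h3 : (0 : ℝ) < ((m : ℝ) ^ 3 / 16) ^ 4 := by positivity
        exact_mod_cast h3.trans_le h2
      · refine le_trans ?_ h2
        calc c * _ ≤ c * (4 * m : ℝ) ^ 12 := by
              apply mul_le_mul_of_nonneg_left hAcard; rw [hc]; positivity
          _ = _ := by rw [hc]; ring) (M * k) le_rfl
  refine ⟨F, fun a ha => (mem_filter.1 (hF1 ha)).2, hF2, hF3, ?_⟩
  intro q hq p1 h1 p2 h2 p3 h3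
  by_contra hlt
  push Not at hlt
  have hs : (q, p1, p2, p3) ∈ T := by simp [hT, hq, h1, h2, h3]
  have i1 : (1 / 2 : ℝ) ^ k ≤ (1 / 2) ^ (F.filter (Rel H (q, p1, p2, p3))).card :=
    pow_le_pow_of_le_one (by norm_num) (by norm_num) hlt.le
  have i2 : (1 / 2 : ℝ) ^ (F.filter (Rel H (q, p1, p2, p3))).card ≤
      ∑ s ∈ T, (1 / 2 : ℝ) ^ (F.filter (Rel H s)).card :=
    single_le_sum (f := fun s => (1 / 2 : ℝ) ^ (F.filter (Rel H s)).card)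
      (fun s _ => by positivity) hs
  have i3 : (1 - c / 2) ^ (M * k) ≤ ((1 / 2) ^ k * (1 / 2) ^ k : ℝ) := by
    rw [pow_mul, ← mul_pow]
    apply pow_le_pow_left₀
    · apply pow_nonneg; rw [hc]; norm_num
    · refine hM.trans (by norm_num)
  rw [hTc] at hF4
  have i4 : (1 / 2 : ℝ) ^ k ≤ 27 * (m : ℝ) ^ 4 * ((1 / 2) ^ k * (1 / 2) ^ k) :=
    (i1.trans i2).trans (hF4.trans (mul_le_mul_of_nonneg_left i3 (by positivity)))
  have i5 : (0 : ℝ) < (1 / 2) ^ k := by positivity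
  nlinarith

end gen

lemma thresh (η : ℝ) (hη : 0 < η) : ∃ N : ℕ, ∀ m : ℕ, N ≤ m →
    27 * (m : ℝ) ^ 4 * (1 / 2) ^ ⌊η * m⌋₊ < 1 := by
  have h := tendsto_pow_const_mul_const_pow_of_abs_lt_one 4 (r := (1 / 2 : ℝ))
    (by rw [abs_of_pos] <;> norm_num)
  have h2 := (h.eventually (gt_mem_nhds (show (0 : ℝ) < η ^ 4 / 54 by positivity)))
  obtain ⟨K, hK⟩ := Filter.eventually_atTop.1 h2
  refine ⟨⌈K / η⌉₊, fun m hm => ?_⟩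
  have h3 : (K : ℝ) / η ≤ m := (Nat.le_ceil _).trans (by exact_mod_cast hm)
  rw [div_le_iff₀ hη] at h3
  have h4 : K ≤ ⌊η * m⌋₊ := Nat.le_floor (by linarith)
  set k := ⌊η * m⌋₊ with hk
  have h5 := hK (k + 1) (by omega)
  have h6 : η * m < k + 1 := Nat.lt_floor_add_one _
  have h7 : (η * m) ^ 4 ≤ ((k + 1 : ℕ) : ℝ) ^ 4 := by
    apply pow_le_pow_left₀ (by positivity)
    push_cast; exact h6.le
  have h8 : (η * m) ^ 4 * (1 / 2 : ℝ) ^ (k + 1) < η ^ 4 / 54 :=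
    (mul_le_mul_of_nonneg_right h7 (by positivity)).trans_lt h5
  have h9 : η ^ 4 * (27 * (m : ℝ) ^ 4 * (1 / 2) ^ k) < η ^ 4 * 1 := by
    have : η ^ 4 * (27 * (m : ℝ) ^ 4 * (1 / 2) ^ k) = 54 * ((η * m) ^ 4 * (1 / 2 : ℝ) ^ (k + 1)) := by
      ring
    rw [this]; linarith
  exact lt_of_mul_lt_mul_left h9 (by positivity)

end Absorb


/-- Absorbing Lemma: There exists `ρ₀ > 0` such that for every
`0 < ρ ≤ ρ₀` there exists `ρ'₀ > 0` such that for every `0 < ρ' ≤ ρ'₀` there exists `N`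
such that for every `n ∈ 3ℤ` with `n ≥ N`: if `H` is a (1,3)-partite 4-graph with
partition classes `Q, P`, `3|Q| = |P| = n`, and
`δ₁(H) ≥ (n/3)(C(n-1,2) - C(2n/3,2) + 1)`, then `H` has a matching `M'` with
`|M'| ≤ ρn` such that for every `S ⊆ V(H) \ V(M')` with `|S| ≤ ρ'n` and
`3|S ∩ Q| = |S ∩ P|`, the induced subgraph `H[S ∪ V(M')]` has a perfect matching. -/
theorem absorbing_lemma :
    ∃ ρ₀ : ℝ, 0 < ρ₀ ∧ ∀ ρ : ℝ, 0 < ρ → ρ ≤ ρ₀ →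
      ∃ ρ'₀ : ℝ, 0 < ρ'₀ ∧ ∀ ρ' : ℝ, 0 < ρ' → ρ' ≤ ρ'₀ →
        ∃ N : ℕ, ∀ n : ℕ, 3 ∣ n → N ≤ n →
          ∀ (Q P : Finset (Fin (n + n / 3))) (H : Finset (Finset (Fin (n + n / 3)))),
            Disjoint Q P → Q ∪ P = Finset.univ →
            Q.card = n / 3 → P.card = n →
            (∀ e ∈ H, (e ∩ Q).card = 1 ∧ (e ∩ P).card = 3) →
            (∀ v : Fin (n + n / 3),
              n / 3 * (Nat.choose (n - 1) 2 - Nat.choose (2 * n / 3) 2 + 1) ≤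
                (H.filter (fun e => v ∈ e)).card) →
            ∃ M' ⊆ H, (∀ e ∈ M', ∀ f ∈ M', e ≠ f → Disjoint e f) ∧
              (M'.card : ℝ) ≤ ρ * n ∧
              ∀ S : Finset (Fin (n + n / 3)),
                Disjoint S (M'.biUnion id) →
                (S.card : ℝ) ≤ ρ' * n →
                3 * (S ∩ Q).card = (S ∩ P).card →
                ∃ M ⊆ H, (∀ e ∈ M, ∀ f ∈ M, e ≠ f → Disjoint e f) ∧
                  (∀ e ∈ M, e ⊆ S ∪ M'.biUnion id) ∧
                  ∀ x ∈ S ∪ M'.biUnion id, ∃ e ∈ M, x ∈ e := by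
  classical
  obtain ⟨M, hM⟩ := exists_pow_lt_of_lt_one (show (0 : ℝ) < 1 / 4 by norm_num)
    (show (1 - (1 / 2 ^ 40 : ℝ) / 2) < 1 by norm_num)
  have hM0 : (1 : ℝ) ≤ M := by
    have : 1 ≤ M := by
      rcases Nat.eq_zero_or_pos M with h | h
      · rw [h] at hM; norm_num at hM
      · exact h
    exact_mod_cast this
  refine ⟨1, one_pos, fun ρ hρ _ => ?_⟩
  set η : ℝ := min ρ (1 / 10000) / M with hη
  have hη0 : 0 < η := by
    apply div_pos (lt_min hρ (by norm_num)); linarith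
  have hηM : M * η = min ρ (1 / 10000) := by rw [hη]; field_simp
  refine ⟨η, hη0, fun ρ' _ hρ'η => ?_⟩
  obtain ⟨N, hN⟩ := Absorb.thresh η hη0
  refine ⟨3 * (N + 10000), ?_⟩
  rintro n ⟨m, rfl⟩ hn Q P H hQP hun hQ hP hH hdeg
  have hn3 : 3 * m / 3 = m := by omega
  have h23 : 2 * (3 * m) / 3 = 2 * m := by omega
  have hQ' : Q.card = m := hQ.trans hn3
  simp only [h23] at hdeg
  have hdeg' : ∀ v, m * (Nat.choose (3 * m - 1) 2 - Nat.choose (2 * m) 2 + 1) ≤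
      (H.filter (fun e => v ∈ e)).card := by
    intro v
    exact (Nat.mul_le_mul_right _ hn3.ge).trans (hdeg v)
  set k := ⌊η * m⌋₊ with hk
  have hNm : N + 10000 ≤ m := Nat.le_of_mul_le_mul_left hn (by norm_num)
  have hm : 10000 ≤ m := (Nat.le_add_left _ _).trans hNm
  have hmR : (10000 : ℝ) ≤ m := by exact_mod_cast hm
  have hkη : (k : ℝ) ≤ η * m := Nat.floor_le (by positivity)
  have htR : ((M * k : ℕ) : ℝ) ≤ min ρ (1 / 10000) * m := by
    push_cast
    rw [← hηM, mul_assoc]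
    exact mul_le_mul_of_nonneg_left hkη (by linarith)
  have ht1 : ((M * k : ℕ) : ℝ) ≤ ρ * m :=
    htR.trans (mul_le_mul_of_nonneg_right (min_le_left _ _) (by linarith))
  have ht2 : ((M * k : ℕ) : ℝ) ≤ 1 / 10000 * m :=
    htR.trans (mul_le_mul_of_nonneg_right (min_le_right _ _) (by linarith))
  have hk384 : 384 * (12 * (M * k) + 9) ≤ m := by
    have : ((384 * (12 * (M * k) + 9) : ℕ) : ℝ) ≤ m := by
      rw [Nat.cast_mul, Nat.cast_add, Nat.cast_mul 12 (M * k)]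
      push_cast at ht2 ⊢
      linarith
    exact_mod_cast this
  obtain ⟨F, hF1, hF2, hF3, hF4⟩ := Absorb.core hQP hun hH m (le_trans (by norm_num) hm) hQ' hP hdeg' _ rfl M k
    hM.le hk384 (hN m ((Nat.le_add_right _ _).trans hNm))
  obtain ⟨M', ⟨hM1, hM2, hM3⟩, hMc⟩ := Absorb.family_pm F hF1 hF3
  refine ⟨M', hM1, hM2, ?_, ?_⟩
  · have h1 : M'.card ≤ 3 * (M * k) := hMc.trans (Nat.mul_le_mul_left _ hF2)
    have h2 : (M'.card : ℝ) ≤ 3 * ((M * k : ℕ) : ℝ) := by exact_mod_cast h1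
    push_cast at h2 ht1 ⊢
    linarith
  · intro S hS hSc hSb
    rw [hM3] at hS ⊢
    have hScard : S.card = (S ∩ Q).card + (S ∩ P).card := by
      rw [← Finset.card_union_of_disjoint
        (hQP.mono Finset.inter_subset_right Finset.inter_subset_right),
        ← Finset.inter_union_distrib_left, hun, Finset.inter_univ]
    have hsk : (S ∩ Q).card ≤ k := by
      apply Nat.le_floor
      have h1 : (S.card : ℝ) = 4 * (S ∩ Q).card := by
        have : S.card = 4 * (S ∩ Q).card := by omega
        exact_mod_cast this
      have h2 : ρ' * m ≤ η * m := mul_le_mul_of_nonneg_right hρ'η (by linarith)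
      have h3 : 0 < η * m := mul_pos hη0 (by linarith)
      push_cast at hSc
      linarith
    obtain ⟨M2, hA, hB, hC⟩ := Absorb.absorb_all Q P hQP (S ∩ Q).card F S hF1 hF3
      (fun q hq p1 h1 p2 h2 p3 h3 => hsk.trans (hF4 q hq p1 h1 p2 h2 p3 h3))
      (by rw [hun]; exact Finset.subset_univ _) hS rfl hSb.symm
    refine ⟨M2, hA, hB, ?_, ?_⟩
    · intro e he
      rw [← hC]
      exact Finset.subset_biUnion_of_mem id he
    · intro x hx
      rw [← hC] at hx
      simpa using hx
end

section
/- There exists N such that for every n ∈ 3ℤ with n ≥ N the following holds: let H be a (1,3)-partite 4-graph with partition classes Q, P such that 3|Q| = |P| = n and δ_1(H) ≥ (n/3)(C(n−1, 2) − C(2n/3, 2) + 1). Then every balanced 4-element set T ⊆ V(H) (i.e., |T ∩ Q| = 1 and |T ∩ P| = 3) has more than 10^{−8} n^{12} / 12! absorbing sets. -/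
open Finset in
lemma aux_count {X : Type*} [DecidableEq X] (s : Finset (Finset X))
    (t1 : Finset X → Finset (Finset X)) (t2 : Finset X → Finset X → Finset (Finset X))
    (t3 : Finset X → Finset X → Finset X → Finset (Finset X)) (A : Finset (Finset X))
    (m0 m : ℕ) (h0 : m0 ≤ s.card) (h1 : ∀ a ∈ s, m ≤ (t1 a).card)
    (h2 : ∀ a ∈ s, ∀ b ∈ t1 a, m ≤ (t2 a b).card)
    (h3 : ∀ a ∈ s, ∀ b ∈ t1 a, ∀ c ∈ t2 a b, m ≤ (t3 a b c).card)
    (hA : ∀ a ∈ A, a.card = 12)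
    (hm : ∀ a ∈ s, ∀ b ∈ t1 a, ∀ c ∈ t2 a b, ∀ d ∈ t3 a b c, a ∪ b ∪ c ∪ d ∈ A ∧
      a.card = 3 ∧ b.card = 3 ∧ c.card = 3 ∧ d.card = 3) :
    m0 * m ^ 3 ≤ 220 ^ 4 * A.card := by
  classical
  let S : Finset (Σ _ : Finset X, Σ _ : Finset X, Σ _ : Finset X, Finset X) :=
    s.sigma fun a => (t1 a).sigma fun b => (t2 a b).sigma fun c => t3 a b c
  have hS : m0 * m ^ 3 ≤ S.card := by
    simp only [S, card_sigma]
    calc m0 * m ^ 3 ≤ s.card * m ^ 3 := Nat.mul_le_mul_right _ h0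
      _ = ∑ a ∈ s, m ^ 3 := by simp
      _ ≤ _ := by
        refine sum_le_sum fun a ha => ?_
        calc m ^ 3 ≤ (t1 a).card * m ^ 2 := by
              rw [pow_succ' m 2]; exact Nat.mul_le_mul_right _ (h1 a ha)
          _ = ∑ b ∈ t1 a, m ^ 2 := by simp
          _ ≤ _ := by
            refine sum_le_sum fun b hb => ?_
            calc m ^ 2 ≤ (t2 a b).card * m := by
                  rw [pow_two]; exact Nat.mul_le_mul_right _ (h2 a ha b hb)
              _ = ∑ c ∈ t2 a b, m := by simp
              _ ≤ _ := sum_le_sum fun c hc => h3 a ha b hb c hc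
  refine hS.trans ?_
  have key := Finset.card_le_mul_card_image_of_maps_to (s := S) (t := A)
    (f := fun x => x.1 ∪ x.2.1 ∪ x.2.2.1 ∪ x.2.2.2) (by
      rintro ⟨a, b, c, d⟩ hx
      simp only [S, mem_sigma, mem_coe] at hx ⊢
      exact (hm a hx.1 b hx.2.1 c hx.2.2.1 d hx.2.2.2).1) (220 ^ 4) (by
      intro B hB
      have hc : ((powersetCard 3 B) ×ˢ (powersetCard 3 B) ×ˢ (powersetCard 3 B) ×ˢ
          (powersetCard 3 B)).card = 220 ^ 4 := by
        simp only [card_product, card_powersetCard, hA B hB]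
        have : Nat.choose 12 3 = 220 := by decide
        rw [this]; norm_num
      rw [← hc]
      refine Finset.card_le_card_of_injOn
        (fun x => (x.1, x.2.1, x.2.2.1, x.2.2.2)) ?_ ?_
      · rintro ⟨a, b, c, d⟩ hx
        simp only [S, mem_sigma, mem_coe, mem_filter] at hx
        obtain ⟨hx, rfl⟩ := hx
        obtain ⟨-, ha, hb, hc, hd⟩ := hm a hx.1 b hx.2.1 c hx.2.2.1 d hx.2.2.2
        simp only [mem_coe, mem_product, mem_powersetCard, ha, hb, hc, hd, and_true]
        refine ⟨?_, ?_, ?_, ?_⟩ <;> intro x hx <;> simp [hx]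
      · rintro ⟨a, b, c, d⟩ _ ⟨a', b', c', d'⟩ _ h
        simp only [Prod.mk.injEq] at h
        obtain ⟨rfl, rfl, rfl, rfl⟩ := h
        rfl)
  exact key

open Finset in
lemma aux_remove {X : Type*} [Fintype X] [DecidableEq X] (F : Finset (Finset X))
    (hF : ∀ U ∈ F, U.card = 3) (W : Finset X) :
    F.card ≤ (F.filter (fun U => Disjoint U W)).card + W.card * (Fintype.card X).choose 2 := by
  classical
  rw [← card_filter_add_card_filter_not (s := F) (fun U => Disjoint U W)]
  refine Nat.add_le_add_left ?_ _
  have : F.filter (fun U => ¬ Disjoint U W) ⊆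
      W.biUnion fun w => (powersetCard 2 (univ : Finset X)).image (insert w) := by
    intro U hU
    rw [mem_filter, not_disjoint_iff] at hU
    obtain ⟨hU, w, hw, hw'⟩ := hU
    simp only [mem_biUnion, mem_image, mem_powersetCard]
    refine ⟨w, hw', U.erase w, ⟨subset_univ _, ?_⟩, insert_erase hw⟩
    rw [card_erase_of_mem hw, hF U hU]
  refine (card_le_card this).trans ?_
  refine card_biUnion_le_card_mul _ _ _ fun w _ => ?_
  refine card_image_le.trans ?_
  rw [card_powersetCard, card_univ]

open Finset in
/-- the link of a vertex -/
def aux_link {X : Type*} [DecidableEq X] (H : Finset (Finset X)) (v : X) : Finset (Finset X) :=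
  (H.filter (fun e => v ∈ e)).image (fun e => e.erase v)

open Finset in
lemma aux_link_card {X : Type*} [DecidableEq X] (H : Finset (Finset X)) (v : X) :
    (aux_link H v).card = (H.filter (fun e => v ∈ e)).card := by
  refine card_image_of_injOn ?_
  intro e he f hf h
  simp only [mem_coe, mem_filter] at he hf h
  rw [← insert_erase he.2, ← insert_erase hf.2, h]

open Finset in
lemma aux_mem_link {X : Type*} [DecidableEq X] {H : Finset (Finset X)} {v : X} {U : Finset X}
    (h : U ∈ aux_link H v) : v ∉ U ∧ insert v U ∈ H := by
  simp only [aux_link, mem_image, mem_filter] at h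
  obtain ⟨e, ⟨he, hv⟩, rfl⟩ := h
  exact ⟨notMem_erase _ _, by rwa [insert_erase hv]⟩

lemma aux_choose (k : ℕ) (d : ℕ) 
    (hd : k * (Nat.choose (3 * k - 1) 2 - Nat.choose (2 * k) 2 + 1) ≤ d) :
    5 * k ^ 3 ≤ 2 * d + 7 * k ^ 2 := by
  rcases Nat.eq_zero_or_pos k with rfl | hk
  · simp
  obtain ⟨j, rfl⟩ : ∃ j, k = j + 1 := ⟨k - 1, by omega⟩
  have h1 : (3 * (j + 1) - 1).choose 2 * 2 = (3 * j + 2) * (3 * j + 1) := by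
    have := Nat.add_one_mul_choose_eq (3 * j + 1) 1
    simp at this
    rw [show 3 * (j + 1) - 1 = 3 * j + 1 + 1 by omega]
    linarith
  have h2 : (2 * (j + 1)).choose 2 * 2 = (2 * j + 2) * (2 * j + 1) := by
    have := Nat.add_one_mul_choose_eq (2 * j + 1) 1
    simp at this
    rw [show 2 * (j + 1) = 2 * j + 1 + 1 by omega]
    linarith
  have h3 := Nat.sub_add_cancel (n := (3 * (j + 1) - 1).choose 2) (m := (2 * (j + 1)).choose 2) 
    (by nlinarith)
  generalize (3 * (j + 1) - 1).choose 2 - (2 * (j + 1)).choose 2 = z at *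
  have : z * 2 + (2 * j + 2) * (2 * j + 1) = (3 * j + 2) * (3 * j + 1) := by rw [← h1, ← h2, ← h3]; ring
  have h4 : (z + 1) * 2 + 7 * (j+1) ≥ 5 * (j + 1)^2 := by nlinarith
  nlinarith [Nat.mul_le_mul_left (j+1) h4]

lemma aux_choose2 (m : ℕ) : 2 * m.choose 2 ≤ m ^ 2 := by
  rw [Nat.choose_two_right]
  have := Nat.mul_div_le (m * (m - 1)) 2
  have : m * (m - 1) ≤ m * m := Nat.mul_le_mul_left _ (by omega)
  nlinarith

open Finset in
lemma aux_common {X : Type*} [Fintype X] [DecidableEq X] (k : ℕ) (hk : 1000 ≤ k)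
    (Q P : Finset X) (H : Finset (Finset X)) (hd : Disjoint Q P) (hu : Q ∪ P = univ)
    (hQ : Q.card = k) (hP : P.card = 3 * k) (hH : ∀ e ∈ H, (e ∩ Q).card = 1 ∧ (e ∩ P).card = 3)
    (hdeg : ∀ v, 5 * k ^ 3 ≤ 2 * (H.filter (fun e => v ∈ e)).card + 7 * k ^ 2)
    (hX : Fintype.card X = 4 * k) (u v : X) (huP : u ∈ P) (hvP : v ∈ P) (W : Finset X)
    (hW : W.card ≤ 13) :
    k ^ 3 ≤ 4 * (((aux_link H u ∩ aux_link H v)).filter (fun U => Disjoint U W)).card := by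
  have hmem : ∀ w ∈ P, aux_link H w ⊆ (Q ×ˢ powersetCard 2 P).image (fun p => insert p.1 p.2) := by
    intro w hw U hU
    obtain ⟨h1, h2⟩ := aux_mem_link hU
    obtain ⟨h3, h4⟩ := hH _ h2
    have hwQ : w ∉ Q := fun h => disjoint_left.1 hd h hw
    rw [insert_inter_of_notMem hwQ] at h3
    rw [insert_inter_of_mem hw, card_insert_of_notMem (by simp [h1])] at h4
    obtain ⟨a, ha⟩ := card_eq_one.1 h3
    have haQ : a ∈ Q := by
      have : a ∈ U ∩ Q := by rw [ha]; simp
      exact (mem_inter.1 this).2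
    simp only [mem_image, mem_product, mem_powersetCard, Prod.exists]
    refine ⟨a, U ∩ P, ⟨haQ, inter_subset_right, by omega⟩, ?_⟩
    rw [insert_eq, ← ha, ← inter_union_distrib_left, hu, inter_univ]
  have hamb : (aux_link H u ∪ aux_link H v).card ≤ k * (3 * k).choose 2 := by
    refine (card_le_card (union_subset (hmem u huP) (hmem v hvP))).trans ?_
    refine card_image_le.trans ?_
    rw [card_product, card_powersetCard, hQ, hP]
  have h1 := card_union_add_card_inter (aux_link H u) (aux_link H v)
  rw [aux_link_card H u, aux_link_card H v] at h1
  have h2 := aux_remove (aux_link H u ∩ aux_link H v) (by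
    intro U hU
    have := hmem u huP (mem_inter.1 hU).1
    simp only [mem_image, mem_product, mem_powersetCard, Prod.exists] at this
    obtain ⟨a, b, ⟨ha, hb, hb2⟩, rfl⟩ := this
    rw [card_insert_of_notMem (fun h => disjoint_left.1 hd ha (hb h)), hb2]) W
  have h3 := hdeg u
  have h4 := hdeg v
  have h5 := aux_choose2 (3 * k)
  have h6 := aux_choose2 (4 * k)
  rw [hX] at h2
  have h7 : W.card * (4 * k).choose 2 ≤ 13 * (8 * k ^ 2) := Nat.mul_le_mul hW (by nlinarith)
  have h8 : 2 * (k * (3 * k).choose 2) ≤ 9 * k ^ 3 := by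
    have := Nat.mul_le_mul_left k h5
    nlinarith
  have h9 : 1000 * k ^ 2 ≤ k ^ 3 := by rw [pow_succ' k 2]; exact Nat.mul_le_mul_right _ hk
  omega

open Finset in
lemma aux_first {X : Type*} [Fintype X] [DecidableEq X] (k : ℕ) (hk : 1000 ≤ k)
    (Q P : Finset X) (H : Finset (Finset X)) (hd : Disjoint Q P) (hu : Q ∪ P = univ)
    (hH : ∀ e ∈ H, (e ∩ Q).card = 1 ∧ (e ∩ P).card = 3)
    (hdeg : ∀ v, 5 * k ^ 3 ≤ 2 * (H.filter (fun e => v ∈ e)).card + 7 * k ^ 2)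
    (hX : Fintype.card X = 4 * k) (q : X) (W : Finset X)
    (hW : W.card ≤ 4) :
    2 * k ^ 3 ≤ ((aux_link H q).filter (fun U => Disjoint U W)).card := by
  have h2 := aux_remove (aux_link H q) (by
    intro U hU
    obtain ⟨h1, h2⟩ := aux_mem_link hU
    obtain ⟨h3, h4⟩ := hH _ h2
    have : (insert q U).card = 4 := by
      rw [← inter_univ (insert q U), ← hu, inter_union_distrib_left, card_union_of_disjoint, h3, h4]
      exact hd.mono inter_subset_right inter_subset_right
    rw [card_insert_of_notMem h1] at this
    omega) W
  rw [aux_link_card H q] at h2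
  have h3 := hdeg q
  have h6 := aux_choose2 (4 * k)
  rw [hX] at h2
  have h7 : W.card * (4 * k).choose 2 ≤ 4 * (8 * k ^ 2) := Nat.mul_le_mul hW (by nlinarith)
  have h9 : 1000 * k ^ 2 ≤ k ^ 3 := by rw [pow_succ' k 2]; exact Nat.mul_le_mul_right _ hk
  omega

set_option maxHeartbeats 2000000 in
open Finset in
lemma aux_main {X : Type*} [Fintype X] [DecidableEq X] (k : ℕ) (hk : 1000 ≤ k)
    (Q P : Finset X) (H : Finset (Finset X)) (hd : Disjoint Q P) (hu : Q ∪ P = univ)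
    (hQ : Q.card = k) (hP : P.card = 3 * k) (hH : ∀ e ∈ H, (e ∩ Q).card = 1 ∧ (e ∩ P).card = 3)
    (hdeg : ∀ v, 5 * k ^ 3 ≤ 2 * (H.filter (fun e => v ∈ e)).card + 7 * k ^ 2)
    (T : Finset X) (hT : T.card = 4) (hTQ : (T ∩ Q).card = 1) (hTP : (T ∩ P).card = 3)
    (A : Finset (Finset X)) (hA : ∀ B, B ∈ A ↔
      B.card = 12 ∧ (B ∩ Q).card = 3 ∧ (B ∩ P).card = 9 ∧ Disjoint B T ∧
                (∃ M ⊆ H, M.card = 3 ∧ (∀ e ∈ M, e ⊆ B) ∧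
                  ∀ e ∈ M, ∀ f ∈ M, e ≠ f → Disjoint e f) ∧
                (∃ M ⊆ H, M.card = 4 ∧ (∀ e ∈ M, e ⊆ B ∪ T) ∧
                  ∀ e ∈ M, ∀ f ∈ M, e ≠ f → Disjoint e f)) :
    k ^ 12 ≤ 32 * 220 ^ 4 * A.card := by
  classical
  have hX : Fintype.card X = 4 * k := by
    rw [← card_univ, ← hu, card_union_of_disjoint hd, hQ, hP]; ring
  obtain ⟨q, hq⟩ := card_eq_one.1 hTQ
  obtain ⟨u1, u2, u3, h12, h13, h23, hus⟩ := card_eq_three.1 hTP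
  have hqT : q ∈ T ∧ q ∈ Q := by rw [← mem_inter, hq]; simp
  have hu1 : u1 ∈ T ∧ u1 ∈ P := by rw [← mem_inter, hus]; simp
  have hu2 : u2 ∈ T ∧ u2 ∈ P := by rw [← mem_inter, hus]; simp
  have hu3 : u3 ∈ T ∧ u3 ∈ P := by rw [← mem_inter, hus]; simp
  have hQP : ∀ x, x ∈ Q → x ∉ P := fun x hx hx' => disjoint_left.1 hd hx hx'
  have hcard : ∀ B : Finset X, B.card = (B ∩ Q).card + (B ∩ P).card := by
    intro B
    rw [← card_union_of_disjoint (hd.mono inter_subset_right inter_subset_right),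
      ← inter_union_distrib_left, hu, inter_univ]
  have : Nonempty X := ⟨q⟩
  have hv : ∀ V : Finset X, ∃ v1 v2 v3, V.card = 3 →
      (v1 ≠ v2 ∧ v1 ≠ v3 ∧ v2 ≠ v3 ∧ V = {v1, v2, v3}) := by
    intro V
    by_cases h : V.card = 3
    · obtain ⟨a, b, c, h⟩ := card_eq_three.1 h
      exact ⟨a, b, c, fun _ => h⟩
    · exact ⟨q, q, q, fun h' => absurd h' h⟩
  choose v1 v2 v3 hv using hv
  let s := (aux_link H q).filter (fun U => Disjoint U T)
  let C : X → X → Finset X → Finset (Finset X) := fun u v W =>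
    (aux_link H u ∩ aux_link H v).filter (fun U => Disjoint U W)
  have hs : ∀ V ∈ s, V.card = 3 ∧ (V ∩ Q).card = 0 ∧ (V ∩ P).card = 3 ∧ V ⊆ P ∧
      insert q V ∈ H ∧ Disjoint V T := by
    intro V hV
    obtain ⟨hV, hVT⟩ := mem_filter.1 hV
    obtain ⟨h1, h2⟩ := aux_mem_link hV
    obtain ⟨h3, h4⟩ := hH _ h2
    rw [insert_inter_of_mem hqT.2, card_insert_of_notMem (by simp [h1])] at h3
    rw [insert_inter_of_notMem (hQP q hqT.2)] at h4
    have h5 := hcard V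
    have h6 : V ∩ P = V := eq_of_subset_of_card_le inter_subset_left (by omega)
    exact ⟨by omega, by omega, h4, inter_eq_left.1 h6, h2, hVT⟩
  have hC : ∀ u v W U, u ∈ P → v ∈ P → U ∈ C u v W → U.card = 3 ∧ (U ∩ Q).card = 1 ∧
      (U ∩ P).card = 2 ∧ insert u U ∈ H ∧ insert v U ∈ H ∧ Disjoint U W := by
    intro u v W U huP hvP hU
    obtain ⟨hU, hUW⟩ := mem_filter.1 hU
    rw [mem_inter] at hU
    obtain ⟨h1, h2⟩ := aux_mem_link hU.1
    obtain ⟨h1', h2'⟩ := aux_mem_link hU.2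
    obtain ⟨h3, h4⟩ := hH _ h2
    have huQ : u ∉ Q := fun h => hQP u h huP
    rw [insert_inter_of_notMem huQ] at h3
    rw [insert_inter_of_mem huP, card_insert_of_notMem (by simp [h1])] at h4
    have h5 := hcard U
    exact ⟨by omega, h3, by omega, h2, h2', hUW⟩
  have hCc : ∀ u v W, u ∈ P → v ∈ P → W.card ≤ 13 → k ^ 3 ≤ 4 * (C u v W).card := by
    intro u v W huP hvP hW
    exact aux_common k hk Q P H hd hu hQ hP hH hdeg hX u v huP hvP W hW
  have hvm : ∀ V ∈ s, (v1 V ∈ V ∧ v2 V ∈ V ∧ v3 V ∈ V) ∧ (v1 V ∈ P ∧ v2 V ∈ P ∧ v3 V ∈ P) := by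
    intro V hV
    obtain ⟨h1, -, -, h2, -⟩ := hs V hV
    have h3 := (hv V h1).2.2.2
    have : v1 V ∈ V ∧ v2 V ∈ V ∧ v3 V ∈ V := by
      have hx : ∀ x, x = v1 V ∨ x = v2 V ∨ x = v3 V → x ∈ V := by
        intro x hx
        rw [h3]
        simpa only [mem_insert, mem_singleton] using hx
      exact ⟨hx _ (Or.inl rfl), hx _ (Or.inr (Or.inl rfl)), hx _ (Or.inr (Or.inr rfl))⟩
    exact ⟨this, h2 this.1, h2 this.2.1, h2 this.2.2⟩
  have hk3 : ∀ c : ℕ, k ^ 3 ≤ 4 * c → (k ^ 3 + 3) / 4 ≤ c := by intro c hc; omega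
  have key := aux_count s (fun V => C u1 (v1 V) (T ∪ V))
    (fun V U1 => C u2 (v2 V) (T ∪ V ∪ U1)) (fun V U1 U2 => C u3 (v3 V) (T ∪ V ∪ U1 ∪ U2))
    A (2 * k ^ 3) ((k ^ 3 + 3) / 4)
    (aux_first k hk Q P H hd hu hH hdeg hX q T hT.le)
    (by
      intro V hV
      obtain ⟨-, p1, p2, p3⟩ := hvm V hV
      refine hk3 _ (hCc _ _ _ hu1.2 p1 ?_)
      have := card_union_le T V
      have := (hs V hV).1
      omega)
    (by
      intro V hV U1 hU1
      obtain ⟨-, p1, p2, p3⟩ := hvm V hV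
      refine hk3 _ (hCc _ _ _ hu2.2 p2 ?_)
      have := card_union_le T V
      have := card_union_le (T ∪ V) U1
      have := (hs V hV).1
      have := (hC _ _ _ _ hu1.2 p1 hU1).1
      omega)
    (by
      intro V hV U1 hU1 U2 hU2
      obtain ⟨-, p1, p2, p3⟩ := hvm V hV
      refine hk3 _ (hCc _ _ _ hu3.2 p3 ?_)
      have := card_union_le T V
      have := card_union_le (T ∪ V) U1
      have := card_union_le (T ∪ V ∪ U1) U2
      have := (hs V hV).1
      have := (hC _ _ _ _ hu1.2 p1 hU1).1
      have := (hC _ _ _ _ hu2.2 p2 hU2).1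
      omega)
    (fun B hB => ((hA B).1 hB).1)
    (by
      intro V hV U1 hU1 U2 hU2 U3 hU3
      obtain ⟨⟨m1, m2, m3⟩, p1, p2, p3⟩ := hvm V hV
      obtain ⟨cV, cVQ, cVP, -, eV, dV⟩ := hs V hV
      obtain ⟨c1, c1Q, c1P, e1, f1, d1⟩ := hC _ _ _ _ hu1.2 p1 hU1
      obtain ⟨c2, c2Q, c2P, e2, f2, d2⟩ := hC _ _ _ _ hu2.2 p2 hU2
      obtain ⟨c3, c3Q, c3P, e3, f3, d3⟩ := hC _ _ _ _ hu3.2 p3 hU3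
      obtain ⟨n12, n13, n23, -⟩ := hv V cV
      clear hU1 hU2 hU3 hv hvm hC hCc hs
      generalize v1 V = w1 at *
      generalize v2 V = w2 at *
      generalize v3 V = w3 at *
      simp only [disjoint_union_right] at d1 d2 d3
      obtain ⟨d1T, d1V⟩ := d1
      obtain ⟨⟨d2T, d2V⟩, d21⟩ := d2
      obtain ⟨⟨⟨d3T, d3V⟩, d31⟩, d32⟩ := d3
      have hun : ∀ R : Finset X, ((V ∪ U1 ∪ U2 ∪ U3) ∩ R).card =
          (V ∩ R).card + (U1 ∩ R).card + (U2 ∩ R).card + (U3 ∩ R).card := by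
        intro R
        rw [union_inter_distrib_right, union_inter_distrib_right, union_inter_distrib_right,
          card_union_of_disjoint, card_union_of_disjoint, card_union_of_disjoint]
        · exact d1V.symm.mono inter_subset_left inter_subset_left
        · rw [← union_inter_distrib_right]
          refine Disjoint.mono inter_subset_left inter_subset_left ?_
          exact disjoint_union_left.2 ⟨d2V.symm, d21.symm⟩
        · rw [← union_inter_distrib_right, ← union_inter_distrib_right]
          refine Disjoint.mono inter_subset_left inter_subset_left ?_
          simp only [disjoint_union_left]
          exact ⟨⟨d3V.symm, d31.symm⟩, d32.symm⟩
      have hunQ := hun Q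
      have hunP := hun P
      have hc12 := hcard (V ∪ U1 ∪ U2 ∪ U3)
      rw [disjoint_left] at d1T d1V d2T d2V d21 d3T d3V d31 d32 dV
      refine ⟨(hA _).2 ⟨by omega, by omega, by omega, ?_, ?_, ?_⟩, cV, c1, c2, c3⟩
      · simp only [disjoint_union_left]
        simp only [disjoint_left]
        exact ⟨⟨⟨dV, d1T⟩, d2T⟩, d3T⟩
      · have D12 : Disjoint (insert w1 U1) (insert w2 U2) := by
          rw [disjoint_left]; intro x hx hy; simp only [mem_insert] at hx hy; grind
        have D13 : Disjoint (insert w1 U1) (insert w3 U3) := by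
          rw [disjoint_left]; intro x hx hy; simp only [mem_insert] at hx hy; grind
        have D23 : Disjoint (insert w2 U2) (insert w3 U3) := by
          rw [disjoint_left]; intro x hx hy; simp only [mem_insert] at hx hy; grind
        refine ⟨{insert w1 U1, insert w2 U2, insert w3 U3}, ?_, ?_, ?_, ?_⟩
        · intro e he; simp only [mem_insert, mem_singleton] at he; grind
        · exact card_eq_three.2 ⟨_, _, _, D12.ne (insert_ne_empty _ _),
            D13.ne (insert_ne_empty _ _), D23.ne (insert_ne_empty _ _), rfl⟩
        · intro e he x hx
          simp only [mem_insert, mem_singleton] at he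
          simp only [mem_union]
          rcases he with rfl | rfl | rfl <;> simp only [mem_insert] at hx <;> grind
        · intro e he f hf hef
          simp only [mem_insert, mem_singleton] at he hf
          rcases he with rfl | rfl | rfl <;> rcases hf with rfl | rfl | rfl <;>
            first
            | exact absurd rfl hef
            | assumption
            | (apply Disjoint.symm; assumption)
      · have D12 : Disjoint (insert u1 U1) (insert u2 U2) := by
          rw [disjoint_left]; intro x hx hy; simp only [mem_insert] at hx hy; grind
        have D13 : Disjoint (insert u1 U1) (insert u3 U3) := by
          rw [disjoint_left]; intro x hx hy; simp only [mem_insert] at hx hy; grind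
        have D23 : Disjoint (insert u2 U2) (insert u3 U3) := by
          rw [disjoint_left]; intro x hx hy; simp only [mem_insert] at hx hy; grind
        have D01 : Disjoint (insert q V) (insert u1 U1) := by
          rw [disjoint_left]; intro x hx hy; simp only [mem_insert] at hx hy; grind
        have D02 : Disjoint (insert q V) (insert u2 U2) := by
          rw [disjoint_left]; intro x hx hy; simp only [mem_insert] at hx hy; grind
        have D03 : Disjoint (insert q V) (insert u3 U3) := by
          rw [disjoint_left]; intro x hx hy; simp only [mem_insert] at hx hy; grind
        refine ⟨{insert q V, insert u1 U1, insert u2 U2, insert u3 U3}, ?_, ?_, ?_, ?_⟩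
        · intro e he; simp only [mem_insert, mem_singleton] at he; grind
        · rw [card_insert_of_notMem]
          · rw [card_eq_three.2 ⟨_, _, _, D12.ne (insert_ne_empty _ _),
              D13.ne (insert_ne_empty _ _), D23.ne (insert_ne_empty _ _), rfl⟩]
          · simp only [mem_insert, mem_singleton, not_or]
            exact ⟨D01.ne (insert_ne_empty _ _),
              D02.ne (insert_ne_empty _ _), D03.ne (insert_ne_empty _ _)⟩
        · intro e he x hx
          simp only [mem_insert, mem_singleton] at he
          simp only [mem_union]
          rcases he with rfl | rfl | rfl | rfl <;> simp only [mem_insert] at hx <;> grind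
        · intro e he f hf hef
          simp only [mem_insert, mem_singleton] at he hf
          rcases he with rfl | rfl | rfl | rfl <;> rcases hf with rfl | rfl | rfl | rfl <;>
            first
            | exact absurd rfl hef
            | assumption
            | (apply Disjoint.symm; assumption))
  have h1 : k ^ 3 ≤ 4 * ((k ^ 3 + 3) / 4) := by omega
  have h2 := Nat.pow_le_pow_left h1 3
  calc k ^ 12 = k ^ 3 * (k ^ 3) ^ 3 := by ring
    _ ≤ k ^ 3 * (4 * ((k ^ 3 + 3) / 4)) ^ 3 := Nat.mul_le_mul_left _ h2
    _ = 32 * (2 * k ^ 3 * ((k ^ 3 + 3) / 4) ^ 3) := by ring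
    _ ≤ 32 * (220 ^ 4 * A.card) := Nat.mul_le_mul_left _ key
    _ = _ := by ring



/-- There exists `N` such that for every `n ∈ 3ℤ` with `n ≥ N`: if `H` is a
(1,3)-partite 4-graph with partition classes `Q, P`, `3|Q| = |P| = n`, and
`δ₁(H) ≥ (n/3)(C(n-1,2) - C(2n/3,2) + 1)`, then every balanced 4-element set `T`
(`|T ∩ Q| = 1`, `|T ∩ P| = 3`) has more than `10⁻⁸ n¹² / 12!` absorbing sets, i.e.
balanced 12-element sets `A` disjoint from `T` such that `H[A]` has a matching of size 3
and `H[A ∪ T]` has a matching of size 4. -/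
theorem many_absorbing_sets :
    ∃ N : ℕ, ∀ n : ℕ, 3 ∣ n → N ≤ n →
      ∀ (Q P : Finset (Fin (n + n / 3))) (H : Finset (Finset (Fin (n + n / 3)))),
        Disjoint Q P → Q ∪ P = Finset.univ →
        Q.card = n / 3 → P.card = n →
        (∀ e ∈ H, (e ∩ Q).card = 1 ∧ (e ∩ P).card = 3) →
        (∀ v : Fin (n + n / 3),
          n / 3 * (Nat.choose (n - 1) 2 - Nat.choose (2 * n / 3) 2 + 1) ≤
            (H.filter (fun e => v ∈ e)).card) →
        ∀ T : Finset (Fin (n + n / 3)),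
          T.card = 4 → (T ∩ Q).card = 1 → (T ∩ P).card = 3 →
          (10 : ℝ) ^ (-8 : ℤ) * (n : ℝ) ^ 12 / (Nat.factorial 12 : ℝ) <
            (({A : Finset (Fin (n + n / 3)) |
                A.card = 12 ∧ (A ∩ Q).card = 3 ∧ (A ∩ P).card = 9 ∧ Disjoint A T ∧
                (∃ M ⊆ H, M.card = 3 ∧ (∀ e ∈ M, e ⊆ A) ∧
                  ∀ e ∈ M, ∀ f ∈ M, e ≠ f → Disjoint e f) ∧
                (∃ M ⊆ H, M.card = 4 ∧ (∀ e ∈ M, e ⊆ A ∪ T) ∧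
                  ∀ e ∈ M, ∀ f ∈ M, e ≠ f → Disjoint e f)} :
              Set (Finset (Fin (n + n / 3)))).ncard : ℝ) := by
  refine ⟨3000, ?_⟩
  rintro n ⟨k, rfl⟩ hn Q P H hd hu hQ hP hH hdeg T hT hTQ hTP
  classical
  have e1 : 3 * k / 3 = k := by omega
  have e2 : 2 * (3 * k) / 3 = 2 * k := by omega
  have hk : 1000 ≤ k := by omega
  have hdeg' : ∀ v, 5 * k ^ 3 ≤ 2 * (H.filter (fun e => v ∈ e)).card + 7 * k ^ 2 := by
    intro v
    have h := hdeg v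
    rw [e2] at h
    refine aux_choose k _ (le_trans (Nat.mul_le_mul_right _ e1.ge) h)
  have hfin := Set.toFinite ({A : Finset (Fin (3 * k + 3 * k / 3)) |
                A.card = 12 ∧ (A ∩ Q).card = 3 ∧ (A ∩ P).card = 9 ∧ Disjoint A T ∧
                (∃ M ⊆ H, M.card = 3 ∧ (∀ e ∈ M, e ⊆ A) ∧
                  ∀ e ∈ M, ∀ f ∈ M, e ≠ f → Disjoint e f) ∧
                (∃ M ⊆ H, M.card = 4 ∧ (∀ e ∈ M, e ⊆ A ∪ T) ∧
                  ∀ e ∈ M, ∀ f ∈ M, e ≠ f → Disjoint e f)})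
  rw [Set.ncard_eq_toFinset_card _ hfin]
  have key := aux_main k hk Q P H hd hu (hQ.trans e1) hP hH hdeg' T hT hTQ hTP
    hfin.toFinset (by intro B; rw [Set.Finite.mem_toFinset]; rfl)
  generalize hfin.toFinset.card = c at *
  have key' : (k : ℝ) ^ 12 ≤ 32 * 220 ^ 4 * (c : ℝ) := by exact_mod_cast key
  have hk0 : (0 : ℝ) < (k : ℝ) ^ 12 := by
    have : (0 : ℝ) < k := by exact_mod_cast (by omega : 0 < k)
    positivity
  have hf : (Nat.factorial 12 : ℝ) = 479001600 := by norm_num [Nat.factorial]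
  rw [hf]
  push_cast
  rw [mul_pow]
  norm_num
  norm_num at key'
  nlinarith
end

section
/- There exists ε_0 > 0 such that for all ε, ρ with 0 < ε ≤ ε_0 and 0 < ρ < ε^{12} there exists N such that for every n ∈ 3ℤ with n ≥ N the following holds: let H be a (1,3)-partite 4-graph with partition classes Q, P, 3|Q| = |P| = n, such that d_H({u, v}) > C(n−1, 2) − C(2n/3, 2) − ρn² for all v ∈ Q and u ∈ P. If H contains no independent set S with |S ∩ Q| ≥ n/3 − ε²n and |S ∩ P| ≥ 2n/3 − ε²n, then H has a perfect fractional matching. -/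
section Helpers
open Finset

set_option maxHeartbeats 1000000 in
lemma core_sorted (m : ℕ) (r : ℝ) (c : ℕ → ℝ) (hm : 1 ≤ m) (hc : Antitone c)
    (h0 : ∀ k, 0 ≤ c k) (hT : ∑ k ∈ range (3*m), c k < m)
    (hE : 5 * (m:ℝ)^2 - r * (m:ℝ)^2 ≤
      (((range (3*m) ×ˢ range (3*m)).filter (fun p => 1 ≤ c p.1 + c p.2)).card : ℝ)) :
    (m:ℝ) - 2 * r * m ≤ ∑ k ∈ range (3*m), c k ∧
    (((range (3*m)).filter (fun k => 1/4 ≤ c k)).card : ℝ) ≤ m + 13 * r * m := by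
  -- find the non-edge on the antidiagonal
  obtain ⟨i, hi, hij⟩ : ∃ i, i < m ∧ c i + c (2*m-1-i) < 1 := by
    by_contra! hcon
    have h1 : ∑ k ∈ range (2*m), c k ≤ ∑ k ∈ range (3*m), c k :=
      sum_le_sum_of_subset_of_nonneg (by intro k; simp; omega) (fun k _ _ => h0 k)
    have h2 : ∑ k ∈ range (2*m), c (2*m-1-k) = ∑ k ∈ range (2*m), c k :=
      sum_range_reflect c (2*m)
    have h3 : ∑ k ∈ range (2*m), (1:ℝ) ≤ ∑ k ∈ range (2*m), (c k + c (2*m-1-k)) := by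
      apply sum_le_sum
      intro k hk
      rw [mem_range] at hk
      by_cases hkm : k < m
      · exact hcon k hkm
      · have := hcon (2*m-1-k) (by omega)
        rw [show 2*m-1-(2*m-1-k) = k by omega] at this
        linarith
    rw [sum_add_distrib, h2] at h3
    simp at h3
    linarith
  obtain ⟨d, hd, hd1⟩ : ∃ d, m = i + d ∧ 1 ≤ d := ⟨m - i, by omega, by omega⟩
  set j := 2*m-1-i with hj
  have hji : j = i + 2*d - 1 := by omega
  set n := 3*m with hn
  set NE := (range n ×ˢ range n).filter (fun p => ¬ (1 ≤ c p.1 + c p.2)) with hNE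
  set A := (range i ×ˢ Ico j n) with hA
  set B1 := Ico j n ×ˢ Ico i n with hB1
  set B2 := Ico i j ×ˢ Ico j n with hB2
  have hcard : (((range n ×ˢ range n).filter (fun p => 1 ≤ c p.1 + c p.2)).card : ℝ)
      + (NE.card : ℝ) = 9 * (m:ℝ)^2 := by
    have := card_filter_add_card_filter_not (s := range n ×ˢ range n) (fun p => 1 ≤ c p.1 + c p.2)
    rw [card_product, card_range] at this
    have h : (((range n ×ˢ range n).filter (fun p => 1 ≤ c p.1 + c p.2)).card : ℝ)
      + (NE.card : ℝ) = (n:ℝ) * n := by exact_mod_cast this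
    rw [h, hn]; push_cast; ring
  have hsub : (A.filter (fun p => ¬ (1 ≤ c p.1 + c p.2))) ∪ (B1 ∪ B2) ⊆ NE := by
    have key : ∀ p q, i ≤ p → j ≤ q → c p + c q < 1 := fun p q hp hq =>
      lt_of_le_of_lt (add_le_add (hc hp) (hc hq)) hij
    rintro ⟨p, q⟩ h
    simp only [hA, hB1, hB2, hNE, mem_union, mem_filter, mem_product, mem_range, mem_Ico] at h ⊢
    rcases h with h | h | h
    · exact ⟨⟨by omega, by omega⟩, h.2⟩
    · refine ⟨⟨by omega, by omega⟩, ?_⟩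
      have := key q p h.2.1 h.1.1
      linarith
    · refine ⟨⟨by omega, by omega⟩, ?_⟩
      have := key p q h.1.1 h.2.1
      linarith
  have hdis2 : Disjoint B1 B2 := by
    rw [Finset.disjoint_left]
    rintro ⟨p, q⟩ h1 h2
    simp only [hB1, hB2, mem_product, mem_Ico] at h1 h2
    omega
  have hdis1 : Disjoint (A.filter (fun p => ¬ (1 ≤ c p.1 + c p.2))) (B1 ∪ B2) := by
    rw [Finset.disjoint_left]
    rintro ⟨p, q⟩ h1 h2
    simp only [hA, hB1, hB2, mem_product, mem_Ico, mem_union, mem_filter, mem_range] at h1 h2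
    omega
  have hc1 := card_le_card hsub
  rw [card_union_of_disjoint hdis1, card_union_of_disjoint hdis2] at hc1
  have hi1 : (i:ℝ) = m - d := by rw [hd]; push_cast; ring
  have hL : ((n - j : ℕ) : ℝ) = 2 * m - d + 1 := by
    have : n - j + d = 2 * m + 1 := by omega
    have : ((n - j : ℕ) : ℝ) + d = 2 * m + 1 := by exact_mod_cast this
    linarith
  have hB1c : (B1.card : ℝ) = (2*m - d + 1) * (2 * m + d) := by
    rw [hB1, card_product, Nat.card_Ico, Nat.card_Ico]
    push_cast [hL]
    congr 1
    have : n - i = 2 * m + d := by omega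
    rw [this]; push_cast; ring
  have hB2c : (B2.card : ℝ) = (2*m - d + 1) * (2 * d - 1) := by
    rw [hB2, card_product, Nat.card_Ico, Nat.card_Ico]
    push_cast [hL]
    rw [mul_comm]
    congr 1
    have : j - i + 1 = 2 * d := by omega
    have : ((j - i : ℕ):ℝ) + 1 = 2 * d := by exact_mod_cast this
    linarith
  have hc1' : ((A.filter (fun p => ¬ (1 ≤ c p.1 + c p.2))).card : ℝ) + (B1.card + B2.card)
      ≤ NE.card := by exact_mod_cast hc1
  rw [hB1c, hB2c] at hc1'
  have hdm : (d:ℝ) ≤ m := by exact_mod_cast (by omega : d ≤ m)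
  have hd1' : (1:ℝ) ≤ d := by exact_mod_cast hd1
  have hm0 : (0:ℝ) < m := by linarith
  set a := ((A.filter (fun p => ¬ (1 ≤ c p.1 + c p.2))).card : ℝ) with ha
  have ha0 : 0 ≤ a := by positivity
  have hmain : a + (m:ℝ) * d ≤ r * (m:ℝ)^2 := by
    have := mul_le_mul_of_nonneg_left hdm (by linarith : (0:ℝ) ≤ d)
    nlinarith only [this, hc1', hE, hcard, hd1']
  have hdr : (d:ℝ) ≤ r * m := by
    have : (m:ℝ) * d ≤ m * (r * m) := by linarith
    exact le_of_mul_le_mul_left this hm0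
  have har : a ≤ r * (m:ℝ)^2 := by linarith [mul_nonneg hm0.le (by linarith : (0:ℝ) ≤ d)]
  -- double counting
  set X := ∑ p ∈ range i, c p with hX
  set Y := ∑ q ∈ Ico j n, c q with hY
  set T := ∑ k ∈ range n, c k with hTdef
  have hXY : X + Y ≤ T := by
    rw [hX, hY, ← sum_union]
    · apply sum_le_sum_of_subset_of_nonneg
      · intro k hk
        simp only [mem_union, mem_range, mem_Ico] at hk ⊢
        omega
      · exact fun k _ _ => h0 k
    · rw [Finset.disjoint_left]
      intro k h1 h2
      simp only [mem_range, mem_Ico] at h1 h2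
      omega
  have hY0 : 0 ≤ Y := sum_nonneg (fun k _ => h0 k)
  have hsum : ∑ p ∈ A, (c p.1 + c p.2) = (2*m-d+1) * X + (m-d) * Y := by
    rw [hA, sum_product]
    simp only [sum_add_distrib, sum_const, card_range, Nat.card_Ico, nsmul_eq_mul, hL, ← hi1,
      ← hY, ← mul_sum, ← hX]
  have hAc : (A.card : ℝ) = (m-d) * (2*m-d+1) := by
    rw [hA, card_product, card_range, Nat.card_Ico]
    push_cast [hL, hi1]; ring
  have hAe : (m-d) * (2*m-d+1) - a ≤ ∑ p ∈ A, (c p.1 + c p.2) := by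
    have h1 : ((A.filter (fun p => 1 ≤ c p.1 + c p.2)).card : ℝ) + a = A.card := by
      rw [ha]
      exact_mod_cast card_filter_add_card_filter_not (s := A) (fun p => 1 ≤ c p.1 + c p.2)
    have h2 : ((A.filter (fun p => 1 ≤ c p.1 + c p.2)).card : ℝ) ≤ ∑ p ∈ A, (c p.1 + c p.2) := by
      rw [card_filter]
      push_cast
      apply sum_le_sum
      intro p _
      split_ifs with h
      · exact h
      · exact add_nonneg (h0 _) (h0 _)
    linarith
  rw [hsum] at hAe
  have hbig : ((m:ℝ) + 1) * Y + (m-d) * (2*m-d+1) ≤ (2*m-d+1) * T + r * (m:ℝ)^2 := by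
    have : (2*(m:ℝ)-d+1) * (X + Y) ≤ (2*m-d+1) * T :=
      mul_le_mul_of_nonneg_left hXY (by linarith)
    linarith
  have hr0 : 0 ≤ r * m := by linarith
  constructor
  · have h1 : (2*(m:ℝ)-d+1) * (m - d - T) ≤ (r * m) * m := by linarith [mul_nonneg (by linarith : (0:ℝ) ≤ m + 1) hY0]
    by_contra! hcon
    have h2 : r * m < m - d - T := by linarith
    have h3 : (r*m) * m ≤ (r * m) * (2*(m:ℝ)-d+1) := mul_le_mul_of_nonneg_left (by linarith) hr0
    have h4 : (r * m) * (2*(m:ℝ)-d+1) < (m - d - T) * (2*(m:ℝ)-d+1) :=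
      mul_lt_mul_of_pos_right h2 (by linarith)
    linarith
  · have hY3 : Y ≤ 3 * (r * m) := by
      have h1 : (m:ℝ) * Y ≤ (2*(m:ℝ)-d+1) * (T - (m - d)) + r * m * m := by linarith
      have h2 : (2*(m:ℝ)-d+1) * (T - (m - d)) ≤ (2*(m:ℝ)-d+1) * (r * m) :=
        mul_le_mul_of_nonneg_left (by linarith) (by linarith)
      have h3 : (2*(m:ℝ)-d+1) * (r * m) ≤ 2 * m * (r * m) :=
        mul_le_mul_of_nonneg_right (by linarith) hr0
      have : (m:ℝ) * Y ≤ m * (3 * (r * m)) := by linarith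
      exact le_of_mul_le_mul_left this hm0
    have hs : (range n).filter (fun k => 1/4 ≤ c k) ⊆
        range j ∪ (Ico j n).filter (fun k => 1/4 ≤ c k) := by
      intro k hk
      simp only [mem_union, mem_filter, mem_range, mem_Ico] at hk ⊢
      by_cases h : k < j
      · exact Or.inl h
      · exact Or.inr ⟨⟨by omega, hk.1⟩, hk.2⟩
    have hs1 := (card_le_card hs).trans (card_union_le _ _)
    rw [card_range] at hs1
    have hs2 : (((range n).filter (fun k => 1/4 ≤ c k)).card : ℝ) ≤
      j + (((Ico j n).filter (fun k => 1/4 ≤ c k)).card : ℝ) := by exact_mod_cast hs1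
    have hs3 : (((Ico j n).filter (fun k => 1/4 ≤ c k)).card : ℝ) ≤ 4 * Y := by
      rw [card_filter, hY, mul_sum]
      push_cast
      apply sum_le_sum
      intro p _
      split_ifs with h
      · linarith
      · linarith [h0 p]
    have hjr : (j:ℝ) ≤ m + d := by exact_mod_cast (by omega : j ≤ m + d)
    linarith

lemma core_fin {n : ℕ} (m : ℕ) (hn : n = 3 * m) (r : ℝ) (c : Fin n → ℝ) (hm : 1 ≤ m)
    (h0 : ∀ k, 0 ≤ c k) (hT : ∑ k, c k < m)
    (hE : 5 * (m:ℝ)^2 - r * (m:ℝ)^2 ≤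
      ((univ.filter (fun p : Fin n × Fin n => 1 ≤ c p.1 + c p.2)).card : ℝ)) :
    (m:ℝ) - 2 * r * m ≤ ∑ k, c k ∧
    ((univ.filter (fun k => 1/4 ≤ c k)).card : ℝ) ≤ m + 13 * r * m := by
  let σ := Tuple.sort (fun k => - c k)
  have hσ : Monotone ((fun k => - c k) ∘ σ) := Tuple.monotone_sort _
  let b : ℕ → ℝ := fun k => if h : k < n then c (σ ⟨k, h⟩) else 0
  have hb0 : ∀ k, 0 ≤ b k := by
    intro k; simp only [b]; split_ifs
    · exact h0 _
    · exact le_rfl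
  have hb : Antitone b := by
    intro p q hpq
    simp only [b]
    split_ifs with h1 h2 h2
    · have := hσ (show (⟨p, h2⟩ : Fin n) ≤ ⟨q, h1⟩ from hpq)
      simpa using this
    · omega
    · exact h0 _
    · exact le_rfl
  have hbv : ∀ k : Fin n, b k = c (σ k) := by
    intro k; simp [b]
  have hs : ∀ g : ℝ → ℝ, ∑ k ∈ range (3*m), g (b k) = ∑ k, g (c k) := by
    intro g
    rw [← hn, ← Fin.sum_univ_eq_sum_range (fun k => g (b k)) n, ← Equiv.sum_comp σ (fun k => g (c k))]
    simp only [hbv]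
  have h1 := hs id
  simp only [id] at h1
  have h2 : (((range (3*m)).filter (fun k => 1/4 ≤ b k)).card : ℝ) =
      ((univ.filter (fun k => 1/4 ≤ c k)).card : ℝ) := by
    rw [card_filter, card_filter]
    push_cast
    exact hs (fun x => if 1/4 ≤ x then 1 else 0)
  have h3 : (((range (3*m) ×ˢ range (3*m)).filter (fun p => 1 ≤ b p.1 + b p.2)).card : ℝ) =
      ((univ.filter (fun p : Fin n × Fin n => 1 ≤ c p.1 + c p.2)).card : ℝ) := by
    rw [card_filter, card_filter]
    push_cast
    rw [sum_product, ← univ_product_univ, sum_product]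
    rw [← hs (fun x => ∑ y, if 1 ≤ x + c y then 1 else 0)]
    apply sum_congr rfl
    intro p _
    exact hs (fun y => if 1 ≤ b p + y then 1 else 0)
  rw [← h1, ← h2]
  refine core_sorted m r b hm hb hb0 (by rw [h1]; exact hT) (by rw [h3]; exact hE)

lemma core_set {V : Type*} [DecidableEq V] (P : Finset V) (m : ℕ) (hP : P.card = 3 * m) (r : ℝ)
    (c : V → ℝ) (hm : 1 ≤ m) (h0 : ∀ k ∈ P, 0 ≤ c k) (hT : ∑ k ∈ P, c k < m)
    (hE : 5 * (m:ℝ)^2 - r * (m:ℝ)^2 ≤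
      (((P ×ˢ P).filter (fun p => 1 ≤ c p.1 + c p.2)).card : ℝ)) :
    (m:ℝ) - 2 * r * m ≤ ∑ k ∈ P, c k ∧
    ((P.filter (fun k => 1/4 ≤ c k)).card : ℝ) ≤ m + 13 * r * m := by
  let σ : Fin P.card ≃ P := P.equivFin.symm
  have hs : ∀ g : V → ℝ, ∑ k, g (σ k) = ∑ k ∈ P, g k := by
    intro g
    rw [Equiv.sum_comp σ (fun k : P => g k), sum_coe_sort]
  have h1 := hs c
  have h2 : ((univ.filter (fun k => 1/4 ≤ c (σ k))).card : ℝ) =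
      ((P.filter (fun k => 1/4 ≤ c k)).card : ℝ) := by
    rw [card_filter, card_filter]
    push_cast
    exact hs (fun x => if 1/4 ≤ c x then 1 else 0)
  have h3 : ((univ.filter (fun p : Fin P.card × Fin P.card =>
        1 ≤ c (σ p.1) + c (σ p.2))).card : ℝ) =
      (((P ×ˢ P).filter (fun p => 1 ≤ c p.1 + c p.2)).card : ℝ) := by
    rw [card_filter, card_filter]
    push_cast
    rw [sum_product, ← univ_product_univ, sum_product]
    rw [← hs (fun x => ∑ y ∈ P, if 1 ≤ c x + c y then 1 else 0)]
    apply sum_congr rfl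
    intro p _
    exact hs (fun y => if 1 ≤ c (σ p) + c y then 1 else 0)
  rw [← h1, ← h2]
  refine core_fin m hP r (fun k => c (σ k)) hm (fun k => h0 _ (σ k).2) (by rw [h1]; exact hT)
    (by rw [h3]; exact hE)

/-- Separation: either a perfect fractional matching or a separating weight. -/
lemma separation {V : Type*} [Fintype V] [DecidableEq V] (H : Finset (Finset V))
    (m : ℕ) (hm : 1 ≤ m)
    (hne : ∀ e ∈ H, e.Nonempty)
    (hno : ¬ ∃ w : Finset V → ℝ, (∀ e ∈ H, 0 ≤ w e ∧ w e ≤ 1) ∧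
      (∀ v : V, ∑ e ∈ H.filter (fun e => v ∈ e), w e ≤ 1) ∧ ∑ e ∈ H, w e = m) :
    ∃ (y : V → ℝ) (u : ℝ), ∑ v, y v < m * u ∧ ∀ e ∈ H, u < ∑ v ∈ e, y v := by
  have hm0 : (0:ℝ) < m := by exact_mod_cast hm
  let ind : Finset V → (V → ℝ) := fun e v => if v ∈ e then 1 else 0
  have hinj : Function.Injective ind := by
    intro e f h
    ext v
    have := congrFun h v
    simp only [ind] at this
    by_cases h1 : v ∈ e <;> by_cases h2 : v ∈ f <;> simp_all
  let p : V → ℝ := fun _ => 1 / m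
  have hp : p ∉ convexHull ℝ ((H.image ind : Finset (V → ℝ)) : Set (V → ℝ)) := by
    intro hp
    rw [Finset.mem_convexHull'] at hp
    obtain ⟨w, hw0, hw1, hw2⟩ := hp
    rw [sum_image hinj.injOn] at hw1 hw2
    have hv : ∀ v : V, ∑ e ∈ H.filter (fun e => v ∈ e), m * w (ind e) = 1 := by
      intro v
      have := congrFun hw2 v
      simp only [Finset.sum_apply, Pi.smul_apply, smul_eq_mul, ind, p, mul_ite, mul_one, mul_zero] at this
      rw [← mul_sum, sum_filter, this]
      field_simp
    have hpos : ∀ e ∈ H, 0 ≤ m * w (ind e) := fun e he =>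
      mul_nonneg hm0.le (hw0 _ (mem_image_of_mem _ he))
    refine hno ⟨fun e => m * w (ind e), ?_, fun v => (hv v).le, ?_⟩
    · intro e he
      refine ⟨hpos e he, ?_⟩
      obtain ⟨v, hve⟩ := hne e he
      rw [← hv v]
      exact single_le_sum (f := fun e => m * w (ind e)) 
        (fun f hf => hpos f (mem_filter.1 hf).1) (mem_filter.2 ⟨he, hve⟩)
    · rw [← mul_sum, hw1, mul_one]
  obtain ⟨f, u, hfp, hfu⟩ := geometric_hahn_banach_point_closed (convex_convexHull ℝ _)
    ((H.image ind).finite_toSet.isClosed_convexHull ℝ) hp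
  let y : V → ℝ := fun v => f (fun j => if v = j then 1 else 0)
  have hf : ∀ z : V → ℝ, f z = ∑ v, z v * y v := by
    intro z
    have := LinearMap.pi_apply_eq_sum_univ (f : (V → ℝ) →ₗ[ℝ] ℝ) z
    simpa [y] using this
  refine ⟨y, u, ?_, ?_⟩
  · rw [hf] at hfp
    simp only [p] at hfp
    rw [← mul_sum, one_div, inv_mul_lt_iff₀ hm0] at hfp
    exact hfp
  · intro e he
    have := hfu (ind e) (subset_convexHull ℝ _ (by exact_mod_cast mem_image_of_mem _ he))
    rw [hf] at this
    simpa [ind, Finset.sum_ite_mem] using this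

lemma degree_count {V : Type*} [DecidableEq V] (Q P : Finset V) (H : Finset (Finset V))
    (hpart : ∀ e ∈ H, (e ∩ Q).card = 1 ∧ (e ∩ P).card = 3) (hdis : Disjoint Q P)
    (hcov : ∀ v, v ∈ Q ∪ P) (v₀ u₀ : V) (hv₀ : v₀ ∈ Q) (hu₀ : u₀ ∈ P) (y : V → ℝ) (u : ℝ)
    (hy : ∀ e ∈ H, u < ∑ v ∈ e, y v) :
    2 * (H.filter (fun e => u₀ ∈ e ∧ v₀ ∈ e)).card ≤
      ((P ×ˢ P).filter (fun p => u ≤ y v₀ + y u₀ + y p.1 + y p.2)).card := by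
  have := Finset.card_mul_le_card_mul (s := H.filter (fun e => u₀ ∈ e ∧ v₀ ∈ e))
    (t := (P ×ˢ P).filter (fun p => u ≤ y v₀ + y u₀ + y p.1 + y p.2))
    (fun e p => e = {v₀, u₀, p.1, p.2}) (m := 2) (n := 1) ?_ ?_
  · omega
  · intro e he
    rw [mem_filter] at he
    obtain ⟨heH, hu, hv⟩ := he
    obtain ⟨h1, h3⟩ := hpart e heH
    have heQ : e ∩ Q = {v₀} := by
      obtain ⟨z, hz⟩ := card_eq_one.1 h1
      have : v₀ ∈ e ∩ Q := mem_inter.2 ⟨hv, hv₀⟩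
      rw [hz, mem_singleton] at this
      rw [hz, this]
    have h2 : ((e ∩ P).erase u₀).card = 2 := by
      rw [card_erase_of_mem (mem_inter.2 ⟨hu, hu₀⟩), h3]
    obtain ⟨p, q, hpq, hE⟩ := card_eq_two.1 h2
    have heP : e ∩ P = insert u₀ {p, q} := by
      rw [← hE, insert_erase (mem_inter.2 ⟨hu, hu₀⟩)]
    have heq : e = {v₀, u₀, p, q} := by
      have : e = (e ∩ Q) ∪ (e ∩ P) := by
        rw [← inter_union_distrib_left]
        exact (inter_eq_left.2 (fun v _ => hcov v)).symm
      rw [this, heQ, heP]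
      rfl
    have hpm : p ∈ (e ∩ P).erase u₀ := by rw [hE]; simp
    have hqm : q ∈ (e ∩ P).erase u₀ := by rw [hE]; simp
    simp only [mem_erase, mem_inter] at hpm hqm
    have hvP : ∀ z ∈ P, v₀ ≠ z := fun z hz h => disjoint_left.1 hdis hv₀ (h ▸ hz)
    have hsum := hy e heH
    rw [heq, sum_insert, sum_insert, sum_pair hpq] at hsum
    rotate_left
    · simp only [mem_insert, mem_singleton, not_or]
      exact ⟨hpm.1.symm, hqm.1.symm⟩
    · simp only [mem_insert, mem_singleton, not_or]
      exact ⟨hvP _ hu₀, hvP _ hpm.2.2, hvP _ hqm.2.2⟩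
    have hne : (p, q) ≠ (q, p) := fun h => hpq (congrArg Prod.fst h)
    rw [← card_pair hne]
    apply card_le_card
    intro z hz
    rw [mem_insert, mem_singleton] at hz
    rw [mem_bipartiteAbove, mem_filter, mem_product]
    rcases hz with rfl | rfl
    · exact ⟨⟨⟨hpm.2.2, hqm.2.2⟩, by dsimp only; linarith⟩, heq⟩
    · exact ⟨⟨⟨hqm.2.2, hpm.2.2⟩, by dsimp only; linarith⟩, by rw [heq, pair_comm p q]⟩
  · intro b _
    rw [card_le_one]
    intro e he f hf
    rw [mem_bipartiteBelow] at he hf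
    rw [he.2, hf.2]

lemma main_lemma {V : Type*} [Fintype V] [DecidableEq V] (Q P : Finset V)
    (H : Finset (Finset V)) (m : ℕ) (hm : 1 ≤ m) (r : ℝ)
    (hpart : ∀ e ∈ H, (e ∩ Q).card = 1 ∧ (e ∩ P).card = 3) (hdis : Disjoint Q P)
    (hcov : Q ∪ P = univ) (hQ : Q.card = m) (hP : P.card = 3 * m)
    (hdeg : ∀ v ∈ Q, ∀ u ∈ P, 5 * (m:ℝ)^2 - r * (m:ℝ)^2 ≤
      2 * ((H.filter (fun e => u ∈ e ∧ v ∈ e)).card : ℝ))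
    (hno : ¬ ∃ w : Finset V → ℝ, (∀ e ∈ H, 0 ≤ w e ∧ w e ≤ 1) ∧
      (∀ v : V, ∑ e ∈ H.filter (fun e => v ∈ e), w e ≤ 1) ∧ ∑ e ∈ H, w e = m) :
    ∃ S : Finset V, (∀ e ∈ H, ¬ e ⊆ S) ∧ (m:ℝ) - 8 * r * m ≤ ((S ∩ Q).card : ℝ) ∧
      2 * (m:ℝ) - 13 * r * m ≤ ((S ∩ P).card : ℝ) := by
  have hm0 : (0:ℝ) < m := by exact_mod_cast hm
  obtain ⟨y, u, hyu, hy⟩ := separation H m hm (by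
    intro e he
    have h := (hpart e he).1
    have : (e ∩ Q).Nonempty := card_pos.1 (by omega)
    exact this.mono inter_subset_left) hno
  obtain ⟨v₀, hv₀, hvmin⟩ := exists_min_image Q y (card_pos.1 (by omega))
  obtain ⟨u₀, hu₀, humin⟩ := exists_min_image P y (card_pos.1 (by omega))
  obtain ⟨D, hD⟩ : ∃ D, D = u - y v₀ - 3 * y u₀ := ⟨_, rfl⟩
  have hsplit : ∑ v, y v = ∑ v ∈ Q, y v + ∑ v ∈ P, y v := by
    rw [← hcov, sum_union hdis]
  have hSQ : ∑ v ∈ Q, (y v - y v₀) = ∑ v ∈ Q, y v - m * y v₀ := by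
    rw [sum_sub_distrib, sum_const, hQ, nsmul_eq_mul]
  have hSP : ∑ v ∈ P, (y v - y u₀) = ∑ v ∈ P, y v - 3 * m * y u₀ := by
    rw [sum_sub_distrib, sum_const, hP, nsmul_eq_mul]; push_cast; ring
  have hSQ0 : 0 ≤ ∑ v ∈ Q, (y v - y v₀) := sum_nonneg fun v hv => sub_nonneg.2 (hvmin v hv)
  have hSP0 : 0 ≤ ∑ v ∈ P, (y v - y u₀) := sum_nonneg fun v hv => sub_nonneg.2 (humin v hv)
  have htot : ∑ v ∈ Q, (y v - y v₀) + ∑ v ∈ P, (y v - y u₀) < m * D := by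
    rw [hSQ, hSP, hD]
    linarith
  have hD0 : 0 < D := by
    by_contra! h
    have := mul_nonpos_of_nonneg_of_nonpos hm0.le h
    linarith
  set a : V → ℝ := fun v => (y v - y v₀) / D with ha
  set c : V → ℝ := fun v => (y v - y u₀) / D with hc
  have htot' : ∑ v ∈ Q, a v + ∑ v ∈ P, c v < m := by
    rw [ha, hc, ← sum_div, ← sum_div, ← add_div, div_lt_iff₀ hD0]
    exact htot
  have ha0 : ∀ v ∈ Q, 0 ≤ a v := fun v hv => div_nonneg (sub_nonneg.2 (hvmin v hv)) hD0.le
  have hc0 : ∀ v ∈ P, 0 ≤ c v := fun v hv => div_nonneg (sub_nonneg.2 (humin v hv)) hD0.le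
  have hE : 5 * (m:ℝ)^2 - r * (m:ℝ)^2 ≤
      (((P ×ˢ P).filter (fun p => 1 ≤ c p.1 + c p.2)).card : ℝ) := by
    have h1 := degree_count Q P H hpart hdis (fun v => by rw [hcov]; exact mem_univ v)
      v₀ u₀ hv₀ hu₀ y u hy
    have h2 : (P ×ˢ P).filter (fun p => u ≤ y v₀ + y u₀ + y p.1 + y p.2) =
        (P ×ˢ P).filter (fun p => 1 ≤ c p.1 + c p.2) := by
      apply filter_congr
      intro p _
      rw [hc]
      dsimp only
      rw [← add_div, le_div_iff₀ hD0, hD]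
      constructor <;> intro h <;> linarith
    rw [h2] at h1
    refine (hdeg v₀ hv₀ u₀ hu₀).trans ?_
    exact_mod_cast h1
  obtain ⟨hT, hcard⟩ := core_set P m hP r c hm hc0 (by linarith [sum_nonneg ha0]) hE
  have hQc : ((Q.filter (fun v => 1/4 ≤ a v)).card : ℝ) ≤ 8 * r * m := by
    have : ((Q.filter (fun v => 1/4 ≤ a v)).card : ℝ) ≤ 4 * ∑ v ∈ Q, a v := by
      rw [card_filter, mul_sum]
      push_cast
      apply sum_le_sum
      intro p hp
      split_ifs with h
      · linarith
      · linarith [ha0 p hp]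
    linarith
  refine ⟨Q.filter (fun v => ¬ 1/4 ≤ a v) ∪ P.filter (fun v => ¬ 1/4 ≤ c v), ?_, ?_, ?_⟩
  · intro e he hsub
    have hs : ∑ v ∈ e, y v = ∑ v ∈ e ∩ Q, y v + ∑ v ∈ e ∩ P, y v := by
      rw [← sum_union]
      · rw [← inter_union_distrib_left, hcov, inter_univ]
      · exact hdis.mono inter_subset_right inter_subset_right
    have h1 : ∑ v ∈ e ∩ Q, y v ≤ (e ∩ Q).card • (y v₀ + D / 4) := by
      apply sum_le_card_nsmul
      intro v hv
      rw [mem_inter] at hv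
      have := hsub hv.1
      rw [mem_union, mem_filter, mem_filter] at this
      rcases this with h | h
      · have h := not_le.1 h.2
        rw [ha] at h
        dsimp only at h
        rw [div_lt_iff₀ hD0] at h
        linarith
      · exact absurd h.1 (disjoint_left.1 hdis hv.2)
    have h2 : ∑ v ∈ e ∩ P, y v ≤ (e ∩ P).card • (y u₀ + D / 4) := by
      apply sum_le_card_nsmul
      intro v hv
      rw [mem_inter] at hv
      have := hsub hv.1
      rw [mem_union, mem_filter, mem_filter] at this
      rcases this with h | h
      · exact absurd hv.2 (disjoint_left.1 hdis h.1)
      · have h := not_le.1 h.2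
        rw [hc] at h
        dsimp only at h
        rw [div_lt_iff₀ hD0] at h
        linarith
    rw [(hpart e he).1, nsmul_eq_mul] at h1
    rw [(hpart e he).2, nsmul_eq_mul] at h2
    push_cast at h1 h2
    have := hy e he
    linarith
  · have h1 : ((Q.filter (fun v => 1/4 ≤ a v)).card : ℝ) +
        ((Q.filter (fun v => ¬ 1/4 ≤ a v)).card : ℝ) = m := by
      rw [← hQ]
      exact_mod_cast card_filter_add_card_filter_not (s := Q) (fun v => 1/4 ≤ a v)
    have h2 : ((Q.filter (fun v => ¬ 1/4 ≤ a v)).card : ℝ) ≤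
      (((Q.filter (fun v => ¬ 1/4 ≤ a v) ∪ P.filter (fun v => ¬ 1/4 ≤ c v)) ∩ Q).card : ℝ) := by
      exact_mod_cast card_le_card (subset_inter subset_union_left (filter_subset _ _))
    linarith
  · have h1 : ((P.filter (fun v => 1/4 ≤ c v)).card : ℝ) +
        ((P.filter (fun v => ¬ 1/4 ≤ c v)).card : ℝ) = 3 * m := by
      have : (P.card : ℝ) = 3 * m := by rw [hP]; push_cast; ring
      rw [← this]
      exact_mod_cast card_filter_add_card_filter_not (s := P) (fun v => 1/4 ≤ c v)
    have h2 : ((P.filter (fun v => ¬ 1/4 ≤ c v)).card : ℝ) ≤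
      (((Q.filter (fun v => ¬ 1/4 ≤ a v) ∪ P.filter (fun v => ¬ 1/4 ≤ c v)) ∩ P).card : ℝ) := by
      exact_mod_cast card_le_card (subset_inter subset_union_right (filter_subset _ _))
    linarith

end Helpers

/-- There exists `ε₀ > 0` such that for all `0 < ε ≤ ε₀` and `0 < ρ < ε¹²`
there exists `N` such that for every `n ∈ 3ℤ` with `n ≥ N`: let `H` be a (1,3)-partite
4-graph with classes `Q, P`, `3|Q| = |P| = n`, with
`d_H({u,v}) > C(n-1,2) - C(2n/3,2) - ρn²` for all `v ∈ Q`, `u ∈ P`. If `H` contains no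
independent set `S` with `|S ∩ Q| ≥ n/3 - ε²n` and `|S ∩ P| ≥ 2n/3 - ε²n`, then `H` has
a perfect fractional matching (total weight `|V(H)|/4`). -/
theorem perfect_fractional_matching :
    ∃ ε₀ : ℝ, 0 < ε₀ ∧ ∀ ε ρ : ℝ, 0 < ε → ε ≤ ε₀ → 0 < ρ → ρ < ε ^ 12 →
      ∃ N : ℕ, ∀ n : ℕ, 3 ∣ n → N ≤ n →
        ∀ (Q P : Finset (Fin (n + n / 3))) (H : Finset (Finset (Fin (n + n / 3)))),
          Disjoint Q P → Q ∪ P = Finset.univ →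
          Q.card = n / 3 → P.card = n →
          (∀ e ∈ H, (e ∩ Q).card = 1 ∧ (e ∩ P).card = 3) →
          (∀ v ∈ Q, ∀ u ∈ P,
            (Nat.choose (n - 1) 2 : ℝ) - (Nat.choose (2 * n / 3) 2 : ℝ) - ρ * (n : ℝ) ^ 2 <
              ((H.filter (fun e => u ∈ e ∧ v ∈ e)).card : ℝ)) →
          (¬ ∃ S : Finset (Fin (n + n / 3)),
            (∀ e ∈ H, ¬ e ⊆ S) ∧
            (n : ℝ) / 3 - ε ^ 2 * (n : ℝ) ≤ ((S ∩ Q).card : ℝ) ∧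
            2 * (n : ℝ) / 3 - ε ^ 2 * (n : ℝ) ≤ ((S ∩ P).card : ℝ)) →
          ∃ w : Finset (Fin (n + n / 3)) → ℝ,
            (∀ e ∈ H, 0 ≤ w e ∧ w e ≤ 1) ∧
            (∀ v : Fin (n + n / 3), ∑ e ∈ H.filter (fun e => v ∈ e), w e ≤ 1) ∧
            ∑ e ∈ H, w e = ((n + n / 3 : ℕ) : ℝ) / 4 := by
  refine ⟨1/2, by norm_num, ?_⟩
  intro ε ρ hε hε2 hρ hρε
  obtain ⟨N, hN⟩ := exists_nat_ge (3 / ρ)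
  refine ⟨N + 1, ?_⟩
  intro n h3 hNn Q P H hdis hcov hQ hP hpart hdeg hind
  obtain ⟨m, rfl⟩ := h3
  have hm : 1 ≤ m := by omega
  have hdiv : 3 * m / 3 = m := by omega
  have hdiv2 : 2 * (3 * m) / 3 = 2 * m := by omega
  have hm0 : (1:ℝ) ≤ m := by exact_mod_cast hm
  have hbig : 3 ≤ 3 * ρ * m := by
    have h1 : 3 / ρ ≤ (3 * m : ℕ) := hN.trans (by exact_mod_cast (by omega : N ≤ 3 * m))
    rw [div_le_iff₀ hρ] at h1
    push_cast at h1
    linarith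
  have htarget : ((3 * m + 3 * m / 3 : ℕ) : ℝ) / 4 = m := by
    rw [hdiv]; push_cast; ring
  by_contra hno
  rw [htarget] at hno
  have hc1 : ((Nat.choose (3 * m - 1) 2 : ℕ) : ℝ) = (3 * m - 1) * (3 * m - 2) / 2 := by
    rw [Nat.cast_choose_two, Nat.cast_sub (by omega)]
    push_cast; ring
  have hc2 : ((Nat.choose (2 * m) 2 : ℕ) : ℝ) = 2 * m * (2 * m - 1) / 2 := by
    rw [Nat.cast_choose_two]; push_cast; ring
  obtain ⟨S, hS, hSQ, hSP⟩ := main_lemma Q P H m hm (27 * ρ) hpart hdis hcov (hQ.trans hdiv) hP (by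
    intro v hv u hu
    have h := hdeg v hv u hu
    rw [hdiv2, hc1, hc2] at h
    push_cast at h
    nlinarith) hno
  have hρ2 : 351 * ρ ≤ 3 * ε ^ 2 := by
    have h10 : ε ^ 10 ≤ (1/2) ^ 10 := pow_le_pow_left₀ hε.le hε2 10
    have h12 : ε ^ 12 = ε ^ 2 * ε ^ 10 := by ring
    have : ε ^ 12 ≤ ε ^ 2 * (1/2) ^ 10 := by
      rw [h12]; exact mul_le_mul_of_nonneg_left h10 (by positivity)
    have h2 : 0 ≤ ε ^ 2 := by positivity
    norm_num at this
    linarith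
  have hρm := mul_le_mul_of_nonneg_right hρ2 (by linarith : (0:ℝ) ≤ m)
  have hρm0 : 0 ≤ ρ * m := by positivity
  refine hind ⟨S, hS, ?_, ?_⟩
  · push_cast
    linarith
  · push_cast
    linarith
end
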